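/- Existence of conformal harmonic boundary coordinates with prescribed boundary trace (Theorem 2.3, part (3), coordinate version): Let n ≥ 3, k ∈ ℕ with k ≥ 2, and α ∈ (0,1). Let g be a metric of class C^{k+α} on an open neighborhood Ω of 0 in ℝⁿ. For ε > 0 set D_ε = B̄(0,ε) ∩ {xⁿ ≥ 0} and Γ_ε = D_ε ∩ {xⁿ = 0}. Then there exist ε > 0 with D_ε ⊆ Ω and functions f¹, …, fⁿ, f of class C^{k+α} on an open neighborhood of D_ε such that: f > 0 on D_ε; L_g f¹ = ⋯ = L_g fⁿ = L_g f = 0 on D_ε; the map Z := (f¹/f, …, fⁿ/f) satisfies DZ(0) = Id; the restriction of Z to the relatively open half-ball D_ε ∖ Γ_ε extends to a map of class C^{k+1+α} on an open neighborhood of 0 in ℝⁿ; Z(Γ_ε) ⊆ {xⁿ = 0}; and on Γ_ε one has Z^j = x^j for j = 1, …, n−1 and Zⁿ = 0. -/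

import Mathlib

noncomputable section

open Set Matrix Matrix

/-- Points of `ℝⁿ`. -/
abbrev Pt (n : ℕ) := Fin n → ℝ

/-- A metric in coordinates: a matrix-valued map. -/
abbrev Met (n : ℕ) := Pt n → Matrix (Fin n) (Fin n) ℝ

/-- Partial derivative of `f` in the `a`-th coordinate direction. -/
def pd {n : ℕ} (a : Fin n) (f : Pt n → ℝ) (x : Pt n) : ℝ :=
  fderiv ℝ f x (Pi.single a 1)

/-- `g` is a metric (pointwise symmetric positive definite) on `U`. -/
def IsMetricOn {n : ℕ} (g : Met n) (U : Set (Pt n)) : Prop :=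
  ∀ x ∈ U, (g x).IsSymm ∧ (g x).PosDef

/-- Christoffel symbols `Γ^c_{ab}` of `g`. -/
def christoffel {n : ℕ} (g : Met n) (c a b : Fin n) (x : Pt n) : ℝ :=
  (1 / 2) * ∑ d, (g x)⁻¹ c d *
    (pd a (fun y => g y b d) x + pd b (fun y => g y a d) x - pd d (fun y => g y a b) x)

/-- Ricci tensor `R_{ab}` of `g`. -/
def ricci {n : ℕ} (g : Met n) (a b : Fin n) (x : Pt n) : ℝ :=
  (∑ c, pd c (christoffel g c a b) x) - (∑ c, pd a (christoffel g c c b) x)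
    + (∑ c, ∑ d, christoffel g c a b x * christoffel g d d c x)
    - (∑ c, ∑ d, christoffel g d c b x * christoffel g c a d x)

/-- Scalar curvature `R(g)`. -/
def scalarCurv {n : ℕ} (g : Met n) (x : Pt n) : ℝ :=
  ∑ a, ∑ b, (g x)⁻¹ a b * ricci g a b x

/-- Laplace–Beltrami operator `Δ_g`. -/
def laplaceBeltrami {n : ℕ} (g : Met n) (u : Pt n → ℝ) (x : Pt n) : ℝ :=
  -(Real.sqrt (g x).det)⁻¹ *
    ∑ a, pd a (fun y => Real.sqrt (g y).det * ∑ b, (g y)⁻¹ a b * pd b u y) x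

/-- Conformal Laplacian `L_g`. -/
def confLap {n : ℕ} (g : Met n) (u : Pt n → ℝ) (x : Pt n) : ℝ :=
  laplaceBeltrami g u x + (((n : ℝ) - 2) / (4 * ((n : ℝ) - 1))) * scalarCurv g x * u x

/-- `f` is of class `C^{k+α}` on `s`: it is `C^k` there and its `k`-th order derivatives are
locally `α`-Hölder continuous. -/
def CHolderOn {n : ℕ} (k : ℕ) (α : ℝ) (s : Set (Pt n)) (f : Pt n → ℝ) : Prop :=
  ContDiffOn ℝ k f s ∧
    ∀ x ∈ s, ∃ C : NNReal, ∃ t ∈ nhdsWithin x s,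
      HolderOnWith C (Real.toNNReal α) (iteratedFDerivWithin ℝ k f s) t

/-- All entries of `g` are of class `C^{k+α}` on `s`. -/
def MetCHolderOn {n : ℕ} (k : ℕ) (α : ℝ) (s : Set (Pt n)) (g : Met n) : Prop :=
  ∀ a b, CHolderOn k α s fun x => g x a b

/-- Contracted Christoffel symbol `Γ^a = g^{bc} Γ^a_{bc}`. -/
def gammaUp {n : ℕ} (g : Met n) (a : Fin n) (x : Pt n) : ℝ :=
  ∑ b, ∑ c, (g x)⁻¹ b c * christoffel g a b c x

/-- Contracted Christoffel symbol `Γ_a = g_{ab} Γ^b`. -/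
def gammaLow {n : ℕ} (g : Met n) (a : Fin n) (x : Pt n) : ℝ :=
  ∑ b, g x a b * gammaUp g b x

/-- `g` satisfies the conformal harmonic gauge on `U`. -/
def ConfHarmonicGauge {n : ℕ} (g : Met n) (U : Set (Pt n)) : Prop :=
  ∃ f : Pt n → ℝ, ContDiffOn ℝ 2 f U ∧ (∀ x ∈ U, 0 < f x) ∧
    (∀ x ∈ U, confLap g f x = 0) ∧
    ∀ a : Fin n, ∀ x ∈ U, gammaLow g a x = 2 * pd a (fun y => Real.log (f y)) x

/-- Determinant-normalized metric `ĝ = (det g)^{-1/n} g`. -/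
def dnorm {n : ℕ} (g : Met n) : Met n :=
  fun x => ((g x).det ^ (-(1 : ℝ) / (n : ℝ))) • g x

/-- Jacobian matrix of a map `Z : ℝⁿ → ℝⁿ`. -/
def jac {n : ℕ} (Z : Pt n → Pt n) (x : Pt n) : Matrix (Fin n) (Fin n) ℝ :=
  Matrix.of fun i j => pd j (fun y => Z y i) x

/-- Riemann curvature tensor `R_{abc}{}^{d}`. -/
def riemannUp {n : ℕ} (g : Met n) (a b c d : Fin n) (x : Pt n) : ℝ :=
  pd a (christoffel g d b c) x - pd b (christoffel g d a c) x
    + (∑ e, christoffel g e b c x * christoffel g d a e x)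
    - (∑ e, christoffel g e a c x * christoffel g d b e x)

/-- Riemann curvature tensor `R_{abcd} = R_{abc}{}^{e} g_{ed}`. -/
def riemannLow {n : ℕ} (g : Met n) (a b c d : Fin n) (x : Pt n) : ℝ :=
  ∑ e, riemannUp g a b c e x * g x e d

/-- Schouten tensor `P_{ab}`. -/
def schouten {n : ℕ} (g : Met n) (a b : Fin n) (x : Pt n) : ℝ :=
  (1 / ((n : ℝ) - 2)) * (ricci g a b x - (scalarCurv g x / (2 * ((n : ℝ) - 1))) * g x a b)

/-- Weyl tensor `W_{abcd}`. -/
def weyl {n : ℕ} (g : Met n) (a b c d : Fin n) (x : Pt n) : ℝ :=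
  riemannLow g a b c d x + schouten g a c x * g x b d - schouten g b c x * g x a d
    + schouten g b d x * g x a c - schouten g a d x * g x b c

/-- Weyl tensor with raised last index, `W_{abc}{}^{d} = g^{de} W_{abce}`. -/
def weylUp {n : ℕ} (g : Met n) (a b c d : Fin n) (x : Pt n) : ℝ :=
  ∑ e, (g x)⁻¹ d e * weyl g a b c e x

/-- Covariant derivative of a 2-tensor: `(∇T)_{cab} = ∇_c T_{ab}`. -/
def cov2 {n : ℕ} (g : Met n) (T : Fin n → Fin n → Pt n → ℝ) (c a b : Fin n) (x : Pt n) : ℝ :=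
  pd c (T a b) x - (∑ d, christoffel g d c a x * T d b x)
    - ∑ d, christoffel g d c b x * T a d x

/-- Covariant derivative of a 3-tensor: `(∇T)_{dabc} = ∇_d T_{abc}`. -/
def cov3 {n : ℕ} (g : Met n) (T : Fin n → Fin n → Fin n → Pt n → ℝ) (d a b c : Fin n)
    (x : Pt n) : ℝ :=
  pd d (T a b c) x - (∑ e, christoffel g e d a x * T e b c x)
    - (∑ e, christoffel g e d b x * T a e c x)
    - ∑ e, christoffel g e d c x * T a b e x

/-- Cotton tensor `C_{abc} = ∇_a P_{bc} - ∇_b P_{ac}`. -/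
def cotton {n : ℕ} (g : Met n) (a b c : Fin n) (x : Pt n) : ℝ :=
  cov2 g (schouten g) a b c x - cov2 g (schouten g) b a c x

/-- Bach tensor `B_{ab}`. -/
def bach {n : ℕ} (g : Met n) (a b : Fin n) (x : Pt n) : ℝ :=
  (∑ c, ∑ d, (g x)⁻¹ c d *
      (cov3 g (cov2 g (schouten g)) d a b c x - cov3 g (cov2 g (schouten g)) d c a b x))
    + ∑ c, ∑ d, ∑ e, ∑ f, (g x)⁻¹ c e * (g x)⁻¹ d f * schouten g e f x * weyl g a c d b x

section Schauder

variable {n : ℕ} {α : ℝ} {S : Set (Pt n)}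

/-- The linear form on `ℝⁿ` with coefficient vector `v`. -/
def gradForm {n : ℕ} (v : Fin n → ℝ) : Pt n →L[ℝ] ℝ :=
  ∑ i, v i • ContinuousLinearMap.proj (R := ℝ) (φ := fun _ : Fin n => ℝ) i

/-- Partial derivative within a set. -/
def pdW {n : ℕ} (S : Set (Pt n)) (i : Fin n) (f : Pt n → ℝ) (x : Pt n) : ℝ :=
  fderivWithin ℝ f S x (Pi.single i 1)

/-- `HB α S m f C`: all partial derivatives of order at most `m` of `f` on `S` are bounded by `C`,
and those of order `m` are `α`-Hölder with constant `C`. -/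
def HB {n : ℕ} (α : ℝ) (S : Set (Pt n)) : ℕ → (Pt n → ℝ) → ℝ → Prop
  | 0, f, C => (∀ x ∈ S, |f x| ≤ C) ∧ ∀ x ∈ S, ∀ y ∈ S, |f x - f y| ≤ C * ‖x - y‖ ^ α
  | m + 1, f, C => (∀ x ∈ S, |f x| ≤ C) ∧ DifferentiableOn ℝ f S ∧ ∀ i, HB α S m (pdW S i f) C

/-- Convex sets with nonempty interior, up to the properties used below. -/
structure IsDom {n : ℕ} (S : Set (Pt n)) : Prop where
  convex : Convex ℝ S
  uniq : UniqueDiffOn ℝ S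
  nonempty : S.Nonempty

lemma gradForm_apply (v : Fin n → ℝ) (x : Pt n) : gradForm v x = ∑ i, v i * x i := by
  simp [gradForm]

lemma gradForm_single (v : Fin n → ℝ) (i : Fin n) : gradForm v (Pi.single i 1) = v i := by
  simp [gradForm_apply, Pi.single_apply]

lemma eq_gradForm (L : Pt n →L[ℝ] ℝ) : L = gradForm fun i => L (Pi.single i 1) := by
  ext x
  rw [gradForm_apply]
  conv_lhs => rw [← Finset.univ_sum_single x]
  rw [map_sum]
  refine Finset.sum_congr rfl fun i _ => ?_
  have : (Pi.single i (x i) : Pt n) = x i • Pi.single i 1 := by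
    rw [← Pi.single_smul]; simp
  rw [this, map_smul, smul_eq_mul, mul_comm]

lemma norm_gradForm_le (v : Fin n → ℝ) {C : ℝ} (hC : 0 ≤ C) (h : ∀ i, |v i| ≤ C) :
    ‖gradForm v‖ ≤ n * C := by
  refine ContinuousLinearMap.opNorm_le_bound _ (by positivity) fun x => ?_
  rw [gradForm_apply]
  calc ‖∑ i, v i * x i‖ ≤ ∑ i, ‖v i * x i‖ := norm_sum_le _ _
    _ ≤ ∑ _i : Fin n, C * ‖x‖ := by
        refine Finset.sum_le_sum fun i _ => ?_
        rw [norm_mul]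
        exact mul_le_mul (h i) (norm_le_pi_norm x i) (norm_nonneg _) hC
    _ = n * C * ‖x‖ := by simp [mul_assoc]

lemma pdW_univ (i : Fin n) (f : Pt n → ℝ) : pdW univ i f = pd i f := by
  ext x; simp [pdW, pd]

lemma pdW_of_hasFDeriv (hS : IsDom S) {f : Pt n → ℝ} {v : Fin n → ℝ} {x : Pt n} (hx : x ∈ S)
    (h : HasFDerivWithinAt f (gradForm v) S x) (i : Fin n) : pdW S i f x = v i := by
  rw [pdW, h.fderivWithin (hS.uniq x hx), gradForm_single]

lemma hasFDeriv_pdW {f : Pt n → ℝ} {x : Pt n} (h : DifferentiableWithinAt ℝ f S x) :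
    HasFDerivWithinAt f (gradForm fun i => pdW S i f x) S x := by
  have := h.hasFDerivWithinAt
  rwa [eq_gradForm (fderivWithin ℝ f S x)] at this

lemma isDom_univ : IsDom (univ : Set (Pt n)) := ⟨convex_univ, uniqueDiffOn_univ, univ_nonempty⟩

lemma isDom_ball {r : ℝ} (hr : 0 < r) : IsDom (Metric.ball (0 : Pt n) r) :=
  ⟨convex_ball _ _, Metric.isOpen_ball.uniqueDiffOn, ⟨0, by simpa⟩⟩

lemma pdW_congr {f g : Pt n → ℝ} (h : EqOn f g S) {x : Pt n} (hx : x ∈ S) (i : Fin n) :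
    pdW S i f x = pdW S i g x := by
  rw [pdW, fderivWithin_congr h (h hx), pdW]

lemma pdW_add (hS : IsDom S) {f g : Pt n → ℝ} {x : Pt n} (hx : x ∈ S)
    (hf : DifferentiableWithinAt ℝ f S x) (hg : DifferentiableWithinAt ℝ g S x) (i : Fin n) :
    pdW S i (fun y => f y + g y) x = pdW S i f x + pdW S i g x := by
  rw [pdW, fderivWithin_fun_add (hS.uniq x hx) hf hg]; rfl

lemma pdW_smul {f : Pt n → ℝ} {x : Pt n} (hS : IsDom S) (hx : x ∈ S)
    (hf : DifferentiableWithinAt ℝ f S x) (c : ℝ) (i : Fin n) :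
    pdW S i (fun y => c * f y) x = c * pdW S i f x := by
  rw [pdW, fderivWithin_const_mul (hS.uniq x hx) hf]; rfl

lemma pdW_mul (hS : IsDom S) {f g : Pt n → ℝ} {x : Pt n} (hx : x ∈ S)
    (hf : DifferentiableWithinAt ℝ f S x) (hg : DifferentiableWithinAt ℝ g S x) (i : Fin n) :
    pdW S i (fun y => f y * g y) x = f x * pdW S i g x + g x * pdW S i f x := by
  rw [pdW, fderivWithin_fun_mul (hS.uniq x hx) hf hg]; simp [pdW]

namespace HB

lemma bound {m : ℕ} {f : Pt n → ℝ} {C : ℝ} (h : HB α S m f C) : ∀ x ∈ S, |f x| ≤ C := by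
  cases m <;> exact h.1

lemma nonneg {m : ℕ} {f : Pt n → ℝ} {C : ℝ} (hS : IsDom S) (h : HB α S m f C) : 0 ≤ C := by
  obtain ⟨x, hx⟩ := hS.nonempty
  exact (abs_nonneg _).trans (h.bound x hx)

lemma mono {m : ℕ} {f : Pt n → ℝ} {C C' : ℝ} (h : HB α S m f C) (hC : C ≤ C') :
    HB α S m f C' := by
  induction m generalizing f with
  | zero =>
    refine ⟨fun x hx => (h.1 x hx).trans hC, fun x hx y hy => (h.2 x hx y hy).trans ?_⟩
    gcongr
  | succ m ih => exact ⟨fun x hx => (h.1 x hx).trans hC, h.2.1, fun i => ih (h.2.2 i)⟩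

lemma congr {m : ℕ} {f g : Pt n → ℝ} {C : ℝ} (h : HB α S m f C) (hfg : EqOn g f S) :
    HB α S m g C := by
  induction m generalizing f g with
  | zero =>
    refine ⟨fun x hx => hfg hx ▸ h.1 x hx, fun x hx y hy => ?_⟩
    rw [hfg hx, hfg hy]; exact h.2 x hx y hy
  | succ m ih =>
    refine ⟨fun x hx => hfg hx ▸ h.1 x hx, h.2.1.congr hfg, fun i => ih (h.2.2 i) ?_⟩
    exact fun x hx => pdW_congr hfg hx i

lemma diff {m : ℕ} {f : Pt n → ℝ} {C : ℝ} (h : HB α S (m + 1) f C) : DifferentiableOn ℝ f S :=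
  h.2.1

lemma pd {m : ℕ} {f : Pt n → ℝ} {C : ℝ} (h : HB α S (m + 1) f C) (i : Fin n) :
    HB α S m (pdW S i f) C := h.2.2 i

lemma of_hasFDeriv {m : ℕ} {f : Pt n → ℝ} {f' : Fin n → Pt n → ℝ} {C : ℝ} (hS : IsDom S)
    (hb : ∀ x ∈ S, |f x| ≤ C)
    (hf : ∀ x ∈ S, HasFDerivWithinAt f (gradForm fun i => f' i x) S x)
    (h : ∀ i, HB α S m (f' i) C) : HB α S (m + 1) f C :=
  ⟨hb, fun x hx => (hf x hx).differentiableWithinAt,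
    fun i => (h i).congr fun x hx => pdW_of_hasFDeriv hS hx (hf x hx) i⟩

lemma holder_of_lipschitz {f : Pt n → ℝ} {A B : ℝ} (hα : α ∈ Ioo (0 : ℝ) 1) (hA : 0 ≤ A)
    (hB : 0 ≤ B) {x y : Pt n} (hx : |f x| ≤ A) (hy : |f y| ≤ A) (h : |f x - f y| ≤ B * ‖x - y‖) :
    |f x - f y| ≤ (2 * A + B) * ‖x - y‖ ^ α := by
  rcases le_total ‖x - y‖ 1 with h1 | h1
  · have : ‖x - y‖ ≤ ‖x - y‖ ^ α := by
      rcases eq_or_lt_of_le (norm_nonneg (x - y)) with h0 | h0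
      · rw [← h0]; positivity
      · calc ‖x - y‖ = ‖x - y‖ ^ (1 : ℝ) := (Real.rpow_one _).symm
          _ ≤ _ := Real.rpow_le_rpow_of_exponent_ge h0 h1 hα.2.le
    calc _ ≤ B * ‖x - y‖ := h
      _ ≤ B * ‖x - y‖ ^ α := by gcongr
      _ ≤ _ := by gcongr; linarith
  · have h2 : 1 ≤ ‖x - y‖ ^ α := Real.one_le_rpow h1 hα.1.le
    calc |f x - f y| ≤ |f x| + |f y| := abs_sub _ _
      _ ≤ 2 * A + B := by linarith
      _ = (2 * A + B) * 1 := by ring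
      _ ≤ _ := by gcongr

lemma lipschitz_of_pd {f : Pt n → ℝ} {C : ℝ} (hS : IsDom S) (hC : 0 ≤ C)
    (hf : DifferentiableOn ℝ f S) (h : ∀ i, ∀ x ∈ S, |pdW S i f x| ≤ C) {x y : Pt n}
    (hx : x ∈ S) (hy : y ∈ S) : |f x - f y| ≤ n * C * ‖x - y‖ := by
  have := hS.convex.norm_image_sub_le_of_norm_hasFDerivWithin_le
    (fun z hz => hasFDeriv_pdW (hf z hz))
    (fun z hz => norm_gradForm_le _ hC (fun i => h i z hz)) hy hx
  simpa using this

lemma zero_of_pd {f : Pt n → ℝ} {C : ℝ} (hS : IsDom S) (hα : α ∈ Ioo (0 : ℝ) 1)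
    (hb : ∀ x ∈ S, |f x| ≤ C)
    (hf : DifferentiableOn ℝ f S) (h : ∀ i, ∀ x ∈ S, |pdW S i f x| ≤ C) :
    HB α S 0 f ((n + 2) * C) := by
  have hC : 0 ≤ C := (abs_nonneg _).trans (hb _ hS.nonempty.some_mem)
  refine ⟨fun x hx => (hb x hx).trans ?_, fun x hx y hy => ?_⟩
  · nlinarith [(Nat.cast_nonneg n : (0:ℝ) ≤ n)]
  · have := holder_of_lipschitz (f := f) hα hC (by positivity) (hb x hx) (hb y hy)
      (lipschitz_of_pd hS hC hf h hx hy)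
    convert this using 2; ring

lemma down {m : ℕ} {f : Pt n → ℝ} {C : ℝ} (hS : IsDom S) (hα : α ∈ Ioo (0 : ℝ) 1)
    (h : HB α S (m + 1) f C) : HB α S m f ((n + 2) * C) := by
  have hC := h.nonneg hS
  induction m generalizing f with
  | zero => exact zero_of_pd hS hα h.bound h.diff fun i => (h.pd i).bound
  | succ m ih =>
    refine ⟨fun x hx => (h.bound x hx).trans ?_, h.diff, fun i => ih (h.pd i)⟩
    nlinarith [(Nat.cast_nonneg n : (0:ℝ) ≤ n)]

lemma const {m : ℕ} (c : ℝ) : HB α S m (fun _ => c) |c| := by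
  cases m with
  | zero => exact ⟨fun _ _ => le_rfl, fun _ _ _ _ => by simp; positivity⟩
  | succ m =>
    refine ⟨fun _ _ => le_rfl, differentiableOn_const c, fun i => ?_⟩
    have : pdW S i (fun _ => c) = fun _ => (0 : ℝ) := by
      ext x; simp [pdW]
    rw [this]
    clear this
    suffices ∀ m, HB α S m (fun _ => (0 : ℝ)) |c| from this m
    intro m
    induction m with
    | zero => exact ⟨fun _ _ => by simp, fun _ _ _ _ => by simp; positivity⟩
    | succ m ih =>
      refine ⟨fun _ _ => by simp, differentiableOn_const _, fun i => ?_⟩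
      have : pdW S i (fun _ => (0:ℝ)) = fun _ => (0 : ℝ) := by
        ext x; simp [pdW]
      rw [this]; exact ih

lemma zero {m : ℕ} : HB α S m (fun _ => (0 : ℝ)) 0 := by simpa using const (α := α) (S := S) (m := m) 0

lemma add {m : ℕ} {f g : Pt n → ℝ} {A B : ℝ} (hS : IsDom S) (hf : HB α S m f A)
    (hg : HB α S m g B) : HB α S m (fun x => f x + g x) (A + B) := by
  induction m generalizing f g with
  | zero =>
    refine ⟨fun x hx => (abs_add_le _ _).trans (add_le_add (hf.1 x hx) (hg.1 x hx)),
      fun x hx y hy => ?_⟩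
    have := hf.2 x hx y hy
    have := hg.2 x hx y hy
    calc _ = |(f x - f y) + (g x - g y)| := by ring_nf
      _ ≤ _ := abs_add_le _ _
      _ ≤ _ := by linarith
  | succ m ih =>
    refine ⟨fun x hx => (abs_add_le _ _).trans (add_le_add (hf.1 x hx) (hg.1 x hx)),
      hf.diff.add hg.diff, fun i => (ih (hf.pd i) (hg.pd i)).congr fun x hx => ?_⟩
    exact pdW_add hS hx (hf.diff x hx) (hg.diff x hx) i

lemma smul {m : ℕ} {f : Pt n → ℝ} {A : ℝ} (hS : IsDom S) (hf : HB α S m f A) (c : ℝ) :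
    HB α S m (fun x => c * f x) (|c| * A) := by
  induction m generalizing f with
  | zero =>
    refine ⟨fun x hx => ?_, fun x hx y hy => ?_⟩
    · rw [abs_mul]; gcongr; exact hf.1 x hx
    · rw [← mul_sub, abs_mul, mul_assoc]; gcongr; exact hf.2 x hx y hy
  | succ m ih =>
    refine ⟨fun x hx => ?_, hf.diff.const_mul c, fun i => (ih (hf.pd i)).congr fun x hx => ?_⟩
    · rw [abs_mul]; gcongr; exact hf.1 x hx
    · exact pdW_smul hS hx (hf.diff x hx) c i

lemma neg {m : ℕ} {f : Pt n → ℝ} {A : ℝ} (hS : IsDom S) (hf : HB α S m f A) :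
    HB α S m (fun x => - f x) A := by
  simpa using hf.smul hS (-1)

lemma sub {m : ℕ} {f g : Pt n → ℝ} {A B : ℝ} (hS : IsDom S) (hf : HB α S m f A)
    (hg : HB α S m g B) : HB α S m (fun x => f x - g x) (A + B) := by
  simpa [sub_eq_add_neg] using hf.add hS (hg.neg hS)

lemma sum {ι : Type*} {m : ℕ} {f : ι → Pt n → ℝ} {A : ι → ℝ} (hS : IsDom S) (s : Finset ι)
    (hf : ∀ j ∈ s, HB α S m (f j) (A j)) :
    HB α S m (fun x => ∑ j ∈ s, f j x) (∑ j ∈ s, A j) := by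
  classical
  induction s using Finset.induction_on with
  | empty => simpa using zero
  | insert a s ha ih =>
    simp only [Finset.sum_insert ha]
    exact (hf a (by simp)).add hS (ih fun j hj => hf j (by simp [hj]))

end HB

/-- Constant in the product estimate for Hölder norms. -/
def mulC (n m : ℕ) : ℝ := 2 * (2 * ((n : ℝ) + 2)) ^ m

lemma one_le_mulC (n m : ℕ) : 1 ≤ mulC n m := by
  have : (1:ℝ) ≤ (2 * ((n : ℝ) + 2)) ^ m := one_le_pow₀ (by
    linarith [(Nat.cast_nonneg n : (0:ℝ) ≤ n)])
  unfold mulC; linarith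

lemma mulC_nonneg (n m : ℕ) : 0 ≤ mulC n m := by linarith [one_le_mulC n m]

namespace HB

lemma mul {m : ℕ} {f g : Pt n → ℝ} {A B : ℝ} (hS : IsDom S) (hα : α ∈ Ioo (0 : ℝ) 1)
    (hf : HB α S m f A) (hg : HB α S m g B) :
    HB α S m (fun x => f x * g x) (mulC n m * (A * B)) := by
  have hA := hf.nonneg hS
  have hB := hg.nonneg hS
  have hbd : ∀ x ∈ S, |f x * g x| ≤ mulC n m * (A * B) := fun x hx => by
    rw [abs_mul]
    calc _ ≤ A * B := mul_le_mul (hf.bound x hx) (hg.bound x hx) (abs_nonneg _) hA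
      _ ≤ _ := by nlinarith [one_le_mulC n m, mul_nonneg hA hB]
  induction m generalizing f g A B with
  | zero =>
    refine ⟨hbd, fun x hx y hy => ?_⟩
    have h1 := hf.2 x hx y hy
    have h2 := hg.2 x hx y hy
    calc _ = |f x * (g x - g y) + g y * (f x - f y)| := by ring_nf
      _ ≤ |f x| * |g x - g y| + |g y| * |f x - f y| := by
        rw [← abs_mul, ← abs_mul]; exact abs_add_le _ _
      _ ≤ A * (B * ‖x - y‖ ^ α) + B * (A * ‖x - y‖ ^ α) := by
        gcongr
        · exact hf.1 x hx
        · exact hg.1 y hy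
      _ = _ := by simp [mulC]; ring
  | succ m ih =>
    refine ⟨hbd, hf.diff.mul hg.diff, fun i => ?_⟩
    have h0 : (0:ℝ) ≤ n := Nat.cast_nonneg n
    have key : ∀ {f g : Pt n → ℝ} {A B : ℝ}, HB α S (m + 1) f A → HB α S (m + 1) g B → 0 ≤ A →
        0 ≤ B → HB α S m (fun x => f x * pdW S i g x) (mulC n m * ((n + 2) * A * B)) :=
      fun {f g A B} hf hg hA hB => by
      refine ih (hf.down hS hα) (hg.pd i) (by positivity) hB fun x hx => ?_
      rw [abs_mul]
      calc _ ≤ ((n + 2) * A) * B := mul_le_mul ((hf.down hS hα).bound x hx)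
            ((hg.pd i).bound x hx) (abs_nonneg _) (by positivity)
        _ = 1 * (((n + 2) * A) * B) := by ring
        _ ≤ _ := by gcongr; exact one_le_mulC n m
    refine (((key hf hg hA hB).add hS (key hg hf hB hA)).congr fun x hx =>
      pdW_mul hS hx (hf.diff x hx) (hg.diff x hx) i).mono (le_of_eq ?_)
    simp only [mulC, pow_succ]; ring

lemma subset {m : ℕ} {S' : Set (Pt n)} {f : Pt n → ℝ} {C : ℝ} (hS' : IsDom S')
    (hss : S' ⊆ S) (h : HB α S m f C) : HB α S' m f C := by
  induction m generalizing f with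
  | zero => exact ⟨fun x hx => h.1 x (hss hx), fun x hx y hy => h.2 x (hss hx) y (hss hy)⟩
  | succ m ih =>
    refine ⟨fun x hx => h.1 x (hss hx), h.diff.mono hss, fun i => (ih (h.pd i)).congr ?_⟩
    intro x hx
    rw [pdW, fderivWithin_subset hss (hS'.uniq x hx) (h.diff x (hss hx)), pdW]

lemma continuousOn {m : ℕ} {f : Pt n → ℝ} {C : ℝ} (hα : α ∈ Ioo (0 : ℝ) 1)
    (h : HB α S m f C) : ContinuousOn f S := by
  cases m with
  | succ m => exact h.diff.continuousOn
  | zero =>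
    intro x hx
    rw [ContinuousWithinAt, tendsto_iff_norm_sub_tendsto_zero]
    have h1 : Filter.Tendsto (fun y => C * ‖y - x‖ ^ α) (nhdsWithin x S) (nhds 0) := by
      have : ContinuousAt (fun y => C * ‖y - x‖ ^ α) x :=
        ((continuous_id.sub continuous_const).norm.continuousAt.rpow_const
          (Or.inr hα.1.le)).const_mul C
      have h2 := this.tendsto.mono_left (nhdsWithin_le_nhds (s := S))
      simpa [Real.zero_rpow hα.1.ne'] using h2
    refine squeeze_zero' (Filter.Eventually.of_forall fun _ => norm_nonneg _) ?_ h1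
    filter_upwards [self_mem_nhdsWithin] with y hy using h.2 y hy x hx

lemma of_contDiff_hasCompactSupport (hα : α ∈ Ioo (0 : ℝ) 1) (m : ℕ) {f : Pt n → ℝ}
    (hf : ContDiff ℝ (⊤ : ℕ∞) f) (hc : HasCompactSupport f) : ∃ C, HB α univ m f C := by
  have hpd : ∀ {f : Pt n → ℝ}, ContDiff ℝ (⊤ : ℕ∞) f → HasCompactSupport f → ∀ i,
      ContDiff ℝ (⊤ : ℕ∞) (_root_.pd i f) ∧ HasCompactSupport (_root_.pd i f) := by
    intro f hf hc i
    refine ⟨(hf.fderiv_right (m := (⊤ : ℕ∞)) (by simp)).clm_apply contDiff_const, ?_⟩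
    exact hc.fderiv_apply (𝕜 := ℝ) _
  have hbd : ∀ {f : Pt n → ℝ}, ContDiff ℝ (⊤ : ℕ∞) f → HasCompactSupport f →
      ∃ C, ∀ x, |f x| ≤ C := fun hf hc => hc.exists_bound_of_continuous hf.continuous
  induction m generalizing f with
  | zero =>
    obtain ⟨A, hA⟩ := hbd hf hc
    choose B hB using fun i => hbd (hpd hf hc i).1 (hpd hf hc i).2
    have hA0 : 0 ≤ A := (abs_nonneg _).trans (hA 0)
    have hB0 : ∀ i, 0 ≤ B i := fun i => (abs_nonneg _).trans (hB i 0)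
    refine ⟨_, zero_of_pd (C := A + ∑ i, B i) isDom_univ hα (fun x _ => (hA x).trans ?_)
      (hf.differentiable (by simp)).differentiableOn fun i x _ => ?_⟩
    · linarith [Finset.sum_nonneg fun i (_ : i ∈ Finset.univ) => hB0 i]
    · rw [pdW_univ]
      have := Finset.single_le_sum (fun i _ => hB0 i) (Finset.mem_univ i)
      linarith [hB i x]
  | succ m ih =>
    obtain ⟨A, hA⟩ := hbd hf hc
    choose B hB using fun i => ih (hpd hf hc i).1 (hpd hf hc i).2
    have hA0 : 0 ≤ A := (abs_nonneg _).trans (hA 0)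
    have hB0 : ∀ i, 0 ≤ B i := fun i => (hB i).nonneg isDom_univ
    refine ⟨A + ∑ i, B i, fun x _ => (hA x).trans ?_,
      (hf.differentiable (by simp)).differentiableOn, fun i => ?_⟩
    · linarith [Finset.sum_nonneg fun i (_ : i ∈ Finset.univ) => hB0 i]
    · rw [pdW_univ]
      have := Finset.single_le_sum (fun i _ => hB0 i) (Finset.mem_univ i)
      exact (hB i).mono (by linarith)

end HB

/-- The closed upper half-space in direction `l`. -/
def upperHS {n : ℕ} (l : Fin n) : Set (Pt n) := {x | 0 ≤ x l}

lemma isDom_upperHS (l : Fin n) : IsDom (upperHS l) := by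
  have hc : Convex ℝ (upperHS l) := by
    intro x hx y hy a b ha hb _
    have hx' : 0 ≤ x l := hx
    have hy' : 0 ≤ y l := hy
    change 0 ≤ a * x l + b * y l
    positivity
  refine ⟨hc, uniqueDiffOn_convex hc ⟨fun _ => 1, ?_⟩, ⟨0, le_refl (0:ℝ)⟩⟩
  refine mem_interior.2 ⟨{x | 0 < x l}, fun x hx => le_of_lt (a := (0:ℝ)) hx, ?_, by simp⟩
  exact isOpen_lt continuous_const (continuous_apply l)

/-- The linear map multiplying the `l`-th coordinate by `-t`. -/
def reflL {n : ℕ} (l : Fin n) (t : ℝ) : Pt n →L[ℝ] Pt n :=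
  ContinuousLinearMap.id ℝ _ - (1 + t) •
    (ContinuousLinearMap.proj (R := ℝ) (φ := fun _ : Fin n => ℝ) l).smulRight
      (Pi.single l 1 : Pt n)

lemma reflL_apply (l : Fin n) (t : ℝ) (x : Pt n) (i : Fin n) :
    reflL l t x i = if i = l then -t * x l else x i := by
  by_cases h : i = l
  · subst h; simp [reflL]; ring
  · simp [reflL, h]

lemma norm_reflL_le (l : Fin n) {t : ℝ} (ht : 0 ≤ t) (x : Pt n) :
    ‖reflL l t x‖ ≤ (1 + t) * ‖x‖ := by
  refine (pi_norm_le_iff_of_nonneg (by positivity)).2 fun i => ?_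
  rw [reflL_apply]
  split_ifs
  · rw [norm_mul, norm_neg, Real.norm_of_nonneg ht]
    have := norm_le_pi_norm x l
    nlinarith [norm_nonneg x]
  · have := norm_le_pi_norm x i
    nlinarith [norm_nonneg x]

lemma reflL_single (l : Fin n) (t : ℝ) (i : Fin n) :
    reflL l t (Pi.single i 1) = (if i = l then -t else 1) • (Pi.single i 1 : Pt n) := by
  ext j
  rw [reflL_apply]
  by_cases hj : j = l <;> by_cases hi : i = l
  · subst hj hi; simp
  · subst hj; simp [hi]
  · subst hi; simp [hj]
  · simp [hi, hj]

lemma reflL_mem {l : Fin n} {t : ℝ} (ht : 0 ≤ t) {x : Pt n} (hx : x l ≤ 0) :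
    reflL l t x ∈ upperHS l := by
  change 0 ≤ reflL l t x l
  rw [reflL_apply, if_pos rfl]; nlinarith

lemma reflL_of_zero {l : Fin n} {t : ℝ} {x : Pt n} (hx : x l = 0) : reflL l t x = x := by
  ext i
  rw [reflL_apply]
  split_ifs with h
  · subst h; simp [hx]
  · rfl

/-- Combination of the reflected values of `f`, with weights `c j * (-t j) ^ p`. -/
def reflSum {n M : ℕ} (l : Fin n) (c t : Fin M → ℝ) (p : ℕ) (f : Pt n → ℝ) (x : Pt n) : ℝ :=
  ∑ j, c j * (-t j) ^ p * f (reflL l (t j) x)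

open Classical in
/-- Extension of `f` across the hyperplane `x l = 0` by higher order reflection. -/
def reflExt {n M : ℕ} (l : Fin n) (c t : Fin M → ℝ) (p : ℕ) (f : Pt n → ℝ) (x : Pt n) : ℝ :=
  if 0 ≤ x l then f x else reflSum l c t p f x

section Extension

variable {M : ℕ} {l : Fin n} {c t : Fin M → ℝ}

lemma reflExt_of_nonneg {p : ℕ} {f : Pt n → ℝ} {x : Pt n} (hx : 0 ≤ x l) :
    reflExt l c t p f x = f x := by simp [reflExt, hx]

lemma reflExt_of_nonpos {p : ℕ} (hp : ∑ j, c j * (-t j) ^ p = 1) {f : Pt n → ℝ} {x : Pt n}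
    (hx : x l ≤ 0) : reflExt l c t p f x = reflSum l c t p f x := by
  rcases eq_or_lt_of_le hx with h | h
  · rw [reflExt_of_nonneg h.ge, reflSum]
    simp_rw [reflL_of_zero h]
    rw [← Finset.sum_mul, hp, one_mul]
  · simp [reflExt, h]

/-- Constant in the estimate for the reflection extension. -/
def reflC {M : ℕ} (N : ℕ) (c t : Fin M → ℝ) : ℝ := 1 + ∑ j, |c j| * (1 + t j) ^ (N + 1)

lemma one_le_reflC (N : ℕ) (ht : ∀ j, 0 ≤ t j) : 1 ≤ reflC N c t := by
  have : 0 ≤ ∑ j, |c j| * (1 + t j) ^ (N + 1) :=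
    Finset.sum_nonneg fun j _ => by have := ht j; positivity
  unfold reflC; linarith

lemma abs_weight_le {N p : ℕ} (hp : p ≤ N) (ht : ∀ j, 0 ≤ t j) {C : ℝ} (hC : 0 ≤ C)
    {u : Fin M → ℝ} (hu : ∀ j, |u j| ≤ (1 + t j) * C) :
    |∑ j, c j * (-t j) ^ p * u j| ≤ reflC N c t * C := by
  calc |∑ j, c j * (-t j) ^ p * u j| ≤ ∑ j, |c j * (-t j) ^ p * u j| :=
        Finset.abs_sum_le_sum_abs _ _
    _ ≤ ∑ j, |c j| * (1 + t j) ^ (N + 1) * C := by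
        refine Finset.sum_le_sum fun j _ => ?_
        have := ht j
        rw [abs_mul, abs_mul, abs_pow, abs_neg, abs_of_nonneg (ht j), pow_succ, mul_assoc, mul_assoc,
          mul_assoc]
        gcongr
        · calc t j ^ p ≤ (1 + t j) ^ p := by gcongr; linarith
            _ ≤ (1 + t j) ^ N := pow_le_pow_right₀ (by linarith) hp
        · exact hu j
    _ ≤ _ := by rw [← Finset.sum_mul]; unfold reflC; nlinarith

lemma HB.reflExt_zero {N p : ℕ} (hα : α ∈ Ioo (0 : ℝ) 1) (hp : p ≤ N) (ht : ∀ j, 0 ≤ t j)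
    (hc : ∑ j, c j * (-t j) ^ p = 1)
    {f : Pt n → ℝ} {C : ℝ} (hC : 0 ≤ C) (hb : ∀ x ∈ upperHS l, |f x| ≤ C)
    (hh : ∀ x ∈ upperHS l, ∀ y ∈ upperHS l, |f x - f y| ≤ C * ‖x - y‖ ^ α) :
    HB α univ 0 (reflExt l c t p f) (2 * reflC N c t * C) := by
  have h1 : 1 ≤ reflC N c t := one_le_reflC N ht
  have hup : ∀ x y : Pt n, 0 ≤ x l → 0 ≤ y l →
      |reflExt l c t p f x - reflExt l c t p f y| ≤ reflC N c t * C * ‖x - y‖ ^ α := by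
    intro x y hx hy
    rw [reflExt_of_nonneg hx, reflExt_of_nonneg hy]
    refine (hh x hx y hy).trans ?_
    gcongr
    nlinarith
  have hlow : ∀ x y : Pt n, x l ≤ 0 → y l ≤ 0 →
      |reflExt l c t p f x - reflExt l c t p f y| ≤ reflC N c t * C * ‖x - y‖ ^ α := by
    intro x y hx hy
    rw [reflExt_of_nonpos hc hx, reflExt_of_nonpos hc hy, reflSum, reflSum,
      ← Finset.sum_sub_distrib]
    simp_rw [← mul_sub]
    rw [mul_assoc]
    refine abs_weight_le hp ht (by positivity) fun j => ?_
    refine (hh _ (reflL_mem (ht j) hx) _ (reflL_mem (ht j) hy)).trans ?_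
    have htj := ht j
    calc C * ‖reflL l (t j) x - reflL l (t j) y‖ ^ α
        ≤ C * ((1 + t j) * ‖x - y‖) ^ α := by
          rw [← map_sub]
          have := norm_reflL_le l (ht j) (x - y)
          have := hα.1
          gcongr
      _ = C * ((1 + t j) ^ α * ‖x - y‖ ^ α) := by
          rw [Real.mul_rpow (by positivity) (norm_nonneg _)]
      _ ≤ C * ((1 + t j) * ‖x - y‖ ^ α) := by
          gcongr
          calc (1 + t j) ^ α ≤ (1 + t j) ^ (1:ℝ) :=
                Real.rpow_le_rpow_of_exponent_le (by linarith) hα.2.le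
            _ = _ := Real.rpow_one _
      _ = _ := by ring
  have hcross : ∀ x y : Pt n, 0 ≤ x l → y l ≤ 0 →
      |reflExt l c t p f x - reflExt l c t p f y| ≤ 2 * reflC N c t * C * ‖x - y‖ ^ α := by
    intro x y hx hy
    rcases eq_or_lt_of_le (sub_nonneg.2 (hy.trans hx)) with h0 | h0
    · have : y l = 0 := by linarith
      refine (hup x y hx this.ge).trans ?_
      gcongr
      nlinarith
    · set s : ℝ := x l / (x l - y l) with hs
      have hs0 : 0 ≤ s := by positivity
      have hs1 : s ≤ 1 := by rw [hs, div_le_one h0]; linarith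
      set z : Pt n := x + s • (y - x) with hz
      have hzl : z l = 0 := by
        simp only [hz, hs, Pi.add_apply, Pi.smul_apply, Pi.sub_apply, smul_eq_mul]
        field_simp; ring
      have e1 : ‖x - z‖ ≤ ‖x - y‖ := by
        have : x - z = s • (x - y) := by rw [hz]; module
        rw [this, norm_smul, Real.norm_of_nonneg hs0]
        nlinarith [norm_nonneg (x - y)]
      have e2 : ‖z - y‖ ≤ ‖x - y‖ := by
        have : z - y = (1 - s) • (x - y) := by rw [hz]; module
        rw [this, norm_smul, Real.norm_of_nonneg (by linarith)]
        nlinarith [norm_nonneg (x - y)]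
      have hα' := hα.1
      calc _ = |(reflExt l c t p f x - reflExt l c t p f z)
              + (reflExt l c t p f z - reflExt l c t p f y)| := by ring_nf
        _ ≤ _ := abs_add_le _ _
        _ ≤ reflC N c t * C * ‖x - z‖ ^ α + reflC N c t * C * ‖z - y‖ ^ α :=
            add_le_add (hup _ _ hx hzl.ge) (hlow _ _ hzl.le hy)
        _ ≤ reflC N c t * C * ‖x - y‖ ^ α + reflC N c t * C * ‖x - y‖ ^ α := by gcongr
        _ = _ := by ring
  refine ⟨fun x _ => ?_, fun x _ y _ => ?_⟩
  · rcases le_total 0 (x l) with hx | hx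
    · rw [reflExt_of_nonneg hx]
      refine (hb x hx).trans ?_
      nlinarith
    · rw [reflExt_of_nonpos hc hx, reflSum]
      calc _ ≤ reflC N c t * C := abs_weight_le hp ht hC fun j => ?_
        _ ≤ _ := by nlinarith
      refine (hb _ (reflL_mem (ht j) hx)).trans ?_
      have := ht j
      nlinarith
  · rcases le_total 0 (x l) with hx | hx <;> rcases le_total 0 (y l) with hy | hy
    · exact (hup x y hx hy).trans (by gcongr; nlinarith)
    · exact hcross x y hx hy
    · rw [abs_sub_comm, norm_sub_rev]; exact hcross y x hy hx
    · exact (hlow x y hx hy).trans (by gcongr; nlinarith)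

lemma hasFDerivWithinAt_reflExt {p : ℕ} (ht : ∀ j, 0 ≤ t j)
    (hc : ∑ j, c j * (-t j) ^ p = 1) (hc' : ∑ j, c j * (-t j) ^ (p + 1) = 1)
    {f : Pt n → ℝ} (hf : DifferentiableOn ℝ f (upperHS l)) (x : Pt n) :
    HasFDerivWithinAt (reflExt l c t p f) (gradForm fun i =>
      reflExt l c t (if i = l then p + 1 else p) (pdW (upperHS l) i f) x) univ x := by
  have hU : (upperHS l) ∪ {x : Pt n | x l ≤ 0} = univ := by
    ext x; simpa [upperHS] using le_total 0 (x l)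
  rw [← hU]
  refine HasFDerivWithinAt.union ?_ ?_
  · by_cases hx : 0 ≤ x l
    · have h1 := hasFDeriv_pdW (hf x hx)
      have h2 : HasFDerivWithinAt (reflExt l c t p f)
          (gradForm fun i => pdW (upperHS l) i f x) (upperHS l) x :=
        h1.congr (fun y hy => reflExt_of_nonneg hy) (reflExt_of_nonneg hx)
      convert h2 using 3 with i
      exact reflExt_of_nonneg hx
    · refine HasFDerivWithinAt.of_notMem_closure ?_
      have : IsClosed (upperHS l) := isClosed_le continuous_const (continuous_apply l)
      rwa [this.closure_eq]
  · by_cases hx : x l ≤ 0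
    · have h1 : HasFDerivWithinAt (reflSum l c t p f)
          (∑ j, (c j * (-t j) ^ p) • ((gradForm fun i => pdW (upperHS l) i f (reflL l (t j) x)).comp
            (reflL l (t j)))) {x : Pt n | x l ≤ 0} x := by
        unfold reflSum
        refine HasFDerivWithinAt.fun_sum fun j _ => ?_
        refine HasFDerivWithinAt.const_mul ?_ _
        exact (hasFDeriv_pdW (hf _ (reflL_mem (ht j) hx))).comp x
          (reflL l (t j)).hasFDerivAt.hasFDerivWithinAt (fun y hy => reflL_mem (ht j) hy)
      have h2 := h1.congr (f₁ := reflExt l c t p f) (fun y hy => reflExt_of_nonpos hc hy)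
        (reflExt_of_nonpos hc hx)
      convert h2 using 1
      rw [eq_gradForm (∑ j, (c j * (-t j) ^ p) •
        ((gradForm fun i => pdW (upperHS l) i f (reflL l (t j) x)).comp (reflL l (t j))))]
      congr 1
      ext i
      have hci : ∑ j, c j * (-t j) ^ (if i = l then p + 1 else p) = 1 := by
        split_ifs <;> assumption
      rw [reflExt_of_nonpos hci hx, reflSum]
      simp only [_root_.sum_apply, _root_.smul_apply,
        ContinuousLinearMap.comp_apply, reflL_single, map_smul, gradForm_single, smul_eq_mul]
      refine Finset.sum_congr rfl fun j _ => ?_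
      split_ifs
      · rw [pow_succ]; ring
      · ring
    · refine HasFDerivWithinAt.of_notMem_closure ?_
      have : IsClosed {x : Pt n | x l ≤ 0} := isClosed_le (continuous_apply l) continuous_const
      rwa [this.closure_eq]

lemma HB.reflExt {N : ℕ} (hα : α ∈ Ioo (0 : ℝ) 1) (ht : ∀ j, 0 ≤ t j)
    (hc : ∀ p ≤ N, ∑ j, c j * (-t j) ^ p = 1) {m p : ℕ} (hmp : m + p ≤ N)
    {f : Pt n → ℝ} {C : ℝ} (hf : HB α (upperHS l) m f C) :
    HB α univ m (reflExt l c t p f) (2 * reflC N c t * C) := by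
  have hC := hf.nonneg (isDom_upperHS l)
  induction m generalizing p f with
  | zero => exact reflExt_zero hα (by omega) ht (hc p (by omega)) hC hf.1 hf.2
  | succ m ih =>
    refine of_hasFDeriv isDom_univ ?_ (fun x _ => hasFDerivWithinAt_reflExt ht (hc p (by omega))
      (hc (p + 1) (by omega)) hf.diff x) fun i => ?_
    · intro x _
      have h1 := one_le_reflC (c := c) N ht
      rcases le_total 0 (x l) with hx | hx
      · rw [reflExt_of_nonneg hx]
        refine (hf.bound x hx).trans ?_
        nlinarith
      · rw [reflExt_of_nonpos (hc p (by omega)) hx, reflSum]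
        calc _ ≤ reflC N c t * C := abs_weight_le (by omega) ht hC fun j => ?_
          _ ≤ _ := by nlinarith
        refine (hf.bound _ (reflL_mem (ht j) hx)).trans ?_
        have := ht j
        nlinarith
    · exact ih (by split_ifs <;> omega) (hf.pd i)

lemma exists_reflection_weights (N : ℕ) : ∃ c t : Fin (N + 1) → ℝ, (∀ j, 0 ≤ t j) ∧
    ∀ p ≤ N, ∑ j, c j * (-t j) ^ p = 1 := by
  let v : Fin (N + 1) → ℝ := fun j => -((j : ℝ) + 1)
  have hv : Set.InjOn v (Finset.univ : Finset (Fin (N + 1))) := by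
    intro a _ b _ h
    simp only [v] at h
    exact Fin.ext (by exact_mod_cast (by linarith : (a : ℝ) = b))
  refine ⟨fun j => (Lagrange.basis Finset.univ v j).eval 1, fun j => (j : ℝ) + 1,
    fun j => by positivity, fun p hp => ?_⟩
  have h := Lagrange.eq_interpolate_of_eval_eq (s := Finset.univ) (v := v)
    (f := (Polynomial.X : Polynomial ℝ) ^ p) (fun j => v j ^ p) hv (by
      rw [Polynomial.degree_X_pow]; simpa using (by exact_mod_cast Nat.lt_succ_of_le hp))
    (fun i _ => by simp)
  have h2 := congrArg (Polynomial.eval 1) h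
  rw [Lagrange.interpolate_apply, Polynomial.eval_finsetSum] at h2
  simp only [Polynomial.eval_pow, Polynomial.eval_X, one_pow, Polynomial.eval_mul,
    Polynomial.eval_C] at h2
  exact (Finset.sum_congr rfl fun j _ => mul_comm _ _).trans h2.symm

end Extension

lemma exists_extension (hα : α ∈ Ioo (0 : ℝ) 1) (l : Fin n) (N : ℕ) :
    ∃ (E : (Pt n → ℝ) → Pt n → ℝ) (K : ℝ), 0 ≤ K ∧ (∀ f x, 0 ≤ x l → E f x = f x) ∧
      (∀ f g, E (fun x => f x + g x) = fun x => E f x + E g x) ∧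
      ∀ f C, HB α (upperHS l) N f C → HB α univ N (E f) (K * C) := by
  obtain ⟨c, t, ht, hc⟩ := exists_reflection_weights N
  refine ⟨reflExt l c t 0, 2 * reflC N c t, ?_, fun f x hx => reflExt_of_nonneg hx, fun f g => ?_,
    fun f C hf => hf.reflExt hα ht hc le_rfl⟩
  · linarith [one_le_reflC (c := c) N ht]
  · ext x
    simp only [reflExt, reflSum]
    split_ifs
    · rfl
    · rw [← Finset.sum_add_distrib]
      exact Finset.sum_congr rfl fun j _ => by ring

lemma pdW_of_isOpen {U : Set (Pt n)} (hU : IsOpen U) {x : Pt n} (hx : x ∈ U) (i : Fin n)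
    (f : Pt n → ℝ) : pdW U i f x = pd i f x := by
  rw [pdW, fderivWithin_of_isOpen hU hx, pd]

lemma hasFDerivWithinAt_gradForm {f : Pt n → ℝ} {L : Pt n →L[ℝ] ℝ} {v : Fin n → ℝ} {x : Pt n}
    (h : HasFDerivWithinAt f L S x) (hv : ∀ i, L (Pi.single i 1) = v i) :
    HasFDerivWithinAt f (gradForm v) S x := by
  rw [eq_gradForm L, funext hv] at h
  exact h

lemma pd_eq_zero_of_eventuallyEq {f : Pt n → ℝ} {x : Pt n}
    (h : f =ᶠ[nhds x] fun _ => (0 : ℝ)) (i : Fin n) : pd i f x = 0 := by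
  rw [pd, h.fderiv_eq]; simp

namespace HB

lemma zeroExt {m : ℕ} (hα : α ∈ Ioo (0 : ℝ) 1) {R : ℝ} {q : Pt n → ℝ} {C : ℝ}
    (hR : 0 ≤ R)
    (h : HB α (Metric.ball 0 (R + 1)) m q C) (h0 : ∀ x, R < ‖x‖ → q x = 0) : HB α univ m q C := by
  have hC := h.nonneg (isDom_ball (by linarith))
  have hcase : ∀ x : Pt n, x ∈ Metric.ball (0 : Pt n) (R + 1) ∨ R < ‖x‖ := fun x => by
    rw [mem_ball_zero_iff]; rcases lt_or_ge ‖x‖ (R + 1) with h | h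
    · exact Or.inl h
    · exact Or.inr (by linarith)
  have hbd : ∀ x ∈ univ, |q x| ≤ C := fun x _ => by
    rcases hcase x with hx | hx
    · exact h.bound x hx
    · simpa [h0 x hx]
  induction m generalizing q with
  | zero =>
    refine ⟨hbd, ?_⟩
    have key : ∀ x y : Pt n, x ∈ Metric.ball (0 : Pt n) (R + 1) → R < ‖y‖ →
        |q x - q y| ≤ C * ‖x - y‖ ^ α := by
      intro x y hx hy
      rcases lt_or_ge ‖y‖ (R + 1) with hy' | hy'
      · exact h.2 x hx y (by rwa [mem_ball_zero_iff])
      · rcases lt_or_ge R ‖x‖ with hx' | hx'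
        · rw [h0 x hx', h0 y hy]; simp; positivity
        · have : 1 ≤ ‖x - y‖ := by
            have := norm_sub_norm_le y x
            rw [norm_sub_rev] at this; linarith
          rw [h0 y hy, sub_zero]
          refine (hbd x trivial).trans ?_
          nlinarith [Real.one_le_rpow this hα.1.le]
    intro x _ y _
    rcases hcase x with hx | hx
    · rcases hcase y with hy | hy
      · exact h.2 x hx y hy
      · exact key x y hx hy
    · rcases hcase y with hy | hy
      · rw [abs_sub_comm, norm_sub_rev]; exact key y x hy hx
      · rw [h0 x hx, h0 y hy]; simp; positivity
  | succ m ih =>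
    have hev : ∀ x : Pt n, R < ‖x‖ → q =ᶠ[nhds x] fun _ => (0 : ℝ) := fun x hx => by
      filter_upwards [(isOpen_lt continuous_const continuous_norm).mem_nhds hx] with y hy
        using h0 y hy
    refine ⟨hbd, fun x _ => ?_, fun i => ?_⟩
    · rcases hcase x with hx | hx
      · exact ((h.diff x hx).differentiableAt (Metric.isOpen_ball.mem_nhds hx)).differentiableWithinAt
      · exact ((hev x hx).differentiableAt_iff.2 (differentiableAt_const _)).differentiableWithinAt
    · rw [pdW_univ]
      have h1 : HB α (Metric.ball 0 (R + 1)) m (_root_.pd i q) C :=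
        (h.pd i).congr fun x hx => (pdW_of_isOpen Metric.isOpen_ball hx i q).symm
      have h2 : ∀ x, R < ‖x‖ → _root_.pd i q x = 0 := fun x hx =>
        pd_eq_zero_of_eventuallyEq (hev x hx) i
      refine ih h1 h2 fun x _ => ?_
      rcases hcase x with hx | hx
      · exact h1.bound x hx
      · simpa [h2 x hx]

lemma zero_of_any {m : ℕ} (hS : IsDom S) (hα : α ∈ Ioo (0 : ℝ) 1) {f : Pt n → ℝ} {C : ℝ}
    (h : HB α S m f C) : HB α S 0 f ((n + 2) ^ m * C) := by
  induction m generalizing C with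
  | zero => simpa using h
  | succ m ih => convert ih (h.down hS hα) using 1; ring

lemma pdW_comp_smul {r R ε : ℝ} (hε : 0 < ε) (hR : ε * R ≤ r) {p : Pt n → ℝ}
    (hp : DifferentiableOn ℝ p (Metric.ball 0 r)) {x : Pt n} (hx : x ∈ Metric.ball (0 : Pt n) R) :
    HasFDerivWithinAt (fun x => p (ε • x))
      (gradForm fun i => ε * pdW (Metric.ball 0 r) i p (ε • x)) (Metric.ball 0 R) x := by
  have hm : ∀ y ∈ Metric.ball (0 : Pt n) R, ε • y ∈ Metric.ball (0 : Pt n) r := fun y hy => by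
    rw [mem_ball_zero_iff] at hy ⊢
    rw [norm_smul, Real.norm_of_nonneg hε.le]; nlinarith
  have h1 := (hasFDeriv_pdW (hp _ (hm x hx))).comp x
    ((ε • ContinuousLinearMap.id ℝ (Pt n)).hasFDerivAt.hasFDerivWithinAt) hm
  refine hasFDerivWithinAt_gradForm h1 fun i => ?_
  simp [gradForm_single]

lemma comp_smul {m : ℕ} (hα : α ∈ Ioo (0 : ℝ) 1) {r R ε : ℝ} (hR0 : 0 < R) (hε : 0 < ε) (hε1 : ε ≤ 1)
    (hR : ε * R ≤ r) {p : Pt n → ℝ} {C : ℝ}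
    (hp : HB α (Metric.ball 0 r) m p C) : HB α (Metric.ball 0 R) m (fun x => p (ε • x)) C := by
  have hm : ∀ y ∈ Metric.ball (0 : Pt n) R, ε • y ∈ Metric.ball (0 : Pt n) r := fun y hy => by
    rw [mem_ball_zero_iff] at hy ⊢
    rw [norm_smul, Real.norm_of_nonneg hε.le]; nlinarith
  have hC := hp.nonneg (isDom_ball (by nlinarith : 0 < r))
  induction m generalizing p with
  | zero =>
    refine ⟨fun x hx => hp.1 _ (hm x hx), fun x hx y hy => (hp.2 _ (hm x hx) _ (hm y hy)).trans ?_⟩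
    rw [← smul_sub, norm_smul, Real.norm_of_nonneg hε.le]
    have := hα.1
    gcongr
    nlinarith [norm_nonneg (x - y)]
  | succ m ih =>
    refine of_hasFDeriv (isDom_ball hR0) (fun x hx => hp.1 _ (hm x hx))
      (fun x hx => pdW_comp_smul hε hR hp.diff hx) fun i => ?_
    refine ((ih (hp.pd i)).smul (isDom_ball hR0) ε).mono ?_
    rw [abs_of_pos hε]; nlinarith

lemma comp_smul_sub {m : ℕ} (hα : α ∈ Ioo (0 : ℝ) 1) {r R ε : ℝ} (hR0 : 1 ≤ R) (hε : 0 < ε)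
    (hε1 : ε ≤ 1) (hR : ε * R ≤ r) {p : Pt n → ℝ} {C : ℝ} (hp : HB α (Metric.ball 0 r) m p C) :
    HB α (Metric.ball 0 R) m (fun x => p (ε • x) - p 0) (ε ^ α * (R * (n + 2) ^ m * C)) := by
  have hm : ∀ y ∈ Metric.ball (0 : Pt n) R, ε • y ∈ Metric.ball (0 : Pt n) r := fun y hy => by
    rw [mem_ball_zero_iff] at hy ⊢
    rw [norm_smul, Real.norm_of_nonneg hε.le]; nlinarith
  have hr : 0 < r := by nlinarith
  have hC := hp.nonneg (isDom_ball hr)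
  have hα0 := hα.1
  have h0 := hp.zero_of_any (isDom_ball hr) hα
  have hn : (0:ℝ) ≤ n := Nat.cast_nonneg n
  have hb : ∀ x ∈ Metric.ball (0 : Pt n) R,
      |p (ε • x) - p 0| ≤ ε ^ α * (R * (n + 2) ^ m * C) := by
    intro x hx
    refine (h0.2 _ (hm x hx) 0 (by simpa)).trans ?_
    rw [sub_zero, norm_smul, Real.norm_of_nonneg hε.le, Real.mul_rpow hε.le (norm_nonneg _)]
    have h2 : ‖x‖ ^ α ≤ R := by
      rw [mem_ball_zero_iff] at hx
      calc ‖x‖ ^ α ≤ R ^ α := by gcongr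
        _ ≤ R ^ (1:ℝ) := Real.rpow_le_rpow_of_exponent_le hR0 hα.2.le
        _ = R := Real.rpow_one _
    calc (n + 2) ^ m * C * (ε ^ α * ‖x‖ ^ α) ≤ (n + 2) ^ m * C * (ε ^ α * R) := by gcongr
      _ = _ := by ring
  cases m with
  | zero =>
    refine ⟨hb, fun x hx y hy => ?_⟩
    have := hp.2 _ (hm x hx) _ (hm y hy)
    rw [sub_sub_sub_cancel_right]
    refine this.trans ?_
    rw [← smul_sub, norm_smul, Real.norm_of_nonneg hε.le, Real.mul_rpow hε.le (norm_nonneg _)]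
    have : C ≤ R * (n + 2) ^ 0 * C := by nlinarith
    calc C * (ε ^ α * ‖x - y‖ ^ α) ≤ (R * (n + 2) ^ 0 * C) * (ε ^ α * ‖x - y‖ ^ α) := by gcongr
      _ = _ := by ring
  | succ m =>
    refine of_hasFDeriv (isDom_ball (by linarith)) hb
      (fun x hx => (pdW_comp_smul hε hR hp.diff hx).sub_const _) fun i => ?_
    refine (((hp.pd i).comp_smul hα (by linarith) hε hε1 hR).smul
      (isDom_ball (by linarith)) ε).mono ?_
    rw [abs_of_pos hε]
    have h1 : ε ≤ ε ^ α := by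
      calc ε = ε ^ (1:ℝ) := (Real.rpow_one _).symm
        _ ≤ _ := Real.rpow_le_rpow_of_exponent_ge hε hε1 hα.2.le
    have h2 : 1 ≤ R * ((n:ℝ) + 2) ^ (m + 1) :=
      one_le_mul_of_one_le_of_one_le hR0 (one_le_pow₀ (by linarith))
    gcongr
    nlinarith

lemma inv {m : ℕ} (hS : IsDom S) (hα : α ∈ Ioo (0 : ℝ) 1) {p : Pt n → ℝ} {C δ : ℝ} (hδ : 0 < δ)
    (hp : HB α S m p C) (hpos : ∀ x ∈ S, δ ≤ p x) : ∃ C', HB α S m (fun x => (p x)⁻¹) C' := by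
  have hne : ∀ x ∈ S, 0 < p x := fun x hx => hδ.trans_le (hpos x hx)
  have hb : ∀ x ∈ S, |(p x)⁻¹| ≤ δ⁻¹ := fun x hx => by
    rw [abs_of_pos (inv_pos.2 (hne x hx))]; exact inv_anti₀ hδ (hpos x hx)
  induction m generalizing C with
  | zero =>
    have hC := hp.nonneg hS
    refine ⟨δ⁻¹ + δ⁻¹ * δ⁻¹ * C, fun x hx => (hb x hx).trans ?_, fun x hx y hy => ?_⟩
    · have : 0 ≤ δ⁻¹ * δ⁻¹ * C := by positivity
      linarith
    · have e : (p x)⁻¹ - (p y)⁻¹ = (p x)⁻¹ * (p y)⁻¹ * (p y - p x) := by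
        have := (hne x hx).ne'; have := (hne y hy).ne'; field_simp
      rw [e, abs_mul, abs_mul]
      calc _ ≤ δ⁻¹ * δ⁻¹ * (C * ‖x - y‖ ^ α) := by
            have := hb x hx; have := hb y hy
            have h3 := hp.2 y hy x hx
            rw [norm_sub_rev] at h3
            gcongr
        _ ≤ _ := by
          have : 0 ≤ ‖x - y‖ ^ α := by positivity
          have : 0 ≤ δ⁻¹ := by positivity
          nlinarith
  | succ m ih =>
    obtain ⟨C', h'⟩ := ih (hp.down hS hα)
    have h2 := fun i => ((hp.pd i).mul hS hα (h'.mul hS hα h')).neg hS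
    set K := mulC n m * (C * (mulC n m * (C' * C')))
    have hK : 0 ≤ K := by
      have := hp.nonneg hS; have := h'.nonneg hS; have := mulC_nonneg n m; positivity
    refine ⟨δ⁻¹ + K, of_hasFDeriv hS (fun x hx => (hb x hx).trans (by linarith))
      (f' := fun i x => -(pdW S i p x * ((p x)⁻¹ * (p x)⁻¹))) (fun x hx => ?_)
      fun i => (h2 i).mono (by have : 0 < δ⁻¹ := by positivity
                               linarith)⟩
    have h3 := (hasDerivAt_inv (hne x hx).ne').comp_hasFDerivWithinAt x (hasFDeriv_pdW (hp.diff x hx))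
    refine hasFDerivWithinAt_gradForm h3 fun i => ?_
    simp only [_root_.smul_apply, gradForm_single, smul_eq_mul]
    rw [pow_two, mul_inv]; ring

lemma sqrt {m : ℕ} (hS : IsDom S) (hα : α ∈ Ioo (0 : ℝ) 1) {p : Pt n → ℝ} {C δ : ℝ} (hδ : 0 < δ)
    (hp : HB α S m p C) (hpos : ∀ x ∈ S, δ ≤ p x) : ∃ C', HB α S m (fun x => √(p x)) C' := by
  have hne : ∀ x ∈ S, 0 < p x := fun x hx => hδ.trans_le (hpos x hx)
  have hb : ∀ x ∈ S, |√(p x)| ≤ √C := fun x hx => by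
    rw [abs_of_nonneg (Real.sqrt_nonneg _)]
    exact Real.sqrt_le_sqrt ((le_abs_self _).trans (hp.bound x hx))
  induction m generalizing C with
  | zero =>
    have hC := hp.nonneg hS
    have hsδ : 0 < √δ := Real.sqrt_pos.2 hδ
    refine ⟨√C + (√δ)⁻¹ * C, fun x hx => (hb x hx).trans ?_, fun x hx y hy => ?_⟩
    · have : 0 ≤ (√δ)⁻¹ * C := by positivity
      linarith
    · have hx' := Real.sqrt_le_sqrt (hpos x hx)
      have hy' := Real.sqrt_le_sqrt (hpos y hy)
      have e : (√(p x) - √(p y)) * (√(p x) + √(p y)) = p x - p y := by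
        have := Real.mul_self_sqrt (hne x hx).le
        have := Real.mul_self_sqrt (hne y hy).le
        nlinarith
      have h1 : |√(p x) - √(p y)| * √δ ≤ C * ‖x - y‖ ^ α := by
        refine le_trans ?_ (hp.2 x hx y hy)
        rw [← e, abs_mul]
        gcongr
        rw [abs_of_pos (by linarith)]; linarith
      have h2 : |√(p x) - √(p y)| ≤ (√δ)⁻¹ * (C * ‖x - y‖ ^ α) := by
        rw [← div_eq_inv_mul, le_div_iff₀ hsδ]; exact h1
      refine h2.trans ?_
      have : 0 ≤ ‖x - y‖ ^ α := by positivity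
      have : 0 ≤ √C := by positivity
      nlinarith
  | succ m ih =>
    obtain ⟨C₁, h₁⟩ := ih (hp.down hS hα) (fun x hx => by
      rw [abs_of_nonneg (Real.sqrt_nonneg _)]
      exact Real.sqrt_le_sqrt ((le_abs_self _).trans ((hp.down hS hα).bound x hx)))
    obtain ⟨C₂, h₂⟩ := (hp.down hS hα).inv hS hα hδ hpos
    have h2 := fun i => ((hp.pd i).mul hS hα (h₁.mul hS hα h₂)).smul hS (1 / 2)
    set K := |(1 / 2 : ℝ)| * (mulC n m * (C * (mulC n m * (C₁ * C₂))))
    have hK : 0 ≤ K := by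
      have := hp.nonneg hS; have := h₁.nonneg hS; have := h₂.nonneg hS
      have := mulC_nonneg n m; positivity
    refine ⟨√C + K, of_hasFDeriv hS (fun x hx => (hb x hx).trans (by linarith))
      (f' := fun i x => 1 / 2 * (pdW S i p x * (√(p x) * (p x)⁻¹))) (fun x hx => ?_)
      fun i => (h2 i).mono (by linarith [Real.sqrt_nonneg C])⟩
    have h3 := (Real.hasDerivAt_sqrt (hne x hx).ne').comp_hasFDerivWithinAt x
      (hasFDeriv_pdW (hp.diff x hx))
    refine hasFDerivWithinAt_gradForm h3 fun i => ?_
    simp only [_root_.smul_apply, gradForm_single, smul_eq_mul]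
    have h4 := Real.mul_self_sqrt (hne x hx).le
    have h5 : 0 < √(p x) := Real.sqrt_pos.2 (hne x hx)
    have h6 : √(p x) * (p x)⁻¹ = (√(p x))⁻¹ := by
      rw [← h4]; rw [Real.sqrt_mul_self h5.le]; field_simp
    rw [h6]; field_simp

lemma tsum {m : ℕ} {f : ℕ → Pt n → ℝ} {C : ℝ} (hf : ∀ j, HB α univ m (f j) (C * (1 / 2) ^ j)) :
    HB α univ m (fun x => ∑' j, f j x) (C * 2) := by
  have hg : HasSum (fun j : ℕ => C * (1 / 2 : ℝ) ^ j) (C * 2) := hasSum_geometric_two.mul_left C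
  have hs : ∀ {g : ℕ → Pt n → ℝ} {m : ℕ}, (∀ j, HB α univ m (g j) (C * (1 / 2) ^ j)) → ∀ x,
      Summable fun j => g j x := fun hg' x =>
    Summable.of_norm_bounded hg.summable fun j => (hg' j).bound x trivial
  have hb : ∀ x ∈ univ, |∑' j, f j x| ≤ C * 2 := fun x _ => by
    rw [← Real.norm_eq_abs]
    exact tsum_of_norm_bounded hg fun j => (hf j).bound x trivial
  induction m generalizing f with
  | zero =>
    refine ⟨hb, fun x _ y _ => ?_⟩
    rw [← (hs hf x).tsum_sub (hs hf y), ← Real.norm_eq_abs]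
    have := hg.mul_right (‖x - y‖ ^ α)
    exact tsum_of_norm_bounded this fun j => (hf j).2 x trivial y trivial
  | succ m ih =>
    have hd : ∀ x, HasFDerivAt (fun x => ∑' j, f j x)
        (∑' j, gradForm fun i => pdW univ i (f j) x) x := by
      intro x
      refine hasFDerivAt_tsum (𝕜 := ℝ) (f' := fun j x => gradForm fun i => pdW univ i (f j) x) (u := fun j => n * (C * (1 / 2) ^ j))
        (hg.summable.mul_left _) (fun j x => ?_) (fun j x => ?_) (hs hf 0) x
      · have := hasFDeriv_pdW ((hf j).diff x trivial)
        rwa [hasFDerivWithinAt_univ] at this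
      · exact norm_gradForm_le _ ((hf j).nonneg isDom_univ)
          fun i => ((hf j).pd i).bound x trivial
    have hd' : ∀ x ∈ univ, HasFDerivWithinAt (fun x => ∑' j, f j x)
        (gradForm fun i => ∑' j, pdW univ i (f j) x) univ x := by
      intro x _
      rw [hasFDerivWithinAt_univ]
      convert hd x using 1
      rw [eq_gradForm (∑' j, gradForm fun i => pdW univ i (f j) x)]
      congr 1; ext i
      have hsum : Summable fun j => gradForm fun i => pdW univ i (f j) x :=
        Summable.of_norm_bounded (hg.summable.mul_left (n : ℝ)) fun j =>
          norm_gradForm_le _ ((hf j).nonneg isDom_univ) fun i => ((hf j).pd i).bound x trivial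
      have := (ContinuousLinearMap.apply ℝ ℝ (Pi.single i 1 : Pt n)).map_tsum hsum
      simpa [gradForm_single] using this.symm
    refine of_hasFDeriv isDom_univ hb hd' fun i => ih (fun j => (hf j).pd i) fun x _ => ?_
    rw [← Real.norm_eq_abs]
    exact tsum_of_norm_bounded hg fun j => ((hf j).pd i).bound x trivial

/-- Solvability of `h = r + K h` for a contraction `K` on the functions in a Hölder class which
satisfy an additional closed linear condition: vanishing off a set `B`. -/
lemma exists_fixedPoint {m : ℕ} {B : Set (Pt n)} {K : (Pt n → ℝ) → Pt n → ℝ}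
    (hK : ∀ h C, HB α univ m h C → (∀ x ∉ B, h x = 0) →
      HB α univ m (K h) (C * (1 / 2)) ∧ ∀ x ∉ B, K h x = 0)
    (hadd : ∀ h₁ h₂ C₁ C₂, HB α univ m h₁ C₁ → HB α univ m h₂ C₂ →
      (∀ x ∉ B, h₁ x = 0) → (∀ x ∉ B, h₂ x = 0) → K (fun x => h₁ x + h₂ x) = fun x => K h₁ x + K h₂ x)
    {r : Pt n → ℝ} {C : ℝ} (hr : HB α univ m r C) (hr0 : ∀ x ∉ B, r x = 0) :
    ∃ h, HB α univ m h (C * 2) ∧ (∀ x ∉ B, h x = 0) ∧ ∀ x, h x = r x + K h x := by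
  let f : ℕ → Pt n → ℝ := fun j => K^[j] r
  have hf : ∀ j, HB α univ m (f j) (C * (1 / 2) ^ j) ∧ ∀ x ∉ B, f j x = 0 := by
    intro j
    induction j with
    | zero => simpa [f] using ⟨hr, hr0⟩
    | succ j ih =>
      have := hK _ _ ih.1 ih.2
      simp only [f, Function.iterate_succ_apply'] at this ⊢
      rwa [pow_succ, ← mul_assoc]
  have hsum : ∀ x, Summable fun j => f j x := fun x =>
    Summable.of_norm_bounded (summable_geometric_two.mul_left C)
      fun j => (hf j).1.bound x trivial
  have htail : ∀ J, HB α univ m (fun x => ∑' j, f (j + J) x) (C * (1 / 2) ^ J * 2) := fun J =>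
    HB.tsum fun j => by
      have := (hf (j + J)).1
      rw [pow_add] at this
      convert this using 1; ring
  have htail0 : ∀ J, ∀ x ∉ B, ∑' j, f (j + J) x = 0 := fun J x hx => by
    simp [(hf _).2 x hx]
  have hstep : ∀ J, (fun x => ∑' j, f (j + J) x) = fun x => f J x + ∑' j, f (j + (J + 1)) x := by
    intro J; ext x
    rw [((summable_nat_add_iff J).2 (hsum x)).tsum_eq_zero_add]
    congr 1
    · simp
    · exact tsum_congr fun j => by rw [show j + 1 + J = j + (J + 1) by omega]
  have hrec : ∀ J x, K (fun x => ∑' j, f j x) x =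
      (∑' j, f (j + 1) x) + (K (fun x => ∑' j, f (j + J) x) x - ∑' j, f (j + (J + 1)) x) := by
    intro J x
    induction J with
    | zero => simp
    | succ J ih =>
      rw [ih, hstep J, hadd _ _ _ _ (hf J).1 (htail (J + 1)) (hf J).2 (htail0 (J + 1))]
      have h1 := congrFun (hstep (J + 1)) x
      have h2 : K (f J) = f (J + 1) := by simp [f, Function.iterate_succ_apply']
      rw [h2]
      linarith
  refine ⟨fun x => ∑' j, f j x, by simpa using htail 0, by simpa using htail0 0, fun x => ?_⟩
  have hz : K (fun x => ∑' j, f j x) x = ∑' j, f (j + 1) x := by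
    have hl : Filter.Tendsto (fun J : ℕ => C * (1 / 2 : ℝ) ^ J * 2 * 2) Filter.atTop (nhds 0) := by
      have := ((tendsto_pow_atTop_nhds_zero_of_lt_one (r := (1/2:ℝ)) (by norm_num)
        (by norm_num)).const_mul C).mul_const 2 |>.mul_const 2
      simpa using this
    have hle : ∀ J, |K (fun x => ∑' j, f j x) x - ∑' j, f (j + 1) x| ≤ C * (1 / 2) ^ J * 2 * 2 := by
      intro J
      rw [hrec J x, add_sub_cancel_left]
      have hC : 0 ≤ C * (1 / 2) ^ J := (hf J).1.nonneg isDom_univ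
      have h1 := (hK _ _ (htail J) (htail0 J)).1.bound x trivial
      have h2 := (htail (J + 1)).bound x trivial
      refine (abs_sub _ _).trans ?_
      rw [pow_succ] at h2
      nlinarith
    have := ge_of_tendsto' hl hle
    exact sub_eq_zero.1 (abs_eq_zero.1 (le_antisymm this (abs_nonneg _)))
  beta_reduce
  rw [hz, (hsum x).tsum_eq_zero_add]
  rfl

end HB

lemma fderivWithin_eq_sum_pdW (f : Pt n → ℝ) (x : Pt n) : fderivWithin ℝ f S x =
    ∑ i, pdW S i f x • ContinuousLinearMap.proj (R := ℝ) (φ := fun _ : Fin n => ℝ) i :=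
  eq_gradForm _

lemma norm_iteratedFDerivWithin_succ_sub {m : ℕ} (hS : UniqueDiffOn ℝ S) (f : Pt n → ℝ)
    {x y : Pt n} (hx : x ∈ S) (hy : y ∈ S) :
    ‖iteratedFDerivWithin ℝ (m + 1) f S x - iteratedFDerivWithin ℝ (m + 1) f S y‖ =
      ‖iteratedFDerivWithin ℝ m (fderivWithin ℝ f S) S x -
        iteratedFDerivWithin ℝ m (fderivWithin ℝ f S) S y‖ := by
  rw [iteratedFDerivWithin_succ_eq_comp_right hS hx, iteratedFDerivWithin_succ_eq_comp_right hS hy,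
    ← dist_eq_norm, ← dist_eq_norm]
  exact LinearIsometryEquiv.dist_map _ _ _

lemma norm_iteratedFDerivWithin_pdW_sub_le {m : ℕ} (hS : UniqueDiffOn ℝ S) {f : Pt n → ℝ}
    (hf : ContDiffOn ℝ (m + 1) f S) (i : Fin n) {x y : Pt n} (hx : x ∈ S) (hy : y ∈ S) :
    ‖iteratedFDerivWithin ℝ m (pdW S i f) S x - iteratedFDerivWithin ℝ m (pdW S i f) S y‖ ≤
      ‖iteratedFDerivWithin ℝ (m + 1) f S x - iteratedFDerivWithin ℝ (m + 1) f S y‖ := by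
  have hf' := ((contDiffOn_succ_iff_fderivWithin hS).1 hf).2.2
  set L : (Pt n →L[ℝ] ℝ) →L[ℝ] ℝ := ContinuousLinearMap.apply ℝ ℝ (Pi.single i 1 : Pt n)
  have hL : ‖L‖ ≤ 1 := by
    refine ContinuousLinearMap.opNorm_le_bound _ zero_le_one fun T => ?_
    have h1 : ‖(Pi.single i 1 : Pt n)‖ ≤ 1 := by
      refine (pi_norm_le_iff_of_nonneg zero_le_one).2 fun j => ?_
      by_cases h : j = i
      · subst h; simp
      · simp [h]
    have h2 := T.le_opNorm (Pi.single i 1 : Pt n)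
    change ‖T (Pi.single i 1)‖ ≤ _
    nlinarith [norm_nonneg T]
  have h1 : ∀ z ∈ S, iteratedFDerivWithin ℝ m (pdW S i f) S z =
      L.compContinuousMultilinearMap (iteratedFDerivWithin ℝ m (fderivWithin ℝ f S) S z) :=
    fun z hz => L.iteratedFDerivWithin_comp_left (hf' z hz) hS hz le_rfl
  rw [h1 x hx, h1 y hy, norm_iteratedFDerivWithin_succ_sub hS f hx hy]
  have h2 : ∀ a b : ContinuousMultilinearMap ℝ (fun _ : Fin m => Pt n) (Pt n →L[ℝ] ℝ),
      L.compContinuousMultilinearMap a - L.compContinuousMultilinearMap b =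
        L.compContinuousMultilinearMap (a - b) := fun a b => by
    ext v; simp
  rw [h2]
  refine (L.norm_compContinuousMultilinearMap_le _).trans ?_
  exact (mul_le_mul_of_nonneg_right hL (norm_nonneg _)).trans (by rw [one_mul])

/-- A function which is of class `C^{m+α}` with bounds on all small balls around the origin. -/
def LocH {n : ℕ} (α : ℝ) (m : ℕ) (p : Pt n → ℝ) : Prop :=
  ∀ᶠ r in nhdsWithin (0 : ℝ) (Ioi 0), ∃ C, HB α (Metric.ball 0 r) m p C

lemma LocH.of_HB {m : ℕ} {p : Pt n → ℝ} {r C : ℝ} (hr : 0 < r)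
    (h : HB α (Metric.ball 0 r) m p C) : LocH α m p := by
  filter_upwards [Ioc_mem_nhdsGT hr] with s hs
  exact ⟨C, h.subset (isDom_ball hs.1) (Metric.ball_subset_ball hs.2)⟩

lemma CHolderOn.locH {k : ℕ} (hα : α ∈ Ioo (0 : ℝ) 1) {Ω : Set (Pt n)} (hΩ : IsOpen Ω)
    (h0 : (0 : Pt n) ∈ Ω) {p : Pt n → ℝ} (hp : CHolderOn k α Ω p) : LocH α k p := by
  obtain ⟨C, t, ht, hC⟩ := hp.2 0 h0
  rw [hΩ.nhdsWithin_eq h0] at ht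
  obtain ⟨r, hr, hrt⟩ := Metric.mem_nhds_iff.1 (Filter.inter_mem ht (hΩ.mem_nhds h0))
  have key : ∀ (m : ℕ) (f : Pt n → ℝ) (r : ℝ), 0 < r → ContDiffOn ℝ m f (Metric.ball 0 r) →
      (∀ x ∈ Metric.ball (0 : Pt n) r, ∀ y ∈ Metric.ball (0 : Pt n) r,
        ‖iteratedFDerivWithin ℝ m f (Metric.ball 0 r) x -
          iteratedFDerivWithin ℝ m f (Metric.ball 0 r) y‖ ≤ C * ‖x - y‖ ^ α) → ∀ s, 0 < s → s < r →
        ∃ C', HB α (Metric.ball 0 s) m f C' := by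
    intro m
    induction m with
    | zero =>
      intro f r hr hf hfC s hs hsr
      obtain ⟨M, hM⟩ := (isCompact_closedBall (0 : Pt n) s).exists_bound_of_continuousOn
        (hf.continuousOn.mono (Metric.closedBall_subset_ball hsr))
      have hsub := Metric.ball_subset_ball (x := (0 : Pt n)) hsr.le
      refine ⟨max M C, fun x hx => (hM x (Metric.ball_subset_closedBall hx)).trans
        (le_max_left _ _), fun x hx y hy => ?_⟩
      have := hfC x (hsub hx) y (hsub hy)
      simp only [iteratedFDerivWithin_zero_eq_comp, Function.comp_apply, ← map_sub,
        LinearIsometryEquiv.norm_map] at this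
      exact this.trans (by gcongr; exact le_max_right _ _)
    | succ m ih =>
      intro f r hr hf hfC s hs hsr
      have hu := (Metric.isOpen_ball (x := (0 : Pt n)) (ε := r)).uniqueDiffOn (𝕜 := ℝ)
      have hf' := (contDiffOn_succ_iff_fderivWithin (n := (m : WithTop ℕ∞)) hu).1 hf
      obtain ⟨M, hM⟩ := (isCompact_closedBall (0 : Pt n) s).exists_bound_of_continuousOn
        (hf.continuousOn.mono (Metric.closedBall_subset_ball hsr))
      have hsub := Metric.ball_subset_ball (x := (0 : Pt n)) hsr.le
      have := fun i => ih (pdW (Metric.ball 0 r) i f) r hr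
        (hf'.2.2.clm_apply contDiffOn_const)
        (fun x hx y hy => (norm_iteratedFDerivWithin_pdW_sub_le hu hf i hx hy).trans
          (hfC x hx y hy)) s hs hsr
      choose c hc using this
      have hc0 := fun i => (hc i).nonneg (isDom_ball hs)
      have hsum : 0 ≤ ∑ i, c i := Finset.sum_nonneg fun i _ => hc0 i
      refine ⟨|M| + ∑ i, c i, fun x hx => ?_, hf'.1.mono hsub, fun i => ?_⟩
      · have h1 : |f x| ≤ M := hM x (Metric.ball_subset_closedBall hx)
        linarith [le_abs_self M]
      · refine ((hc i).mono ?_).congr fun x hx => ?_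
        · have := Finset.single_le_sum (fun i _ => hc0 i) (Finset.mem_univ i)
          linarith [abs_nonneg M]
        · rw [pdW_of_isOpen Metric.isOpen_ball hx, pdW_of_isOpen Metric.isOpen_ball (hsub hx)]
  filter_upwards [Ioo_mem_nhdsGT hr] with s hs
  refine key k p r hr (hp.1.mono fun x hx => (hrt hx).2) (fun x hx y hy => ?_) s hs.1 hs.2
  have h1 := hC.dist_le (hrt hx).1 (hrt hy).1
  rw [Real.coe_toNNReal _ hα.1.le, dist_eq_norm, dist_eq_norm] at h1
  rwa [iteratedFDerivWithin_of_isOpen k Metric.isOpen_ball hx,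
    iteratedFDerivWithin_of_isOpen k Metric.isOpen_ball hy,
    ← iteratedFDerivWithin_of_isOpen k hΩ (hrt hx).2,
    ← iteratedFDerivWithin_of_isOpen k hΩ (hrt hy).2]

lemma HB.contDiffOn {m : ℕ} (hα : α ∈ Ioo (0 : ℝ) 1) (hS : IsDom S) {f : Pt n → ℝ} {C : ℝ}
    (h : HB α S m f C) : ContDiffOn ℝ m f S ∧ ∀ x ∈ S, ∀ y ∈ S,
      ‖iteratedFDerivWithin ℝ m f S x - iteratedFDerivWithin ℝ m f S y‖ ≤
        (n : ℝ) ^ m * C * ‖x - y‖ ^ α := by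
  induction m generalizing f with
  | zero =>
    refine ⟨contDiffOn_zero.2 (h.continuousOn hα), fun x hx y hy => ?_⟩
    simp only [iteratedFDerivWithin_zero_eq_comp, Function.comp_apply, ← map_sub,
        LinearIsometryEquiv.norm_map]
    simpa using h.2 x hx y hy
  | succ m ih =>
    let P : Fin n → ℝ →L[ℝ] (Pt n →L[ℝ] ℝ) := fun i =>
      ContinuousLinearMap.toSpanSingleton ℝ
        (ContinuousLinearMap.proj (R := ℝ) (φ := fun _ : Fin n => ℝ) i)
    have hP : ∀ i, ‖P i‖ ≤ 1 := fun i => by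
      rw [ContinuousLinearMap.norm_toSpanSingleton]
      refine ContinuousLinearMap.opNorm_le_bound _ zero_le_one fun x => ?_
      simpa using norm_le_pi_norm x i
    have hfd : fderivWithin ℝ f S = ∑ i, (P i ∘ pdW S i f) := by
      ext1 x
      rw [fderivWithin_eq_sum_pdW, Finset.sum_apply]
      rfl
    have hcd : ∀ i, ContDiffOn ℝ m (P i ∘ pdW S i f) S := fun i =>
      (P i).contDiff.comp_contDiffOn (ih (h.pd i)).1
    refine ⟨(contDiffOn_succ_iff_fderivWithin hS.uniq).2 ⟨h.diff, fun h => (WithTop.natCast_ne_top (α := ℕ∞) m h).elim, ?_⟩,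
      fun x hx y hy => ?_⟩
    · rw [hfd, show (∑ i, (P i ∘ pdW S i f)) = fun x => ∑ i, (P i ∘ pdW S i f) x by
        ext1 x; exact Finset.sum_apply x _ _]
      exact ContDiffOn.sum fun i _ => hcd i
    · rw [norm_iteratedFDerivWithin_succ_sub hS.uniq f hx hy, hfd, iteratedFDerivWithin_sum_apply hS.uniq hx fun i _ => hcd i x hx,
        iteratedFDerivWithin_sum_apply hS.uniq hy fun i _ => hcd i y hy, ← Finset.sum_sub_distrib]
      have hle : ∀ i, ‖iteratedFDerivWithin ℝ m (P i ∘ pdW S i f) S x -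
          iteratedFDerivWithin ℝ m (P i ∘ pdW S i f) S y‖ ≤ (n : ℝ) ^ m * C * ‖x - y‖ ^ α := by
        intro i
        rw [(P i).iteratedFDerivWithin_comp_left ((ih (h.pd i)).1 x hx) hS.uniq hx le_rfl,
          (P i).iteratedFDerivWithin_comp_left ((ih (h.pd i)).1 y hy) hS.uniq hy le_rfl]
        have h2 : ∀ a b : ContinuousMultilinearMap ℝ (fun _ : Fin m => Pt n) ℝ,
            (P i).compContinuousMultilinearMap a - (P i).compContinuousMultilinearMap b =
              (P i).compContinuousMultilinearMap (a - b) := fun a b => by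
          ext v; simp
        rw [h2]
        refine ((P i).norm_compContinuousMultilinearMap_le _).trans ?_
        exact ((mul_le_mul_of_nonneg_right (hP i) (norm_nonneg _)).trans (by rw [one_mul])).trans
          ((ih (h.pd i)).2 x hx y hy)
      refine (norm_sum_le _ _).trans ((Finset.sum_le_sum fun i _ => hle i).trans ?_)
      simp [pow_succ]
      apply le_of_eq; ring

lemma HB.cHolderOn {m : ℕ} (hα : α ∈ Ioo (0 : ℝ) 1) (hS : IsDom S) {f : Pt n → ℝ} {C : ℝ}
    (h : HB α S m f C) : CHolderOn m α S f := by
  refine ⟨(h.contDiffOn hα hS).1, fun x _ => ⟨(n ^ m * C).toNNReal, S, self_mem_nhdsWithin,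
    fun y hy z hz => ?_⟩⟩
  have hC := h.nonneg hS
  rw [edist_dist, edist_dist, Real.coe_toNNReal _ hα.1.le,
    ENNReal.ofReal_rpow_of_nonneg dist_nonneg hα.1.le]
  change _ ≤ ENNReal.ofReal _ * _
  rw [← ENNReal.ofReal_mul (by positivity)]
  apply ENNReal.ofReal_le_ofReal
  rw [dist_eq_norm, dist_eq_norm]
  exact (h.contDiffOn hα hS).2 y hy z hz

namespace LocH

variable {m : ℕ} {p q : Pt n → ℝ}

lemma add (hp : LocH α m p) (hq : LocH α m q) : LocH α m fun x => p x + q x := by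
  filter_upwards [hp, hq, self_mem_nhdsWithin] with r ⟨A, hA⟩ ⟨B, hB⟩ hr
  exact ⟨_, hA.add (isDom_ball hr) hB⟩

lemma sub (hp : LocH α m p) (hq : LocH α m q) : LocH α m fun x => p x - q x := by
  filter_upwards [hp, hq, self_mem_nhdsWithin] with r ⟨A, hA⟩ ⟨B, hB⟩ hr
  exact ⟨_, hA.sub (isDom_ball hr) hB⟩

lemma mul (hα : α ∈ Ioo (0 : ℝ) 1) (hp : LocH α m p) (hq : LocH α m q) :
    LocH α m fun x => p x * q x := by
  filter_upwards [hp, hq, self_mem_nhdsWithin] with r ⟨A, hA⟩ ⟨B, hB⟩ hr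
  exact ⟨_, hA.mul (isDom_ball hr) hα hB⟩

lemma const (c : ℝ) : LocH (n := n) α m fun _ => c :=
  Filter.Eventually.of_forall fun _ => ⟨_, HB.const c⟩

lemma neg (hp : LocH α m p) : LocH α m fun x => - p x := by
  filter_upwards [hp, self_mem_nhdsWithin] with r ⟨A, hA⟩ hr
  exact ⟨_, hA.neg (isDom_ball hr)⟩

lemma sum {ι : Type*} (s : Finset ι) {f : ι → Pt n → ℝ} (hf : ∀ j, LocH α m (f j)) :
    LocH α m fun x => ∑ j ∈ s, f j x := by
  classical
  induction s using Finset.induction_on with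
  | empty => simpa using const 0
  | insert a s ha ih => simpa [Finset.sum_insert ha] using (hf a).add ih

lemma prod (hα : α ∈ Ioo (0 : ℝ) 1) {ι : Type*} (s : Finset ι) {f : ι → Pt n → ℝ}
    (hf : ∀ j, LocH α m (f j)) : LocH α m fun x => ∏ j ∈ s, f j x := by
  classical
  induction s using Finset.induction_on with
  | empty => simpa using const 1
  | insert a s ha ih => simpa [Finset.prod_insert ha] using (hf a).mul hα ih

lemma down (hα : α ∈ Ioo (0 : ℝ) 1) (hp : LocH α (m + 1) p) : LocH α m p := by
  filter_upwards [hp, self_mem_nhdsWithin] with r ⟨A, hA⟩ hr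
  exact ⟨_, hA.down (isDom_ball hr) hα⟩

lemma downTo (hα : α ∈ Ioo (0 : ℝ) 1) {m' : ℕ} (h : m ≤ m') (hp : LocH α m' p) : LocH α m p := by
  induction h with
  | refl => exact hp
  | step _ ih => exact ih (hp.down hα)

lemma pd (hp : LocH α (m + 1) p) (i : Fin n) : LocH α m (pd i p) := by
  filter_upwards [hp] with r ⟨A, hA⟩
  exact ⟨A, (hA.pd i).congr fun x hx => (pdW_of_isOpen Metric.isOpen_ball hx i p).symm⟩

lemma continuousAt (hα : α ∈ Ioo (0 : ℝ) 1) (hp : LocH α m p) : ContinuousAt p 0 := by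
  obtain ⟨r, ⟨C, hC⟩, hr⟩ := (hp.and self_mem_nhdsWithin).exists
  exact (hC.continuousOn hα).continuousAt (Metric.ball_mem_nhds _ hr)

lemma eventually_differentiableAt (hp : LocH α (m + 1) p) :
    ∀ᶠ x in nhds (0 : Pt n), DifferentiableAt ℝ p x := by
  obtain ⟨r, ⟨C, hC⟩, hr⟩ := (hp.and self_mem_nhdsWithin).exists
  filter_upwards [Metric.ball_mem_nhds _ hr] with x hx
  exact (hC.diff x hx).differentiableAt (Metric.isOpen_ball.mem_nhds hx)

lemma eventually_le (hα : α ∈ Ioo (0 : ℝ) 1) (hp : LocH α m p) (h0 : 0 < p 0) :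
    ∀ᶠ r in nhdsWithin (0 : ℝ) (Ioi 0), ∀ x ∈ Metric.ball (0 : Pt n) r, p 0 / 2 ≤ p x := by
  have h1 : ∀ᶠ x in nhds (0 : Pt n), p 0 / 2 < p x :=
    (hp.continuousAt hα).eventually_const_lt (by linarith)
  obtain ⟨s, hs, hsq⟩ := Metric.eventually_nhds_iff_ball.1 h1
  filter_upwards [Ioo_mem_nhdsGT hs] with r hr x hx
  exact (hsq x (Metric.ball_subset_ball hr.2.le hx)).le

lemma inv (hα : α ∈ Ioo (0 : ℝ) 1) (hp : LocH α m p) (h0 : 0 < p 0) :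
    LocH α m fun x => (p x)⁻¹ := by
  filter_upwards [hp, hp.eventually_le hα h0, self_mem_nhdsWithin] with r ⟨A, hA⟩ h hr
  exact hA.inv (isDom_ball hr) hα (by linarith) h

lemma sqrt (hα : α ∈ Ioo (0 : ℝ) 1) (hp : LocH α m p) (h0 : 0 < p 0) :
    LocH α m fun x => √(p x) := by
  filter_upwards [hp, hp.eventually_le hα h0, self_mem_nhdsWithin] with r ⟨A, hA⟩ h hr
  exact hA.sqrt (isDom_ball hr) hα (by linarith) h

lemma smul (c : ℝ) (hp : LocH α m p) : LocH α m fun x => c * p x := by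
  filter_upwards [hp, self_mem_nhdsWithin] with r ⟨A, hA⟩ hr
  exact ⟨_, hA.smul (isDom_ball hr) c⟩

end LocH

open MeasureTheory in
/-- The average of `h` at scale `s` against the kernel `ρ`. -/
def avg {n : ℕ} (ρ : Pt n → ℝ) (s : ℝ) (h : Pt n → ℝ) (x : Pt n) : ℝ :=
  ∫ y, ρ y * h (x - s • y)

/-- Smooth kernels supported in the ball of radius `r`. -/
def Ker {n : ℕ} (r : ℝ) (ρ : Pt n → ℝ) : Prop :=
  ContDiff ℝ (⊤ : ℕ∞) ρ ∧ ∀ y, r < ‖y‖ → ρ y = 0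

/-- Measurable functions bounded by `M`. -/
def BddMeas {n : ℕ} (M : ℝ) (h : Pt n → ℝ) : Prop := Measurable h ∧ ∀ x, |h x| ≤ M

namespace BddMeas

variable {M : ℝ} {h : Pt n → ℝ}

lemma nonneg (hh : BddMeas M h) : 0 ≤ M := (abs_nonneg _).trans (hh.2 0)

lemma comp_smul (hh : BddMeas M h) (s : ℝ) : BddMeas M fun x => h (s • x) :=
  ⟨hh.1.comp (measurable_const_smul s), fun _ => hh.2 _⟩

lemma locallyIntegrable (hh : BddMeas M h) : MeasureTheory.LocallyIntegrable h := by
  refine (MeasureTheory.locallyIntegrable_const M).mono hh.1.aestronglyMeasurable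
    (Filter.Eventually.of_forall fun x => ?_)
  rw [Real.norm_of_nonneg hh.nonneg]; exact hh.2 x

end BddMeas

namespace Ker

variable {r : ℝ} {ρ : Pt n → ℝ}

lemma hasCompactSupport (h : Ker r ρ) : HasCompactSupport ρ :=
  HasCompactSupport.intro (isCompact_closedBall 0 r) fun y hy => h.2 y (by simpa using hy)

lemma pd (h : Ker r ρ) (i : Fin n) : Ker r (pd i ρ) := by
  refine ⟨(h.1.fderiv_right (m := (⊤ : ℕ∞)) (by simp)).clm_apply contDiff_const, fun y hy => ?_⟩
  refine pd_eq_zero_of_eventuallyEq ?_ i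
  filter_upwards [(isOpen_lt continuous_const continuous_norm).mem_nhds hy] with z hz using h.2 z hz

lemma integrable (h : Ker r ρ) : MeasureTheory.Integrable ρ :=
  h.1.continuous.integrable_of_hasCompactSupport h.hasCompactSupport

lemma pd_comm (h : Ker r ρ) (i j : Fin n) : _root_.pd i (_root_.pd j ρ) = _root_.pd j (_root_.pd i ρ) := by
  have hd : ∀ x, DifferentiableAt ℝ (fderiv ℝ ρ) x := fun x =>
    ((h.1.fderiv_right (m := (⊤ : ℕ∞)) (by simp)).differentiable (by simp)) x
  have key : ∀ i j x, _root_.pd i (_root_.pd j ρ) x =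
      fderiv ℝ (fderiv ℝ ρ) x (Pi.single i 1) (Pi.single j 1) := fun i j x => by
    change fderiv ℝ (fun y => fderiv ℝ ρ y (Pi.single j 1)) x (Pi.single i 1) = _
    rw [fderiv_clm_apply (hd x) (differentiableAt_const _)]
    simp
  ext x
  rw [key, key]
  exact (h.1.contDiffAt.isSymmSndFDerivAt
    (by simp only [minSmoothness_of_isRCLikeNormedField]; exact WithTop.coe_le_coe.2 le_top)).eq _ _

variable {M : ℝ} {h : Pt n → ℝ}

lemma integrable_mul (hρ : Ker r ρ) (hh : BddMeas M h) (s : ℝ) (x : Pt n) :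
    MeasureTheory.Integrable fun y => ρ y * h (x - s • y) := by
  refine (hρ.integrable.norm.mul_const M).mono
    (hρ.1.continuous.aestronglyMeasurable.mul
      (hh.1.comp (by fun_prop : Measurable fun y : Pt n => x - s • y)).aestronglyMeasurable)
    (Filter.Eventually.of_forall fun y => ?_)
  rw [norm_mul, norm_mul, norm_norm, Real.norm_of_nonneg hh.nonneg]
  gcongr; exact hh.2 _

end Ker

section avg

variable {r M : ℝ} {ρ h h' : Pt n → ℝ} {s : ℝ}

open MeasureTheory

lemma abs_avg_le (hρ : Ker r ρ) {x : Pt n} (hb : ∀ y, ρ y ≠ 0 → |h (x - s • y)| ≤ M) :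
    |avg ρ s h x| ≤ (∫ y, |ρ y|) * M := by
  rw [← integral_mul_const, avg, ← Real.norm_eq_abs]
  refine norm_integral_le_of_norm_le (hρ.integrable.norm.mul_const M)
    (Filter.Eventually.of_forall fun y => ?_)
  rw [norm_mul]
  by_cases hy : ρ y = 0
  · simp [hy]
  · exact mul_le_mul_of_nonneg_left (hb y hy) (norm_nonneg _)

lemma avg_add {M' : ℝ} (hρ : Ker r ρ) (hh : BddMeas M h) (hh' : BddMeas M' h') (x : Pt n) :
    avg ρ s (fun y => h y + h' y) x = avg ρ s h x + avg ρ s h' x := by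
  rw [avg, avg, avg, ← integral_add (hρ.integrable_mul hh s x) (hρ.integrable_mul hh' s x)]
  simp only [mul_add]

lemma avg_sub {M' : ℝ} (hρ : Ker r ρ) (hh : BddMeas M h) (hh' : BddMeas M' h') (x : Pt n) :
    avg ρ s (fun y => h y - h' y) x = avg ρ s h x - avg ρ s h' x := by
  rw [avg, avg, avg, ← integral_sub (hρ.integrable_mul hh s x) (hρ.integrable_mul hh' s x)]
  simp only [mul_sub]

lemma hasFDerivAt_avg (hρ : Ker r ρ) (hs : s ≠ 0) (hh : BddMeas M h) (x : Pt n) :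
    HasFDerivAt (avg ρ s h) (gradForm fun i => s⁻¹ * avg (pd i ρ) s h x) x := by
  set L := ContinuousLinearMap.mul ℝ ℝ
  set hs' : Pt n → ℝ := fun w => h (s • w)
  have hl : LocallyIntegrable hs' := (hh.comp_smul s).locallyIntegrable
  have hA : ∀ τ : Pt n → ℝ, avg τ s h = fun x => convolution τ hs' L volume (s⁻¹ • x) := by
    intro τ; ext x
    simp [avg, convolution, L, hs', smul_sub, smul_smul, mul_inv_cancel₀ hs]
  have h1 := hρ.hasCompactSupport.hasFDerivAt_convolution_left (μ := volume) L
    (hρ.1.of_le (by simp)) hl (s⁻¹ • x)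
  have h2 : HasFDerivAt (fun x : Pt n => s⁻¹ • x) (s⁻¹ • ContinuousLinearMap.id ℝ (Pt n)) x :=
    (hasFDerivAt_id x).const_smul s⁻¹
  have h3 := h1.comp x h2
  rw [hA ρ, ← hasFDerivWithinAt_univ]
  refine hasFDerivWithinAt_gradForm (L := _) (hasFDerivWithinAt_univ.2 h3) fun i => ?_
  rw [hA]
  simp only [ContinuousLinearMap.comp_apply, _root_.smul_apply, ContinuousLinearMap.id_apply,
    map_smul, smul_eq_mul]
  congr 1
  rw [convolution, ContinuousLinearMap.integral_apply]
  · rfl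
  · exact (hρ.hasCompactSupport.fderiv ℝ).convolutionExists_left _
      (hρ.1.continuous_fderiv (by simp)) hl _

/-- Averages against `∂_i ρ` of functions which do not depend on the `i`-th variable vanish. -/
lemma avg_pd_eq_zero (hρ : Ker r ρ) (hs : s ≠ 0) (hh : BddMeas M h) {i : Fin n}
    (hi : ∀ (y : Pt n) (t : ℝ), h (y + t • (Pi.single i 1 : Pt n)) = h y) (x : Pt n) : avg (pd i ρ) s h x = 0 := by
  have h1 := hasFDerivAt_avg hρ hs hh x
  have h2 : HasDerivAt (fun t : ℝ => avg ρ s h (x + t • Pi.single i 1))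
      (s⁻¹ * avg (pd i ρ) s h x) 0 := by
    have := (h1.hasLineDerivAt (Pi.single i 1))
    rwa [gradForm_single] at this
  have h3 : (fun t : ℝ => avg ρ s h (x + t • Pi.single i 1)) = fun _ => avg ρ s h x := by
    ext t
    simp only [avg]
    congr 1; ext y
    rw [add_sub_right_comm, hi]
  rw [h3] at h2
  have := h2.unique (hasDerivAt_const _ _)
  simpa [hs] using this

lemma avg_pd_le (hα : α ∈ Ioo (0 : ℝ) 1) (hρ : Ker r ρ) (hs : 0 < s)
    (hh : BddMeas M h) {i : Fin n}
    {C : ℝ} (hC : 0 ≤ C)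
    (hi : ∀ y t, |h y - h (Function.update y i t)| ≤ C * |y i - t| ^ α) (x : Pt n) :
    |avg (pd i ρ) s h x| ≤ (∫ y, |pd i ρ y|) * (C * (s * r) ^ α) := by
  set q : Pt n → ℝ := fun z => h (Function.update z i (x i))
  have hq : BddMeas M q := ⟨hh.1.comp (by fun_prop), fun z => hh.2 _⟩
  have h0 : avg (pd i ρ) s q x = 0 := by
    refine avg_pd_eq_zero hρ hs.ne' hq (fun y t => ?_) x
    simp only [q]
    congr 1
    ext j
    by_cases hj : j = i
    · subst hj; simp
    · simp [hj]
  rw [← sub_zero (avg _ _ _ _), ← h0, ← avg_sub (hρ.pd i) hh hq]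
  refine abs_avg_le (hρ.pd i) fun y hy => (hi _ _).trans ?_
  have hy' : ‖y‖ ≤ r := not_lt.1 fun h => hy ((hρ.pd i).2 y h)
  have h2 : |y i| ≤ r := (norm_le_pi_norm y i).trans hy'
  have := hα.1
  gcongr
  simp [abs_mul, abs_of_pos hs]
  gcongr

lemma avg_pd_of_hasDerivAt (hρ : Ker r ρ) (hs : s ≠ 0) (hh : BddMeas M h) {M' : ℝ}
    (hh' : BddMeas M' h') {i : Fin n}
    (hd : ∀ y : Pt n, HasDerivAt (fun t : ℝ => h (y + t • (Pi.single i 1 : Pt n))) (h' y) 0) (x : Pt n) :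
    avg (pd i ρ) s h x = s * avg ρ s h' x := by
  have h1 : HasDerivAt (fun t : ℝ => avg ρ s h (x + t • Pi.single i 1))
      (s⁻¹ * avg (pd i ρ) s h x) 0 := by
    have := ((hasFDerivAt_avg hρ hs hh x).hasLineDerivAt (Pi.single i 1))
    rwa [gradForm_single] at this
  have h2 : HasDerivAt (fun t : ℝ => avg ρ s h (x + t • Pi.single i 1)) (avg ρ s h' x) 0 := by
    have hd' : ∀ (y : Pt n) (t : ℝ), HasDerivAt (fun t : ℝ => h (y + t • (Pi.single i 1 : Pt n)))
        (h' (y + t • Pi.single i 1)) t := fun y t => by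
      have := (hd (y + t • Pi.single i 1))
      have h3 : HasDerivAt (fun u : ℝ => u - t) 1 t := (hasDerivAt_id t).sub_const t
      have h4 := HasDerivAt.comp (h := fun u : ℝ => u - t) t (by simpa using this) h3
      refine (h4.congr_deriv (mul_one _)).congr_of_eventuallyEq
        (Filter.Eventually.of_forall fun u => ?_)
      simp only [Function.comp_apply, add_assoc, ← add_smul, add_sub_cancel]
    have := (hasDerivAt_integral_of_dominated_loc_of_deriv_le (μ := volume)
      (F := fun t y => ρ y * h (x + t • Pi.single i 1 - s • y))
      (F' := fun t y => ρ y * h' (x + t • Pi.single i 1 - s • y))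
      (bound := fun y => |ρ y| * M') (x₀ := (0 : ℝ)) Filter.univ_mem
      (Filter.Eventually.of_forall fun t =>
        (hρ.integrable_mul hh s (x + t • Pi.single i 1)).aestronglyMeasurable)
      (hρ.integrable_mul hh s _) (hρ.integrable_mul hh' s _).aestronglyMeasurable
      (Filter.Eventually.of_forall fun y t _ => ?_) (hρ.integrable.norm.mul_const _)
      (Filter.Eventually.of_forall fun y t _ => ?_)).2
    · simpa [avg] using this
    · rw [norm_mul]
      exact mul_le_mul_of_nonneg_left (hh'.2 _) (norm_nonneg _)
    · have := (hd' (x - s • y) t).const_mul (ρ y)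
      simpa only [sub_add_eq_add_sub] using this
  have := h1.unique h2
  rw [← this, ← mul_assoc, mul_inv_cancel₀ hs, one_mul]

end avg

/-- A smooth decreasing cutoff, `1` for `t ≤ 1/2` and `0` for `t ≥ 1`. -/
def cutoffProfile (t : ℝ) : ℝ := 1 - Real.smoothTransition (2 * t - 1)

lemma contDiff_cutoffProfile : ContDiff ℝ (⊤ : ℕ∞) cutoffProfile :=
  contDiff_const.sub (Real.smoothTransition.contDiff.comp
    ((contDiff_const.mul contDiff_id).sub contDiff_const))

lemma cutoffProfile_of_le {t : ℝ} (h : t ≤ 1 / 2) : cutoffProfile t = 1 := by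
  simp [cutoffProfile, Real.smoothTransition.zero_of_nonpos (show 2 * t - 1 ≤ 0 by linarith)]

lemma cutoffProfile_of_ge {t : ℝ} (h : 1 ≤ t) : cutoffProfile t = 0 := by
  simp [cutoffProfile, Real.smoothTransition.one_of_one_le (show 1 ≤ 2 * t - 1 by linarith)]

lemma cutoffProfile_nonneg (t : ℝ) : 0 ≤ cutoffProfile t :=
  sub_nonneg.2 (Real.smoothTransition.le_one _)

lemma deriv_cutoffProfile_nonpos (t : ℝ) : deriv cutoffProfile t ≤ 0 := by
  refine Antitone.deriv_nonpos (fun a b hab => ?_)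
  exact sub_le_sub_left (Real.smoothTransition.monotone (by linarith)) _

/-- A radial profile that agrees with `t ^ (-d/2)` for `t ≥ 1` and is smooth at the origin. -/
def tailProfile (d t : ℝ) : ℝ :=
  cutoffProfile t + (1 - cutoffProfile t) * t ^ (-d / 2)

lemma tailProfile_of_ge {d t : ℝ} (h : 1 ≤ t) : tailProfile d t = t ^ (-d / 2) := by
  simp [tailProfile, cutoffProfile_of_ge h]

lemma tailProfile_of_le {d t : ℝ} (h : t ≤ 1 / 2) : tailProfile d t = 1 := by
  simp [tailProfile, cutoffProfile_of_le h]

lemma contDiff_tailProfile (d : ℝ) : ContDiff ℝ (⊤ : ℕ∞) (tailProfile d) := by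
  refine contDiff_iff_contDiffAt.2 fun t => ?_
  rcases lt_or_ge t (1 / 2) with h | h
  · refine (contDiffAt_const (c := (1 : ℝ))).congr_of_eventuallyEq ?_
    filter_upwards [isOpen_Iio.mem_nhds h] with s hs using tailProfile_of_le (le_of_lt hs)
  · have hb := contDiff_cutoffProfile.contDiffAt (x := t)
    exact hb.add ((contDiffAt_const.sub hb).mul
      (contDiffAt_id.rpow_const_of_ne (by simp only [id]; linarith)))

/-- The radial source profile of `tailProfile`. -/
def sourceProfile (d t : ℝ) : ℝ := d * tailProfile d t + 2 * t * deriv (tailProfile d) t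

lemma contDiff_sourceProfile (d : ℝ) : ContDiff ℝ (⊤ : ℕ∞) (sourceProfile d) := by
  have h := contDiff_tailProfile d
  exact (contDiff_const.mul h).add ((contDiff_const.mul contDiff_id).mul
    ((contDiff_infty_iff_deriv.1 h).2))

lemma sourceProfile_eq (d : ℝ) {t : ℝ} (ht : 0 < t) :
    sourceProfile d t = d * cutoffProfile t + 2 * t * deriv cutoffProfile t * (1 - t ^ (-d / 2)) := by
  have hb : HasDerivAt cutoffProfile (deriv cutoffProfile t) t :=
    (contDiff_cutoffProfile.differentiable (by simp) t).hasDerivAt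
  have h := (hb.add ((hb.const_sub 1).mul (Real.hasDerivAt_rpow_const (p := -d / 2)
    (Or.inl ht.ne')))).deriv
  have e : deriv (tailProfile d) t = _ := h
  have h2 : t ^ (-d / 2 - 1) * t = t ^ (-d / 2) := by
    rw [← Real.rpow_add_one ht.ne']; congr 1; ring
  rw [sourceProfile, e, tailProfile, ← h2]
  ring

lemma sourceProfile_of_gt (d : ℝ) {t : ℝ} (ht : 1 < t) : sourceProfile d t = 0 := by
  have : deriv cutoffProfile t = 0 := by
    rw [Filter.EventuallyEq.deriv_eq (f := fun _ => (0 : ℝ)), deriv_const]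
    filter_upwards [isOpen_Ioi.mem_nhds ht] with s hs using cutoffProfile_of_ge (le_of_lt hs)
  rw [sourceProfile_eq d (by linarith), this, cutoffProfile_of_ge ht.le]
  ring

lemma sourceProfile_of_lt (d : ℝ) {t : ℝ} (ht : t < 1 / 2) : sourceProfile d t = d := by
  have : deriv (tailProfile d) t = 0 := by
    rw [Filter.EventuallyEq.deriv_eq (f := fun _ => (1 : ℝ)), deriv_const]
    filter_upwards [isOpen_Iio.mem_nhds ht] with s hs using tailProfile_of_le (le_of_lt hs)
  rw [sourceProfile, this, tailProfile_of_le ht.le]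
  ring

lemma sourceProfile_nonneg {d : ℝ} (hd : 0 ≤ d) (t : ℝ) : 0 ≤ sourceProfile d t := by
  rcases lt_or_ge t (1 / 2) with h | h
  · rw [sourceProfile_of_lt d h]; exact hd
  rcases lt_or_ge 1 t with h1 | h1
  · rw [sourceProfile_of_gt d h1]
  have h0 : 0 < t := by linarith
  rw [sourceProfile_eq d h0]
  have h2 : 1 ≤ t ^ (-d / 2) := Real.one_le_rpow_of_pos_of_le_one_of_nonpos h0 h1 (by linarith)
  have h3 := deriv_cutoffProfile_nonpos t
  have h4 := mul_nonneg hd (cutoffProfile_nonneg t)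
  nlinarith [mul_nonneg (mul_nonneg h0.le (neg_nonneg.2 h3)) (sub_nonneg.2 h2)]

/-- The difference of consecutive dyadic dilates of `tailProfile`. -/
def shellProfile (d t : ℝ) : ℝ := 2 ^ d * tailProfile d (4 * t) - tailProfile d t

lemma contDiff_shellProfile (d : ℝ) : ContDiff ℝ (⊤ : ℕ∞) (shellProfile d) :=
  (contDiff_const.mul ((contDiff_tailProfile d).comp (contDiff_const.mul contDiff_id))).sub
    (contDiff_tailProfile d)

lemma shellProfile_of_ge (d : ℝ) {t : ℝ} (ht : 1 ≤ t) : shellProfile d t = 0 := by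
  have h4 : (4 : ℝ) ^ (-d / 2) = 2 ^ (-d) := by
    rw [show (4 : ℝ) = 2 ^ (2 : ℝ) by norm_num, ← Real.rpow_mul (by norm_num)]
    congr 1; ring
  rw [shellProfile, tailProfile_of_ge (by linarith), tailProfile_of_ge ht,
    Real.mul_rpow (by norm_num) (by linarith), h4, ← mul_assoc, ← Real.rpow_add (by norm_num)]
  simp

/-- The primitive of `shellProfile` that vanishes for `t ≥ 1`. -/
def potentialProfile (d t : ℝ) : ℝ := ∫ x in (1 : ℝ)..t, shellProfile d x

lemma deriv_potentialProfile (d : ℝ) : deriv (potentialProfile d) = shellProfile d := by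
  ext t
  exact (contDiff_shellProfile d).continuous.deriv_integral _ _ _

lemma contDiff_potentialProfile (d : ℝ) : ContDiff ℝ (⊤ : ℕ∞) (potentialProfile d) := by
  refine contDiff_infty_iff_deriv.2 ⟨fun t => ?_, ?_⟩
  · exact ((contDiff_shellProfile d).continuous.integral_hasStrictDerivAt _ _).hasDerivAt.differentiableAt
  · rw [deriv_potentialProfile]; exact contDiff_shellProfile d

lemma potentialProfile_of_ge (d : ℝ) {t : ℝ} (ht : 1 ≤ t) : potentialProfile d t = 0 := by
  rw [potentialProfile, intervalIntegral.integral_congr (g := fun _ => (0 : ℝ))]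
  · simp
  · intro x hx
    rw [uIcc_of_le ht] at hx
    exact shellProfile_of_ge d hx.1

lemma potentialProfile_identity (d t : ℝ) :
    d * deriv (potentialProfile d) t + 2 * t * deriv (deriv (potentialProfile d)) t =
      2 ^ d * sourceProfile d (4 * t) - sourceProfile d t := by
  have hk : ∀ s, HasDerivAt (tailProfile d) (deriv (tailProfile d) s) s := fun s =>
    ((contDiff_tailProfile d).differentiable (by simp) s).hasDerivAt
  have h1 : HasDerivAt (fun t => tailProfile d (4 * t)) (deriv (tailProfile d) (4 * t) * (4 * 1)) t :=
    (hk (4 * t)).comp t ((hasDerivAt_id t).const_mul 4)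
  have h2 : deriv (shellProfile d) t = _ := ((h1.const_mul (2 ^ d)).sub (hk t)).deriv
  rw [deriv_potentialProfile, h2, shellProfile, sourceProfile, sourceProfile]
  ring

section quadratic

variable {A : Matrix (Fin n) (Fin n) ℝ} {l : Fin n}

/-- The quadratic form of a matrix. -/
def quadForm (B : Matrix (Fin n) (Fin n) ℝ) (y : Pt n) : ℝ := y ⬝ᵥ B *ᵥ y

lemma hasFDerivAt_mulVec (B : Matrix (Fin n) (Fin n) ℝ) (i : Fin n) (y : Pt n) :
    HasFDerivAt (fun y : Pt n => (B *ᵥ y) i) (gradForm (B i)) y := by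
  have : (fun y : Pt n => (B *ᵥ y) i) = gradForm (B i) := by
    ext y; rw [gradForm_apply]; rfl
  rw [this]
  exact (gradForm (B i)).hasFDerivAt

lemma hasFDerivAt_quadForm {B : Matrix (Fin n) (Fin n) ℝ} (hB : B.IsSymm) (y : Pt n) :
    HasFDerivAt (quadForm B) (gradForm fun i => 2 * (B *ᵥ y) i) y := by
  have h := HasFDerivAt.fun_sum (u := Finset.univ) fun i _ =>
    (hasFDerivAt_apply (𝕜 := ℝ) (F' := fun _ : Fin n => ℝ) i y).mul (hasFDerivAt_mulVec B i y)
  refine h.congr_fderiv ?_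
  ext v
  simp only [_root_.sum_apply, _root_.add_apply,
    _root_.smul_apply, gradForm_apply, ContinuousLinearMap.proj_apply, smul_eq_mul]
  rw [Finset.sum_add_distrib]
  have e1 : ∑ i, y i * ∑ j, B i j * v j = ∑ i, (B *ᵥ y) i * v i := by
    simp only [mulVec, dotProduct, Finset.mul_sum, Finset.sum_mul]
    rw [Finset.sum_comm]
    refine Finset.sum_congr rfl fun i _ => Finset.sum_congr rfl fun j _ => ?_
    rw [hB.apply i j]; ring
  rw [e1, ← Finset.sum_add_distrib]
  exact Finset.sum_congr rfl fun i _ => by ring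

lemma contDiff_quadForm (B : Matrix (Fin n) (Fin n) ℝ) : ContDiff ℝ (⊤ : ℕ∞) (quadForm B) := by
  unfold quadForm dotProduct mulVec dotProduct
  fun_prop

lemma quadForm_smul (B : Matrix (Fin n) (Fin n) ℝ) (t : ℝ) (y : Pt n) :
    quadForm B (t • y) = t ^ 2 * quadForm B y := by
  simp only [quadForm, mulVec_smul, dotProduct_smul, smul_dotProduct, smul_eq_mul]
  ring

lemma exists_quadForm_ge {B : Matrix (Fin n) (Fin n) ℝ} (hB : B.PosDef) :
    ∃ c > 0, ∀ y, c * ‖y‖ ^ 2 ≤ quadForm B y := by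
  have hpos : ∀ y : Pt n, y ≠ 0 → 0 < quadForm B y := fun y hy => by
    simpa [quadForm] using hB.dotProduct_mulVec_pos hy
  have hunit : ∀ y : Pt n, y ≠ 0 → ‖y‖⁻¹ • y ∈ Metric.sphere (0 : Pt n) 1 := fun y hy => by
    simp [norm_smul, inv_mul_cancel₀ (norm_ne_zero_iff.2 hy)]
  have h0 : quadForm B 0 = 0 := by simp [quadForm]
  rcases (Metric.sphere (0 : Pt n) 1).eq_empty_or_nonempty with he | hne
  · refine ⟨1, one_pos, fun y => ?_⟩
    by_cases hy : y = 0
    · subst hy; simp [h0]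
    · have := hunit y hy; rw [he] at this; exact this.elim
  · obtain ⟨z, hz, hmin⟩ := (isCompact_sphere (0 : Pt n) 1).exists_isMinOn hne
      (contDiff_quadForm B).continuous.continuousOn
    refine ⟨quadForm B z, hpos z (fun h => by simp [h] at hz), fun y => ?_⟩
    by_cases hy : y = 0
    · subst hy; simp [h0]
    · have h1 : quadForm B z ≤ quadForm B (‖y‖⁻¹ • y) := hmin (hunit y hy)
      rw [quadForm_smul] at h1
      have h2 : 0 < ‖y‖ := norm_pos_iff.2 hy
      rw [inv_pow, inv_mul_eq_div, le_div_iff₀ (by positivity)] at h1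
      exact h1

lemma pd_comp_quadForm {B : Matrix (Fin n) (Fin n) ℝ} (hB : B.IsSymm) {G : ℝ → ℝ}
    (hG : ContDiff ℝ (⊤ : ℕ∞) G) (i : Fin n) :
    pd i (fun y => G (quadForm B y / 2)) = fun y => deriv G (quadForm B y / 2) * (B *ᵥ y) i := by
  ext y
  have h1 : HasDerivAt G (deriv G (quadForm B y / 2)) (quadForm B y / 2) :=
    (hG.differentiable (by simp) _).hasDerivAt
  have h2 : HasFDerivAt (fun y => quadForm B y / 2) ((1 / 2 : ℝ) • gradForm fun i => 2 * (B *ᵥ y) i) y := by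
    have := (hasFDerivAt_quadForm hB y).const_mul (1 / 2)
    refine this.congr_of_eventuallyEq (Filter.Eventually.of_forall fun z => ?_)
    change quadForm B z / 2 = 1 / 2 * quadForm B z
    ring
  have h3 : HasFDerivAt (fun y => G (quadForm B y / 2)) _ y := h1.comp_hasFDerivAt y h2
  rw [pd, h3.fderiv]
  simp only [_root_.smul_apply, gradForm_single, smul_eq_mul]
  ring

lemma pd_pd_comp_quadForm {B : Matrix (Fin n) (Fin n) ℝ} (hB : B.IsSymm) {G : ℝ → ℝ}
    (hG : ContDiff ℝ (⊤ : ℕ∞) G) (i j : Fin n) (y : Pt n) :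
    pd i (pd j (fun y => G (quadForm B y / 2))) y =
      deriv (deriv G) (quadForm B y / 2) * (B *ᵥ y) i * (B *ᵥ y) j +
        deriv G (quadForm B y / 2) * B j i := by
  have hG' := (contDiff_infty_iff_deriv.1 hG).2
  rw [pd_comp_quadForm hB hG]
  have hd : HasFDerivAt (fun y => deriv G (quadForm B y / 2)) _ y :=
    ((hG'.comp ((contDiff_quadForm B).div_const 2)).differentiable (by simp) y).hasFDerivAt
  have h3 : HasFDerivAt (fun y => deriv G (quadForm B y / 2) * (B *ᵥ y) j) _ y :=
    hd.mul (hasFDerivAt_mulVec B j y)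
  rw [pd, h3.fderiv]
  simp only [_root_.add_apply, _root_.smul_apply, gradForm_single,
    smul_eq_mul]
  have := congrFun (pd_comp_quadForm hB hG' i) y
  rw [pd] at this
  change _ + _ * fderiv ℝ (fun y => deriv G (quadForm B y / 2)) y (Pi.single i 1) = _
  rw [this]
  ring

/-- The reflection in the hyperplane `x_l = 0` along the conormal direction `A e_l`. -/
def conormalRefl (A : Matrix (Fin n) (Fin n) ℝ) (l : Fin n) : Pt n →L[ℝ] Pt n :=
  .id ℝ (Pt n) - (ContinuousLinearMap.proj (R := ℝ) (φ := fun _ : Fin n => ℝ) l).smulRight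
    ((2 / A l l) • A.col l)

lemma conormalRefl_apply (x : Pt n) :
    conormalRefl A l x = x - (2 * x l / A l l) • A.col l := by
  simp only [conormalRefl, _root_.sub_apply, ContinuousLinearMap.smulRight_apply,
    ContinuousLinearMap.proj_apply, smul_smul]
  congr 2; ring

lemma conormalRefl_apply_l (hA : A l l ≠ 0) (x : Pt n) : conormalRefl A l x l = -x l := by
  rw [conormalRefl_apply]
  simp only [Pi.sub_apply, Pi.smul_apply, Matrix.col_apply, smul_eq_mul]
  field_simp; ring

lemma conormalRefl_conormalRefl (hA : A l l ≠ 0) (x : Pt n) :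
    conormalRefl A l (conormalRefl A l x) = x := by
  rw [conormalRefl_apply, conormalRefl_apply_l hA, conormalRefl_apply, sub_sub, ← add_smul]
  rw [show 2 * x l / A l l + 2 * -x l / A l l = 0 by ring]
  simp

lemma conormalRefl_of_eq_zero {x : Pt n} (hx : x l = 0) : conormalRefl A l x = x := by
  rw [conormalRefl_apply, hx]; simp

lemma conormalRefl_add_single {i : Fin n} (hi : i ≠ l) (x : Pt n) (t : ℝ) :
    conormalRefl A l (x + t • Pi.single i 1) = conormalRefl A l x + t • Pi.single i 1 := by
  have h : (x + t • (Pi.single i 1 : Pt n)) l = x l := by simp [hi.symm]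
  rw [conormalRefl_apply, conormalRefl_apply, h]
  abel

lemma quadForm_conormalRefl (hAs : A.IsSymm) (hA : A.PosDef) (x : Pt n) :
    quadForm A⁻¹ (conormalRefl A l x) = quadForm A⁻¹ x := by
  have hl : A l l ≠ 0 := (hA.diag_pos (i := l)).ne'
  have hu : IsUnit A.det := (Matrix.isUnit_iff_isUnit_det A).1 hA.isUnit
  have hc : A.col l = A *ᵥ Pi.single l 1 := by ext i; simp
  have hb : A⁻¹ *ᵥ A.col l = Pi.single l 1 := by
    rw [hc, mulVec_mulVec, nonsing_inv_mul A hu, one_mulVec]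
  have hs : A⁻¹.IsSymm := by
    rw [Matrix.IsSymm, transpose_nonsing_inv, hAs]
  have h1 : A.col l ⬝ᵥ A⁻¹ *ᵥ x = x l := by
    rw [dotProduct_mulVec, ← mulVec_transpose, hs, hb]; simp
  rw [conormalRefl_apply, quadForm, mulVec_sub, mulVec_smul, hb, sub_dotProduct, dotProduct_sub,
    dotProduct_sub, smul_dotProduct, smul_dotProduct, h1, quadForm]
  simp only [dotProduct_smul, smul_eq_mul, dotProduct_single, mul_one, Matrix.col_apply]
  field_simp
  ring

lemma measurePreserving_conormalRefl (hA : A l l ≠ 0) :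
    MeasureTheory.MeasurePreserving (conormalRefl A l) := by
  have hd : LinearMap.det (conormalRefl A l : Pt n →ₗ[ℝ] Pt n) *
      LinearMap.det (conormalRefl A l : Pt n →ₗ[ℝ] Pt n) = 1 := by
    rw [← LinearMap.det_comp]
    have : (conormalRefl A l : Pt n →ₗ[ℝ] Pt n) ∘ₗ (conormalRefl A l : Pt n →ₗ[ℝ] Pt n) =
        LinearMap.id := LinearMap.ext fun x => conormalRefl_conormalRefl hA x
    rw [this, LinearMap.det_id]
  refine ⟨(conormalRefl A l).continuous.measurable, ?_⟩
  have h0 : LinearMap.det (conormalRefl A l : Pt n →ₗ[ℝ] Pt n) ≠ 0 := fun h => by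
    rw [h] at hd; simp at hd
  have := Real.map_linearMap_volume_pi_eq_smul_volume_pi h0
  rw [abs_inv, show |LinearMap.det (conormalRefl A l : Pt n →ₗ[ℝ] Pt n)| = 1 by
    rcases mul_self_eq_one_iff.1 hd with h | h <;> rw [h] <;> simp] at this
  simpa using this

lemma exists_kernel (hAs : A.IsSymm) (hA : A.PosDef) (l : Fin n) :
    ∃ (r : ℝ) (Ψ φ : Pt n → ℝ), 0 < r ∧ Ker r Ψ ∧ Ker r φ ∧ 0 < ∫ y, φ y ∧
      (∀ y, Ψ (conormalRefl A l y) = Ψ y) ∧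
      ∀ y, ∑ i, ∑ j, A i j * pd i (pd j Ψ) y = 2 ^ n * φ ((2 : ℝ) • y) - φ y := by
  have hu : IsUnit A.det := (Matrix.isUnit_iff_isUnit_det A).1 hA.isUnit
  have hs : A⁻¹.IsSymm := by
    rw [Matrix.IsSymm, transpose_nonsing_inv, hAs]
  obtain ⟨c, hc, hQ⟩ := exists_quadForm_ge hA.inv
  have hn : 0 < n := l.pos
  have hr : ∀ y : Pt n, Real.sqrt (2 / c) < ‖y‖ → 1 < quadForm A⁻¹ y / 2 := fun y hy => by
    have h1 : 2 / c < ‖y‖ ^ 2 := (Real.sqrt_lt' ((Real.sqrt_nonneg _).trans_lt hy)).1 hy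
    rw [div_lt_iff₀ hc] at h1
    linarith [hQ y]
  have hkφ : Ker (Real.sqrt (2 / c)) fun y : Pt n => sourceProfile n (quadForm A⁻¹ y / 2) :=
    ⟨(contDiff_sourceProfile n).comp ((contDiff_quadForm _).div_const 2),
      fun y hy => sourceProfile_of_gt _ (hr y hy)⟩
  refine ⟨Real.sqrt (2 / c), fun y => potentialProfile n (quadForm A⁻¹ y / 2),
    fun y => sourceProfile n (quadForm A⁻¹ y / 2), by positivity,
    ⟨(contDiff_potentialProfile n).comp ((contDiff_quadForm _).div_const 2),
      fun y hy => potentialProfile_of_ge _ (hr y hy).le⟩, hkφ, ?_, fun y => ?_, fun y => ?_⟩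
  · refine Continuous.integral_pos_of_hasCompactSupport_nonneg_nonzero (x := 0) hkφ.1.continuous
      hkφ.hasCompactSupport (fun y => sourceProfile_nonneg (by positivity) _) ?_
    have : quadForm A⁻¹ (0 : Pt n) = 0 := by simp [quadForm]
    rw [this, sourceProfile_of_lt _ (by norm_num)]
    exact_mod_cast hn.ne'
  · simp only [quadForm_conormalRefl hAs hA]
  · have h4 : quadForm A⁻¹ ((2 : ℝ) • y) / 2 = 4 * (quadForm A⁻¹ y / 2) := by
      rw [quadForm_smul]; ring
    beta_reduce
    rw [h4, ← Real.rpow_natCast, ← potentialProfile_identity]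
    simp only [pd_pd_comp_quadForm hs (contDiff_potentialProfile n), mul_add,
      Finset.sum_add_distrib]
    have e1 : ∑ i, ∑ j, A i j * (A⁻¹ *ᵥ y) i * (A⁻¹ *ᵥ y) j = quadForm A⁻¹ y := by
      have : A *ᵥ (A⁻¹ *ᵥ y) = y := by rw [mulVec_mulVec, mul_nonsing_inv A hu, one_mulVec]
      have h : quadForm A⁻¹ y = (A⁻¹ *ᵥ y) ⬝ᵥ A *ᵥ (A⁻¹ *ᵥ y) := by
        rw [this, dotProduct_comm, quadForm]
      rw [h]
      generalize A⁻¹ *ᵥ y = z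
      simp only [dotProduct, mulVec, Finset.mul_sum]
      exact Finset.sum_congr rfl fun i _ => Finset.sum_congr rfl fun j _ => by ring
    have e2 : ∑ i, ∑ j, A i j * A⁻¹ j i = n := by
      have := congrArg Matrix.trace (mul_nonsing_inv A hu)
      simpa [Matrix.trace, Matrix.mul_apply] using this
    set t := quadForm A⁻¹ y / 2
    have e3 : ∑ i, ∑ j, A i j * (deriv (deriv (potentialProfile n)) t * (A⁻¹ *ᵥ y) i * (A⁻¹ *ᵥ y) j)
        = deriv (deriv (potentialProfile n)) t * quadForm A⁻¹ y := by
      rw [← e1]; simp only [Finset.mul_sum]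
      exact Finset.sum_congr rfl fun i _ => Finset.sum_congr rfl fun j _ => by ring
    have e4 : ∑ i, ∑ j, A i j * (deriv (potentialProfile n) t * A⁻¹ j i)
        = deriv (potentialProfile n) t * n := by
      rw [← e2]; simp only [Finset.mul_sum]
      exact Finset.sum_congr rfl fun i _ => Finset.sum_congr rfl fun j _ => by ring
    rw [e3, e4, show quadForm A⁻¹ y = 2 * t by simp only [t]; ring]
    ring

end quadratic

section oddExt

variable {A : Matrix (Fin n) (Fin n) ℝ} {l i : Fin n} {h h' : Pt n → ℝ} {M r s : ℝ} {ρ : Pt n → ℝ}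

/-- The extension of `h` from `x_l > 0` which is odd under `conormalRefl A l`. -/
def oddExt (A : Matrix (Fin n) (Fin n) ℝ) (l : Fin n) (h : Pt n → ℝ) (x : Pt n) : ℝ :=
  if 0 < x l then h x else if x l < 0 then -h (conormalRefl A l x) else 0

lemma oddExt_of_pos {x : Pt n} (hx : 0 < x l) : oddExt A l h x = h x := by simp [oddExt, hx]

lemma oddExt_conormalRefl (hA : A l l ≠ 0) (x : Pt n) :
    oddExt A l h (conormalRefl A l x) = -oddExt A l h x := by
  simp only [oddExt, conormalRefl_apply_l hA, conormalRefl_conormalRefl hA]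
  rcases lt_trichotomy (x l) 0 with h0 | h0 | h0
  · simp [h0, h0.le.not_gt]
  · simp [h0]
  · simp [h0, h0.le.not_gt]

lemma bddMeas_oddExt (hh : BddMeas M h) : BddMeas M (oddExt A l h) := by
  have hl : Measurable fun x : Pt n => x l := measurable_pi_apply l
  refine ⟨Measurable.ite (measurableSet_lt measurable_const hl) hh.1
    (Measurable.ite (measurableSet_lt hl measurable_const)
      (hh.1.comp (conormalRefl A l).continuous.measurable).neg measurable_const), fun x => ?_⟩
  unfold oddExt
  split_ifs
  · exact hh.2 _
  · rw [abs_neg]; exact hh.2 _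
  · simpa using hh.nonneg

lemma oddExt_add : oddExt A l (fun x => h x + h' x) =
    fun x => oddExt A l h x + oddExt A l h' x := by
  ext x
  unfold oddExt
  split_ifs <;> ring

lemma oddExt_holder (hil : i ≠ l) (hα : α ∈ Ioo (0 : ℝ) 1) (hM : 0 ≤ M)
    (hh : ∀ x y, |h x - h y| ≤ M * ‖x - y‖ ^ α) (x : Pt n) (t : ℝ) :
    |oddExt A l h x - oddExt A l h (Function.update x i t)| ≤ M * |x i - t| ^ α := by
  have hu : Function.update x i t = x + (t - x i) • (Pi.single i 1 : Pt n) := by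
    ext j
    by_cases hj : j = i
    · subst hj; simp
    · simp [hj]
  have hn : ∀ z : Pt n, ‖z - (z + (t - x i) • (Pi.single i 1 : Pt n))‖ = |x i - t| := fun z => by
    rw [sub_add_cancel_left, norm_neg, norm_smul, Pi.norm_single, Real.norm_eq_abs, norm_one, mul_one, abs_sub_comm]
  have hl : (Function.update x i t) l = x l := Function.update_of_ne hil.symm _ _
  unfold oddExt
  rw [hl]
  split_ifs
  · rw [hu, ← hn x]; exact hh _ _
  · rw [hu, conormalRefl_add_single hil, neg_sub_neg, ← hn (conormalRefl A l x), abs_sub_comm]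
    exact hh _ _
  · have := hα.1; simp; positivity

lemma hasDerivAt_oddExt (hil : i ≠ l)
    (hd : ∀ y : Pt n, HasDerivAt (fun t : ℝ => h (y + t • (Pi.single i 1 : Pt n))) (h' y) 0) (y : Pt n) :
    HasDerivAt (fun t : ℝ => oddExt A l h (y + t • (Pi.single i 1 : Pt n))) (oddExt A l h' y) 0 := by
  have hl : ∀ t : ℝ, (y + t • (Pi.single i 1 : Pt n)) l = y l := fun t => by simp [hil.symm]
  unfold oddExt
  simp only [hl, conormalRefl_add_single hil]
  split_ifs
  · exact hd y
  · exact (hd _).neg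
  · exact hasDerivAt_const _ _

lemma oddExt_eq_zero (hA : A l l ≠ 0) {R : ℝ} (hh : ∀ x, R < ‖x‖ → h x = 0) {x : Pt n}
    (hx : R < ‖x‖) (hx' : ‖conormalRefl A l‖ * R < ‖x‖) : oddExt A l h x = 0 := by
  unfold oddExt
  split_ifs
  · exact hh x hx
  · rw [hh, neg_zero]
    by_contra hc
    have h1 := (conormalRefl A l).le_opNorm (conormalRefl A l x)
    rw [conormalRefl_conormalRefl hA] at h1
    have := mul_le_mul_of_nonneg_left (not_lt.1 hc) (norm_nonneg (conormalRefl A l))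
    linarith
  · rfl

lemma avg_congr {x : Pt n} (hb : ∀ y, ρ y ≠ 0 → h (x - s • y) = h' (x - s • y)) :
    avg ρ s h x = avg ρ s h' x := by
  unfold avg
  congr 1
  ext y
  by_cases hy : ρ y = 0
  · simp [hy]
  · rw [hb y hy]

lemma avg_oddExt_of_pos (hρ : Ker r ρ) (hs : 0 < s) {x : Pt n} (hx : s * r < x l) :
    avg ρ s (oddExt A l h) x = avg ρ s h x := by
  refine avg_congr fun y hy => oddExt_of_pos ?_
  have hy' : ‖y‖ ≤ r := not_lt.1 fun h => hy (hρ.2 y h)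
  have h2 : |y l| ≤ r := (norm_le_pi_norm y l).trans hy'
  simp only [Pi.sub_apply, Pi.smul_apply, smul_eq_mul]
  nlinarith [le_abs_self (y l)]

lemma avg_oddExt_eq_zero (hA : A l l ≠ 0) (hρ : ∀ y, ρ (conormalRefl A l y) = ρ y) {x : Pt n}
    (hx : x l = 0) : avg ρ s (oddExt A l h) x = 0 := by
  have h1 : avg ρ s (oddExt A l h) x = -avg ρ s (oddExt A l h) x := by
    conv_lhs => rw [avg]
    have he : MeasurableEmbedding (conormalRefl A l) :=
      (Homeomorph.mk ⟨conormalRefl A l, conormalRefl A l, conormalRefl_conormalRefl hA,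
        conormalRefl_conormalRefl hA⟩ (conormalRefl A l).continuous
        (conormalRefl A l).continuous).measurableEmbedding
    rw [← (measurePreserving_conormalRefl hA).integral_comp he, avg, ← MeasureTheory.integral_neg]
    congr 1; ext y
    have : x - s • conormalRefl A l y = conormalRefl A l (x - s • y) := by
      rw [map_sub, map_smul, conormalRefl_of_eq_zero hx]
    rw [hρ, this, oddExt_conormalRefl hA]
    ring
  linarith

open MeasureTheory in
lemma abs_avg_sub_le (hα : α ∈ Ioo (0 : ℝ) 1) (hρ : Ker r ρ) (hs : 0 < s) (hh : BddMeas M h)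
    (hM : ∀ x y, |h x - h y| ≤ M * ‖x - y‖ ^ α) (x : Pt n) :
    |avg ρ s h x - (∫ y, ρ y) * h x| ≤ (∫ y, |ρ y|) * (M * (s * r) ^ α) := by
  have h1 : (∫ y, ρ y) * h x = avg ρ s (fun _ => h x) x := by rw [avg, integral_mul_const]
  have hc : BddMeas M (fun _ : Pt n => h x) := ⟨measurable_const, fun _ => hh.2 x⟩
  rw [h1, ← avg_sub hρ hh hc]
  refine abs_avg_le hρ fun y hy => (hM _ _).trans ?_
  have hy' : ‖y‖ ≤ r := not_lt.1 fun h => hy (hρ.2 y h)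
  have := hα.1
  have := hh.nonneg
  have e : ‖x - s • y - x‖ ≤ s * r := by
    rw [sub_sub_cancel_left, norm_neg, norm_smul, Real.norm_of_nonneg hs.le]
    gcongr
  gcongr

lemma HB.bddMeas {m : ℕ} {C : ℝ} (hα : α ∈ Ioo (0 : ℝ) 1) (hh : HB α univ m h C) : BddMeas C h :=
  ⟨(continuousOn_univ.1 (hh.continuousOn hα)).measurable, fun x => hh.bound x (mem_univ x)⟩

open MeasureTheory in
/-- Averages at large scale of compactly supported functions are small. -/
lemma exists_abs_avg_le (hn : 0 < n) (hρ : Ker r ρ) (R : ℝ) : ∃ κ, 0 ≤ κ ∧ ∀ (s M : ℝ) (h : Pt n → ℝ), 1 ≤ s →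
    BddMeas M h → (∀ x, R < ‖x‖ → h x = 0) → ∀ x, |avg ρ s h x| ≤ κ * M / s := by
  obtain ⟨P, hP⟩ := hρ.1.continuous.bounded_above_of_compact_support hρ.hasCompactSupport
  have hP0 : 0 ≤ P := (norm_nonneg _).trans (hP 0)
  refine ⟨P * (2 * |R|) ^ n, by positivity, fun s M h hs hh h0 x => ?_⟩
  have hs0 : 0 < s := by linarith
  have hM := hh.nonneg
  set B := Metric.closedBall (s⁻¹ • x) (|R| / s)
  have hz : ∀ y, y ∉ B → ρ y * h (x - s • y) = 0 := fun y hy => by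
    rw [h0, mul_zero]
    have h1 : |R| / s < ‖y - s⁻¹ • x‖ := by simpa [B, dist_eq_norm] using hy
    have h2 : x - s • y = -(s • (y - s⁻¹ • x)) := by
      rw [smul_sub, smul_smul, mul_inv_cancel₀ hs0.ne', one_smul, neg_sub]
    rw [h2, norm_neg, norm_smul, Real.norm_of_nonneg hs0.le]
    rw [div_lt_iff₀ hs0] at h1
    linarith [le_abs_self R]
  rw [avg, ← setIntegral_eq_integral_of_forall_compl_eq_zero (s := B) (fun y hy => hz y hy)]
  have hvol : volume.real B = (2 * (|R| / s)) ^ n := by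
    have : volume B = ENNReal.ofReal ((2 * (|R| / s)) ^ n) := by
      have := Real.volume_pi_closedBall (s⁻¹ • x) (r := |R| / s) (by positivity)
      simpa using this
    rw [measureReal_def, this, ENNReal.toReal_ofReal (by positivity)]
  have h3 := norm_setIntegral_le_of_norm_le_const (μ := volume) (s := B) (C := P * M)
    (f := fun y => ρ y * h (x - s • y)) (measure_closedBall_lt_top)
    (fun y _ => by
      rw [norm_mul]
      exact mul_le_mul (hP y) (hh.2 _) (norm_nonneg _) hP0)
  rw [hvol, Real.norm_eq_abs] at h3
  refine h3.trans ?_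
  have h4 : (2 * (|R| / s)) ^ n = (2 * |R|) ^ n / s ^ n := by
    rw [← div_pow]; ring_nf
  have h5 : s ≤ s ^ n := le_self_pow₀ hs hn.ne'
  rw [h4]
  calc P * M * ((2 * |R|) ^ n / s ^ n) ≤ P * M * ((2 * |R|) ^ n / s) := by gcongr
    _ = _ := by ring

lemma exists_HB_avg (hα : α ∈ Ioo (0 : ℝ) 1) (hn : 0 < n) (hρ : Ker r ρ) (R : ℝ) (m : ℕ) : ∃ κ, 0 ≤ κ ∧
    ∀ (s M : ℝ) (h : Pt n → ℝ), 1 ≤ s → BddMeas M h → (∀ x, R < ‖x‖ → h x = 0) →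
      HB α univ m (avg ρ s h) (κ * M / s) := by
  have hgrad : ∀ {ρ : Pt n → ℝ}, Ker r ρ → ∀ {s M : ℝ} {h : Pt n → ℝ}, 1 ≤ s → BddMeas M h → ∀ x ∈ (univ : Set (Pt n)),
      HasFDerivWithinAt (avg ρ s h) (gradForm fun i => s⁻¹ * avg (pd i ρ) s h x) univ x :=
    fun hρ s M h hs hh x _ => (hasFDerivAt_avg hρ (by positivity) hh x).hasFDerivWithinAt
  have hinv : ∀ {s a : ℝ}, 1 ≤ s → 0 ≤ a → |s⁻¹| * a ≤ a := fun {s a} hs ha => by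
    rw [abs_of_pos (by positivity)]
    exact mul_le_of_le_one_left ha (inv_le_one_of_one_le₀ hs)
  induction m generalizing ρ with
  | zero =>
    obtain ⟨κ, hκ0, hκ⟩ := exists_abs_avg_le hn hρ R
    choose κ' hκ' H using fun i => exists_abs_avg_le hn (hρ.pd i) R
    have hk := fun i => Finset.single_le_sum (fun i _ => hκ' i) (Finset.mem_univ i)
    have hK : 0 ≤ κ + ∑ i, κ' i := add_nonneg hκ0 (Finset.sum_nonneg fun i _ => hκ' i)
    refine ⟨(n + 2) * (κ + ∑ i, κ' i), by positivity, fun s M h hs hh h0 => ?_⟩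
    have hM := hh.nonneg
    have hg : ∀ x ∈ (univ : Set (Pt n)), _ := hgrad hρ hs hh
    have := HB.zero_of_pd (C := (κ + ∑ i, κ' i) * M / s) isDom_univ hα
      (fun x _ => (hκ s M h hs hh h0 x).trans (by gcongr; linarith [Finset.sum_nonneg fun i (_ : i ∈ Finset.univ) => hκ' i]))
      (fun x hx => (hg x hx).differentiableWithinAt)
      (fun i x hx => by
        rw [pdW_of_hasFDeriv isDom_univ hx (hg x hx) i, abs_mul]
        refine (hinv hs (abs_nonneg _)).trans ((H i s M h hs hh h0 x).trans ?_)
        gcongr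
        linarith [hk i])
    convert this using 1
    ring
  | succ m ih =>
    choose κ' hκ' H using fun i => ih (hρ.pd i)
    obtain ⟨κ, hκ0, hκ⟩ := exists_abs_avg_le hn hρ R
    have hk := fun i => Finset.single_le_sum (fun i _ => hκ' i) (Finset.mem_univ i)
    refine ⟨κ + ∑ i, κ' i, add_nonneg hκ0 (Finset.sum_nonneg fun i _ => hκ' i),
      fun s M h hs hh h0 => ?_⟩
    have hM := hh.nonneg
    refine HB.of_hasFDeriv isDom_univ (fun x _ => (hκ s M h hs hh h0 x).trans ?_)
      (hgrad hρ hs hh) fun i => ((H i s M h hs hh h0).smul isDom_univ s⁻¹).mono ?_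
    · gcongr; linarith [Finset.sum_nonneg fun i (_ : i ∈ Finset.univ) => hκ' i]
    · have := hκ' i
      refine (hinv hs (by positivity)).trans ?_
      gcongr
      linarith [hk i]

end oddExt

/-- The Hölder constant of a dyadic sum. -/
def dyadicC (α : ℝ) : ℝ := 2 / (2 * (1 / 2) ^ α - 1) + 2 / (1 - (1 / 2) ^ α)

lemma half_rpow_mem (hα : α ∈ Ioo (0 : ℝ) 1) : (1 / 2 : ℝ) ^ α ∈ Ioo (1 / 2 : ℝ) 1 := by
  refine ⟨?_, Real.rpow_lt_one (by norm_num) (by norm_num) hα.1⟩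
  conv_lhs => rw [← Real.rpow_one (1 / 2)]
  exact Real.rpow_lt_rpow_of_exponent_gt (by norm_num) (by norm_num) hα.2

lemma dyadicC_nonneg (hα : α ∈ Ioo (0 : ℝ) 1) : 0 ≤ dyadicC α := by
  obtain ⟨h1, h2⟩ := half_rpow_mem hα
  have := sub_pos.2 h2
  have : 0 < 2 * (1 / 2 : ℝ) ^ α - 1 := by linarith
  unfold dyadicC
  positivity

lemma abs_tsum_le_geometric {w : ℕ → ℝ} {M q : ℝ} (hq0 : 0 ≤ q) (hq1 : q < 1)
    (hw : ∀ j, |w j| ≤ M * q ^ j) : Summable w ∧ |∑' j, w j| ≤ M / (1 - q) := by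
  have hg := (hasSum_geometric_of_lt_one hq0 hq1).mul_left M
  refine ⟨Summable.of_norm_bounded hg.summable hw, ?_⟩
  rw [div_eq_mul_inv]
  exact tsum_of_norm_bounded (f := w) hg hw

/-- Dyadic sums whose terms have size `q ^ j` and Lipschitz constants `(2 q) ^ j` are Hölder. -/
lemma HB.tsum_dyadic (hα : α ∈ Ioo (0 : ℝ) 1) {v : ℕ → Pt n → ℝ} {M : ℝ} (hM : 0 ≤ M)
    (hv : ∀ j x, |v j x| ≤ M * ((1 / 2) ^ α) ^ j)
    (hl : ∀ j x y, |v j x - v j y| ≤ M * (2 * (1 / 2) ^ α) ^ j * ‖x - y‖) :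
    HB α univ 0 (fun x => ∑' j, v j x) (dyadicC α * M) := by
  obtain ⟨h1, h2⟩ := half_rpow_mem hα
  set q : ℝ := (1 / 2) ^ α with hq
  have hα0 := hα.1
  have hq0 : 0 < q := by linarith
  have h1' : 0 < 2 * q - 1 := by linarith
  have h2' := sub_pos.2 h2
  have hK : dyadicC α * M = 2 * M / (2 * q - 1) + 2 * M / (1 - q) := by
    rw [dyadicC, ← hq]; ring
  have hsum := fun x => abs_tsum_le_geometric hq0.le h2 fun j => hv j x
  have hA : 0 ≤ 2 * M / (2 * q - 1) := by positivity
  refine ⟨fun x _ => (hsum x).2.trans ?_, fun x _ y _ => ?_⟩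
  · rw [hK]
    have : M / (1 - q) ≤ 2 * M / (1 - q) := by gcongr; linarith
    linarith
  rw [← ((hsum x).1.tsum_sub (hsum y).1)]
  set w := fun j => v j x - v j y
  have hw1 : ∀ j, |w j| ≤ 2 * M * q ^ j := fun j => by
    refine (abs_sub _ _).trans ?_
    linarith [hv j x, hv j y]
  rcases (norm_nonneg (x - y)).eq_or_lt' with h0 | h0
  · have : x = y := sub_eq_zero.1 (norm_eq_zero.1 h0)
    subst this
    simp [w, Real.zero_rpow hα0.ne']
  rcases lt_or_ge 1 ‖x - y‖ with hd | hd
  · refine (abs_tsum_le_geometric hq0.le h2 hw1).2.trans ?_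
    have h3 : 1 ≤ ‖x - y‖ ^ α := Real.one_le_rpow hd.le hα0.le
    rw [hK]
    have : 0 ≤ 2 * M / (1 - q) := by positivity
    nlinarith
  obtain ⟨J, hJ1, hJ2⟩ := exists_nat_pow_near_of_lt_one h0 hd (show (0 : ℝ) < 1 / 2 by norm_num)
    (by norm_num)
  have hqJ : q ^ (J + 1) ≤ ‖x - y‖ ^ α := by
    rw [hq, Real.rpow_pow_comm (by norm_num)]
    gcongr
  have hs := (abs_tsum_le_geometric hq0.le h2 hw1).1
  rw [← hs.sum_add_tsum_nat_add (J + 1), hK, add_mul]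
  refine (abs_add_le _ _).trans (add_le_add ?_ ?_)
  · calc |∑ j ∈ Finset.range (J + 1), w j| ≤ ∑ j ∈ Finset.range (J + 1), |w j| :=
          Finset.abs_sum_le_sum_abs _ _
      _ ≤ ∑ j ∈ Finset.range (J + 1), M * ‖x - y‖ * (2 * q) ^ j :=
          Finset.sum_le_sum fun j _ => (hl j x y).trans (le_of_eq (by ring))
      _ = M * ‖x - y‖ * (((2 * q) ^ (J + 1) - 1) / (2 * q - 1)) := by
          rw [← Finset.mul_sum, geom_sum_eq (by linarith)]
      _ ≤ M * (1 / 2) ^ J * ((2 * q) ^ (J + 1) / (2 * q - 1)) := by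
          have : (1 : ℝ) ≤ (2 * q) ^ (J + 1) := one_le_pow₀ (by linarith)
          gcongr
          linarith
      _ = 2 * M / (2 * q - 1) * q ^ (J + 1) := by
          rw [mul_pow, pow_succ 2 J, one_div, inv_pow]
          field_simp
      _ ≤ _ := by gcongr
  · have h3 := (abs_tsum_le_geometric (w := fun j => w (j + (J + 1))) (M := 2 * M * q ^ (J + 1)) hq0.le h2
      fun j => (hw1 _).trans (le_of_eq (by rw [pow_add]; ring))).2
    refine h3.trans ?_
    calc 2 * M * q ^ (J + 1) / (1 - q) ≤ 2 * M * ‖x - y‖ ^ α / (1 - q) := by gcongr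
      _ = _ := by ring

lemma hasFDerivAt_tsum_gradForm {T : Set (Pt n)} {f : ℕ → Pt n → ℝ} {f' : Fin n → ℕ → Pt n → ℝ} {u : ℕ → ℝ}
    (hu : Summable u) (hT : IsOpen T) (hT' : IsPreconnected T)
    (hf : ∀ j, ∀ x ∈ T, HasFDerivAt (f j) (gradForm fun i => f' i j x) x)
    (hb : ∀ i j, ∀ x ∈ T, |f' i j x| ≤ u j) (h0 : ∀ x, Summable fun j => f j x) {x : Pt n} (hx : x ∈ T) :
    HasFDerivAt (fun x => ∑' j, f j x) (gradForm fun i => ∑' j, f' i j x) x := by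
  rcases Nat.eq_zero_or_pos n with rfl | hn
  · exact (hasFDerivAt_of_subsingleton _ x).congr_fderiv (Subsingleton.elim _ _)
  have hu0 : ∀ j, 0 ≤ u j := fun j => (abs_nonneg _).trans (hb ⟨0, hn⟩ j x hx)
  have hb' : ∀ j, ∀ x ∈ T, ‖gradForm fun i => f' i j x‖ ≤ n * u j := fun j x hx =>
    norm_gradForm_le _ (hu0 j) fun i => hb i j x hx
  have h := hasFDerivAt_tsum_of_isPreconnected (hu.mul_left (n : ℝ)) hT hT' hf hb' hx (h0 x) hx
  have hs : Summable fun j => gradForm fun i => f' i j x :=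
    Summable.of_norm_bounded (hu.mul_left (n : ℝ)) fun j => hb' j x hx
  refine h.congr_fderiv ?_
  rw [eq_gradForm (∑' j, gradForm fun i => f' i j x)]
  congr 1
  ext i
  have := (ContinuousLinearMap.apply ℝ ℝ (Pi.single i 1 : Pt n)).map_tsum hs
  simp only [ContinuousLinearMap.apply_apply, gradForm_single] at this
  exact this

/-- Dyadic scales. -/
def sc (N : ℝ) (j : ℕ) : ℝ := N * (1 / 2) ^ j

/-- Dyadic superposition of averages. -/
def pot (N : ℝ) (ρ : Pt n → ℝ) (p : ℕ) (h : Pt n → ℝ) (x : Pt n) : ℝ :=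
  ∑' j, sc N j ^ p * avg ρ (sc N j) h x

section pot

variable {N M r : ℝ} {ρ h : Pt n → ℝ} {i k : Fin n} {p : ℕ}

/-- Hölder continuity in the `i`-th variable. -/
def HolderDir (α M : ℝ) (i : Fin n) (h : Pt n → ℝ) : Prop :=
  ∀ y t, |h y - h (Function.update y i t)| ≤ M * |y i - t| ^ α

lemma sc_pos (hN : 0 < N) (j : ℕ) : 0 < sc N j := by unfold sc; positivity

lemma sc_rpow (hN : 0 < N) (j : ℕ) : sc N j ^ α = N ^ α * ((1 / 2) ^ α) ^ j := by
  rw [sc, Real.mul_rpow hN.le (by positivity), ← Real.rpow_pow_comm (by norm_num)]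

lemma sc_inv (N : ℝ) (j : ℕ) : (sc N j)⁻¹ = N⁻¹ * 2 ^ j := by
  rw [sc, mul_inv, ← inv_pow]; norm_num

lemma summable_sc_pow (hp : p ≠ 0) : Summable fun j => sc N j ^ p := by
  simp only [sc, mul_pow]
  refine Summable.mul_left _ ?_
  simp only [← pow_mul, mul_comm _ p]
  simp only [pow_mul]
  exact summable_geometric_of_lt_one (by positivity) (pow_lt_one₀ (by norm_num) (by norm_num) hp)

lemma abs_avg_le' (hρ : Ker r ρ) (hh : BddMeas M h) (s : ℝ) (x : Pt n) :
    |avg ρ s h x| ≤ (∫ y, |ρ y|) * M := abs_avg_le hρ fun _ _ => hh.2 _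

lemma abs_pot_term_le (hN : 0 < N) (hρ : Ker r ρ) (hh : BddMeas M h) (p j : ℕ) (x : Pt n) :
    |sc N j ^ p * avg ρ (sc N j) h x| ≤ sc N j ^ p * ((∫ y, |ρ y|) * M) := by
  have := sc_pos hN j
  rw [abs_mul, abs_of_nonneg (by positivity)]
  gcongr
  exact abs_avg_le' hρ hh _ x

lemma summable_pot (hN : 0 < N) (hρ : Ker r ρ) (hh : BddMeas M h) (hp : p ≠ 0) (x : Pt n) :
    Summable fun j => sc N j ^ p * avg ρ (sc N j) h x :=
  Summable.of_norm_bounded ((summable_sc_pow hp).mul_right ((∫ y, |ρ y|) * M))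
    fun j => abs_pot_term_le hN hρ hh p j x

lemma abs_pot_le (hN : 0 < N) (hρ : Ker r ρ) (hh : BddMeas M h) (hp : p ≠ 0) (x : Pt n) :
    |pot N ρ p h x| ≤ (∑' j, sc N j ^ p) * (∫ y, |ρ y|) * M := by
  have := (summable_sc_pow (N := N) hp).hasSum.mul_right ((∫ y, |ρ y|) * M)
  rw [mul_assoc]
  exact tsum_of_norm_bounded (f := fun j => sc N j ^ p * avg ρ (sc N j) h x) this fun j => abs_pot_term_le hN hρ hh p j x

lemma hasFDerivAt_pot_term (hN : 0 < N) (hρ : Ker r ρ) (hh : BddMeas M h) (p j : ℕ) (x : Pt n) :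
    HasFDerivAt (fun x => sc N j ^ (p + 1) * avg ρ (sc N j) h x)
      (gradForm fun i => sc N j ^ p * avg (pd i ρ) (sc N j) h x) x := by
  have hs := sc_pos hN j
  refine ((hasFDerivAt_avg hρ hs.ne' hh x).const_mul (sc N j ^ (p + 1))).congr_fderiv ?_
  rw [eq_gradForm (_ • _)]
  congr 1
  ext i
  rw [_root_.smul_apply, gradForm_single, smul_eq_mul, pow_succ]
  field_simp

lemma hasFDerivAt_pot (hN : 0 < N) (hρ : Ker r ρ) (hh : BddMeas M h) (hp : p ≠ 0) (x : Pt n) :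
    HasFDerivAt (pot N ρ (p + 1) h) (gradForm fun i => pot N (pd i ρ) p h x) x := by
  have hM := hh.nonneg
  have hq : ∀ i, 0 ≤ ∫ y, |pd i ρ y| := fun i => MeasureTheory.integral_nonneg fun _ => abs_nonneg _
  refine hasFDerivAt_tsum_gradForm ((summable_sc_pow (N := N) hp).mul_right ((∑ i, ∫ y, |pd i ρ y|) * M)) isOpen_univ
    isPreconnected_univ (fun j x _ => hasFDerivAt_pot_term hN hρ hh p j x) (fun i j x _ => ?_)
    (fun x => summable_pot hN hρ hh (by simp) x) (mem_univ x)
  refine (abs_pot_term_le hN (hρ.pd i) hh p j x).trans ?_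
  have := sc_pos hN j
  gcongr
  exact Finset.single_le_sum (fun i _ => hq i) (Finset.mem_univ i)

lemma abs_avg_pd_le (hα : α ∈ Ioo (0 : ℝ) 1) (hr : 0 < r) (hN : 0 < N) (hρ : Ker r ρ) (hh : BddMeas M h)
    (hd : HolderDir α M i h) (j : ℕ) (x : Pt n) :
    |avg (pd i ρ) (sc N j) h x| ≤ (∫ y, |pd i ρ y|) * (N * r) ^ α * M * ((1 / 2) ^ α) ^ j := by
  refine (avg_pd_le hα hρ (sc_pos hN j) hh hh.nonneg hd x).trans (le_of_eq ?_)
  rw [Real.mul_rpow (sc_pos hN j).le hr.le, sc_rpow hN, Real.mul_rpow hN.le hr.le]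
  ring

lemma exists_HB_pot_zero (hα : α ∈ Ioo (0 : ℝ) 1) (hr : 0 < r) (hN : 0 < N) (hρ : Ker r ρ) (i : Fin n) :
    ∃ K, 0 ≤ K ∧ ∀ M h, BddMeas M h → HolderDir α M i h →
      HB α univ 0 (pot N (pd i ρ) 0 h) (K * M) := by
  have hq : ∀ k, 0 ≤ ∫ y, |pd i (pd k ρ) y| :=
    fun i => MeasureTheory.integral_nonneg fun _ => abs_nonneg _
  have hqi : 0 ≤ ∫ y, |pd i ρ y| := MeasureTheory.integral_nonneg fun _ => abs_nonneg _
  obtain ⟨h1, h2⟩ := half_rpow_mem hα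
  set q : ℝ := (1 / 2) ^ α
  set Q := ∑ k, ∫ y, |pd i (pd k ρ) y|
  have hQ : 0 ≤ Q := Finset.sum_nonneg fun k _ => hq k
  set K0 := ((∫ y, |pd i ρ y|) + n * (N⁻¹ * Q)) * (N * r) ^ α
  refine ⟨dyadicC α * K0, mul_nonneg (dyadicC_nonneg hα) (by positivity), fun M h hh hd => ?_⟩
  have hM := hh.nonneg
  rw [mul_assoc]
  refine HB.tsum_dyadic hα (by positivity) (fun j x => ?_) (fun j x y => ?_)
  · rw [pow_zero, one_mul]
    refine (abs_avg_pd_le hα hr hN hρ hh hd j x).trans ?_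
    simp only [K0]
    gcongr
    have : 0 ≤ n * (N⁻¹ * Q) := by positivity
    linarith
  · simp only [pow_zero, one_mul]
    have hg : ∀ x ∈ (univ : Set (Pt n)), HasFDerivWithinAt (avg (pd i ρ) (sc N j) h)
        (gradForm fun k => (sc N j)⁻¹ * avg (pd k (pd i ρ)) (sc N j) h x) univ x := fun x _ =>
      (hasFDerivAt_avg (hρ.pd i) (sc_pos hN j).ne' hh x).hasFDerivWithinAt
    refine (HB.lipschitz_of_pd (C := N⁻¹ * Q * (N * r) ^ α * M * (2 * q) ^ j) isDom_univ (by positivity)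
      (fun x hx => (hg x hx).differentiableWithinAt) (fun k x hx => ?_) (mem_univ x) (mem_univ y)).trans ?_
    · rw [pdW_of_hasFDeriv isDom_univ hx (hg x hx) k, hρ.pd_comm k i, sc_inv, abs_mul,
        abs_of_pos (by positivity)]
      calc N⁻¹ * 2 ^ j * |avg (pd i (pd k ρ)) (sc N j) h x|
          ≤ N⁻¹ * 2 ^ j * ((∫ y, |pd i (pd k ρ) y|) * (N * r) ^ α * M * q ^ j) := by
            gcongr; exact abs_avg_pd_le hα hr hN (hρ.pd k) hh hd j x
        _ ≤ N⁻¹ * 2 ^ j * (Q * (N * r) ^ α * M * q ^ j) := by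
            gcongr; exact Finset.single_le_sum (fun i _ => hq i) (Finset.mem_univ k)
        _ = _ := by rw [mul_pow]; ring
    · gcongr ?_ * _
      calc n * (N⁻¹ * Q * (N * r) ^ α * M * (2 * q) ^ j) = (n * (N⁻¹ * Q)) * (N * r) ^ α * M * (2 * q) ^ j := by ring
        _ ≤ _ := by
          simp only [K0]
          gcongr
          linarith

end pot

/-- The kernels of `exists_kernel`. -/
structure PotKernel {n : ℕ} (A : Matrix (Fin n) (Fin n) ℝ) (l : Fin n) (r : ℝ) (Ψ φ : Pt n → ℝ) :
    Prop where
  hA : 0 < A l l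
  hr : 0 < r
  ker : Ker r Ψ
  src : Ker r φ
  refl : ∀ y, Ψ (conormalRefl A l y) = Ψ y
  pde : ∀ y, ∑ i, ∑ j, A i j * pd i (pd j Ψ) y = 2 ^ n * φ ((2 : ℝ) • y) - φ y

section potential

variable {A : Matrix (Fin n) (Fin n) ℝ} {l i k : Fin n} {h : Pt n → ℝ} {M r s N : ℝ} {Ψ φ : Pt n → ℝ}

open MeasureTheory in
lemma PotKernel.sum_avg (H : PotKernel A l r Ψ φ) (hh : BddMeas M h) (s : ℝ) (x : Pt n) :
    ∑ i, ∑ j, A i j * avg (pd i (pd j Ψ)) s h x = avg φ (s / 2) h x - avg φ s h x := by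
  have h1 : ∑ i, ∑ j, A i j * avg (pd i (pd j Ψ)) s h x =
      ∫ y, ∑ i, ∑ j, A i j * (pd i (pd j Ψ) y * h (x - s • y)) := by
    have hi : ∀ i j, Integrable fun y => A i j * (pd i (pd j Ψ) y * h (x - s • y)) := fun i j =>
      (((H.ker.pd j).pd i).integrable_mul hh s x).const_mul _
    rw [integral_finsetSum _ fun i _ => integrable_finsetSum _ fun j _ => hi i j]
    refine Finset.sum_congr rfl fun i _ => ?_
    rw [integral_finsetSum _ fun j _ => hi i j]
    exact Finset.sum_congr rfl fun j _ => by rw [avg, integral_const_mul]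
  have h2 : avg φ (s / 2) h x = ∫ y, 2 ^ n * φ ((2 : ℝ) • y) * h (x - s • y) := by
    have := Measure.integral_comp_smul volume (fun y => φ y * h (x - (s / 2) • y)) 2
    simp only [smul_smul, div_mul_cancel₀ s (two_ne_zero' ℝ)] at this
    simp only [mul_assoc]
    rw [integral_const_mul, this, avg]
    simp
  have hi2 : Integrable fun y => 2 ^ n * φ ((2 : ℝ) • y) * h (x - s • y) := by
    have := ((H.src.integrable_mul hh (s / 2) x).comp_smul (two_ne_zero' ℝ)).const_mul (2 ^ n)
    simp only [smul_smul, div_mul_cancel₀ s (two_ne_zero' ℝ)] at this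
    simpa only [mul_assoc] using this
  rw [h1, h2, avg, ← integral_sub hi2 (H.src.integrable_mul hh s x)]
  congr 1
  ext y
  rw [← sub_mul, ← H.pde y, Finset.sum_mul]
  refine Finset.sum_congr rfl fun i _ => ?_
  rw [Finset.sum_mul]
  exact Finset.sum_congr rfl fun j _ => by ring

lemma tendsto_avg_sc (hα : α ∈ Ioo (0 : ℝ) 1) (hN : 0 < N) (hφ : Ker r φ) (hh : HB α univ 0 h M)
    {x : Pt n} (hx : 0 < x l) :
    Filter.Tendsto (fun j => avg φ (sc N j) (oddExt A l h) x) Filter.atTop (nhds ((∫ y, φ y) * h x)) := by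
  have hb := hh.bddMeas hα
  have hs : Filter.Tendsto (fun j => sc N j * r) Filter.atTop (nhds 0) := by
    have := ((tendsto_pow_atTop_nhds_zero_of_lt_one (r := (1 / 2 : ℝ)) (by norm_num)
      (by norm_num)).const_mul N).mul_const r
    simpa [sc] using this
  rw [tendsto_iff_norm_sub_tendsto_zero]
  have h0 : Filter.Tendsto (fun j => (∫ y, |φ y|) * (M * (sc N j * r) ^ α)) Filter.atTop (nhds 0) := by
    have := ((hs.rpow_const (p := α) (Or.inr hα.1.le)).const_mul M).const_mul (∫ y, |φ y|)
    simpa [Real.zero_rpow hα.1.ne'] using this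
  refine squeeze_zero' (Filter.Eventually.of_forall fun j => norm_nonneg _) ?_ h0
  filter_upwards [hs.eventually_lt_const hx] with j hj
  rw [avg_oddExt_of_pos hφ (sc_pos hN j) hj]
  exact abs_avg_sub_le hα hφ (sc_pos hN j) hb (fun x y => hh.2 x (mem_univ x) y (mem_univ y)) x

lemma HB.holderDir_oddExt (hα : α ∈ Ioo (0 : ℝ) 1) (hh : HB α univ 0 h M) (hil : i ≠ l) :
    HolderDir α M i (oddExt A l h) :=
  oddExt_holder hil hα (hh.nonneg isDom_univ) fun x y => hh.2 x (mem_univ x) y (mem_univ y)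

lemma HB.holderDir (hα : α ∈ Ioo (0 : ℝ) 1) (hh : HB α univ 0 h M) (i : Fin n) : HolderDir α M i h := by
  intro y t
  refine (hh.2 y (mem_univ y) _ (mem_univ _)).trans ?_
  have := hh.nonneg isDom_univ
  have := hα.1
  gcongr
  refine (pi_norm_le_iff_of_nonneg (abs_nonneg _)).2 fun j => ?_
  by_cases hj : j = i
  · subst hj; simp
  · simp [hj]

/-- The interior bound for the second normal derivative. -/
lemma abs_avg_pd_oddExt_le (hα : α ∈ Ioo (0 : ℝ) 1) (hr : 0 < r) (hN : 0 < N) (hΨ : Ker r Ψ)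
    (hh : HB α univ 0 h M) {δ : ℝ} (hδ : 0 < δ) {x : Pt n} (hx : δ < x l) (i : Fin n) (j : ℕ) :
    |avg (pd i Ψ) (sc N j) (oddExt A l h) x| ≤
      (∫ y, |pd i Ψ y|) * (N * r) ^ α * M * (1 + (δ ^ α)⁻¹) * ((1 / 2) ^ α) ^ j := by
  have hM := hh.nonneg isDom_univ
  have hq : 0 ≤ ∫ y, |pd i Ψ y| := MeasureTheory.integral_nonneg fun _ => abs_nonneg _
  have hs := sc_pos hN j
  have hb := hh.bddMeas hα
  have e : (N * r) ^ α * ((1 / 2) ^ α) ^ j = (sc N j * r) ^ α := by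
    rw [Real.mul_rpow hs.le hr.le, sc_rpow hN, Real.mul_rpow hN.le hr.le]; ring
  have hd : 0 < δ ^ α := by positivity
  have := hα.1
  rcases le_or_gt (sc N j * r) δ with hj | hj
  · rw [avg_oddExt_of_pos (hΨ.pd i) hs (hj.trans_lt hx)]
    refine (abs_avg_pd_le hα hr hN hΨ hb (hh.holderDir hα i) j x).trans ?_
    gcongr ?_ * _
    refine le_mul_of_one_le_right (by positivity) ?_
    linarith [inv_pos.2 hd]
  · refine (abs_avg_le' (hΨ.pd i) (bddMeas_oddExt hb) _ x).trans ?_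
    have h1 : 1 ≤ (1 + (δ ^ α)⁻¹) * (sc N j * r) ^ α := by
      have h2 : δ ^ α ≤ (sc N j * r) ^ α := by gcongr
      calc (1 : ℝ) = (δ ^ α)⁻¹ * δ ^ α := (inv_mul_cancel₀ hd.ne').symm
        _ ≤ (1 + (δ ^ α)⁻¹) * (sc N j * r) ^ α := by gcongr; linarith
    calc (∫ y, |pd i Ψ y|) * M ≤ (∫ y, |pd i Ψ y|) * M * ((1 + (δ ^ α)⁻¹) * (sc N j * r) ^ α) :=
          le_mul_of_one_le_right (by positivity) h1
      _ = _ := by rw [← e]; ring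

/-- The second derivatives of the potential; the pure normal one is read off from the equation. -/
def potDD (A : Matrix (Fin n) (Fin n) ℝ) (l : Fin n) (Ψ φ : Pt n → ℝ) (N : ℝ) (h : Pt n → ℝ)
    (i k : Fin n) (x : Pt n) : ℝ :=
  if i = l ∧ k = l then
    (A l l)⁻¹ * ((∫ y, φ y) * h x - avg φ N (oddExt A l h) x -
      ∑ p, ∑ q, if p = l ∧ q = l then 0 else A p q * pot N (pd p (pd q Ψ)) 0 (oddExt A l h) x)
  else pot N (pd i (pd k Ψ)) 0 (oddExt A l h) x

lemma sum_sum_ite_add (F : Fin n → Fin n → ℝ) :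
    ∑ p, ∑ q, F p q = F l l + ∑ p, ∑ q, if p = l ∧ q = l then 0 else F p q := by
  have h1 : ∀ p q, F p q = (if p = l then if q = l then F p q else 0 else 0) +
      if p = l ∧ q = l then 0 else F p q := fun p q => by
    by_cases hp : p = l <;> by_cases hq : q = l <;> simp [hp, hq]
  rw [Finset.sum_congr rfl fun p _ => Finset.sum_congr rfl fun q _ => h1 p q]
  simp only [Finset.sum_add_distrib]
  congr 1
  rw [Finset.sum_eq_single l, Finset.sum_eq_single l] <;> simp +contextual

lemma PotKernel.sum_potDD (H : PotKernel A l r Ψ φ) (x : Pt n) :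
    ∑ i, ∑ k, A i k * potDD A l Ψ φ N h i k x = (∫ y, φ y) * h x - avg φ N (oddExt A l h) x := by
  rw [sum_sum_ite_add (l := l)]
  have h1 : ∀ p q, (if p = l ∧ q = l then 0 else A p q * potDD A l Ψ φ N h p q x) =
      if p = l ∧ q = l then 0 else A p q * pot N (pd p (pd q Ψ)) 0 (oddExt A l h) x := fun p q => by
    split_ifs with hpq
    · rfl
    · rw [potDD, if_neg hpq]
  simp only [h1]
  rw [potDD, if_pos ⟨rfl, rfl⟩, mul_inv_cancel_left₀ H.hA.ne']
  ring

lemma summable_potDD (hα : α ∈ Ioo (0 : ℝ) 1) (hr : 0 < r) (hN : 0 < N) (hΨ : Ker r Ψ)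
    (hh : HB α univ 0 h M) {x : Pt n} (hx : 0 < x l) (i k : Fin n) :
    Summable fun j => avg (pd i (pd k Ψ)) (sc N j) (oddExt A l h) x := by
  obtain ⟨h1, h2⟩ := half_rpow_mem hα
  exact (abs_tsum_le_geometric (by linarith) h2 fun j =>
    abs_avg_pd_oddExt_le hα hr hN (hΨ.pd k) hh (half_pos hx) (half_lt_self hx) i j).1

lemma PotKernel.potDD_eq_tsum (H : PotKernel A l r Ψ φ) (hα : α ∈ Ioo (0 : ℝ) 1) (hN : 0 < N)
    (hh : HB α univ 0 h M) {x : Pt n} (hx : 0 < x l) (i k : Fin n) :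
    potDD A l Ψ φ N h i k x = ∑' j, avg (pd i (pd k Ψ)) (sc N j) (oddExt A l h) x := by
  set a : Fin n → Fin n → ℝ := fun i k => ∑' j, avg (pd i (pd k Ψ)) (sc N j) (oddExt A l h) x
  have hpot : ∀ i k, pot N (pd i (pd k Ψ)) 0 (oddExt A l h) x = a i k := fun i k => by
    simp [pot, a]
  have hs := fun i k => (summable_potDD hα H.hr hN H.ker hh hx i k (A := A)).hasSum
  have hsum : HasSum (fun j => avg φ (sc N j / 2) (oddExt A l h) x - avg φ (sc N j) (oddExt A l h) x)
      (∑ i, ∑ k, A i k * a i k) := by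
    simp only [← H.sum_avg (bddMeas_oddExt (hh.bddMeas hα))]
    exact hasSum_sum fun i _ => hasSum_sum fun k _ => (hs i k).mul_left _
  have hlim := hsum.tendsto_sum_nat
  have hsc : ∀ j, sc N j / 2 = sc N (j + 1) := fun j => by rw [sc, sc, pow_succ]; ring
  simp only [hsc, Finset.sum_range_sub fun j => avg φ (sc N j) (oddExt A l h) x] at hlim
  have h2 := (tendsto_avg_sc hα hN H.src hh hx (A := A)).sub_const
    (avg φ (sc N 0) (oddExt A l h) x)
  have h3 := tendsto_nhds_unique hlim h2
  rw [sum_sum_ite_add (l := l), show sc N 0 = N by simp [sc]] at h3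
  rw [potDD]
  simp only [hpot]
  split_ifs with hik
  · rw [hik.1, hik.2, ← h3, add_sub_cancel_right, inv_mul_cancel_left₀ H.hA.ne']
  · rfl

lemma convex_posHS (l : Fin n) (δ : ℝ) : Convex ℝ {x : Pt n | δ < x l} :=
  convex_halfSpace_gt ⟨fun _ _ => rfl, fun _ _ => rfl⟩ δ

lemma isOpen_posHS (l : Fin n) (δ : ℝ) : IsOpen {x : Pt n | δ < x l} :=
  isOpen_lt continuous_const (continuous_apply l)

lemma closure_posHS (l : Fin n) : closure {x : Pt n | 0 < x l} = upperHS l := by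
  refine Subset.antisymm (closure_lt_subset_le continuous_const (continuous_apply l)) fun x hx => ?_
  have hx : 0 ≤ x l := hx
  refine mem_closure_of_tendsto (f := fun t : ℝ => x + t • (Pi.single l 1 : Pt n)) (b := nhdsWithin 0 (Ioi 0)) ?_ ?_
  · have : Continuous fun t : ℝ => x + t • (Pi.single l 1 : Pt n) := by fun_prop
    simpa using (this.tendsto 0).mono_left nhdsWithin_le_nhds
  · filter_upwards [self_mem_nhdsWithin] with t ht
    have ht : 0 < t := ht
    simp; linarith

lemma PotKernel.hasFDerivAt_normal (H : PotKernel A l r Ψ φ) (hα : α ∈ Ioo (0 : ℝ) 1) (hN : 0 < N)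
    (hh : HB α univ 0 h M) {x : Pt n} (hx : 0 < x l) (k : Fin n) :
    HasFDerivAt (pot N (pd k Ψ) 1 (oddExt A l h)) (gradForm fun i => potDD A l Ψ φ N h i k x) x := by
  simp only [H.potDD_eq_tsum hα hN hh hx]
  have hM := hh.nonneg isDom_univ
  have hb := bddMeas_oddExt (A := A) (l := l) (hh.bddMeas hα)
  have hr := H.hr
  obtain ⟨h1, h2⟩ := half_rpow_mem hα
  have hq : ∀ i, 0 ≤ ∫ y, |pd i (pd k Ψ) y| :=
    fun i => MeasureTheory.integral_nonneg fun _ => abs_nonneg _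
  refine hasFDerivAt_tsum_gradForm (T := {y | x l / 2 < y l})
    (u := fun j => (∑ i, ∫ y, |pd i (pd k Ψ) y|) * (N * r) ^ α * M * (1 + ((x l / 2) ^ α)⁻¹) * ((1 / 2) ^ α) ^ j)
    ((summable_geometric_of_lt_one (by linarith) h2).mul_left _) (isOpen_posHS l _)
    (convex_posHS l _).isPreconnected (fun j y _ => ?_) (fun i j y hy => ?_)
    (fun x => summable_pot hN (H.ker.pd k) hb one_ne_zero x) (half_lt_self hx)
  · have := hasFDerivAt_pot_term hN (H.ker.pd k) hb 0 j y
    simpa only [pow_zero, one_mul, zero_add] using this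
  · refine (abs_avg_pd_oddExt_le hα hr hN (H.ker.pd k) hh (half_pos hx) hy i j).trans ?_
    gcongr
    exact Finset.single_le_sum (fun i _ => hq i) (Finset.mem_univ i)

lemma exists_HB_potDD (H : PotKernel A l r Ψ φ) (hα : α ∈ Ioo (0 : ℝ) 1) (hN : 1 ≤ N) (R : ℝ) :
    ∃ K, 0 ≤ K ∧ ∀ M h, HB α univ 0 h M → (∀ x, R < ‖x‖ → h x = 0) → ∀ i k,
      HB α univ 0 (potDD A l Ψ φ N h i k) (K * M) := by
  have hN0 : 0 < N := by linarith
  set R' := max R (‖conormalRefl A l‖ * R)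
  obtain ⟨κ, hκ, Hκ⟩ := exists_HB_avg hα l.pos H.src R' 0
  choose K0 hK0 HK0 using fun i k => exists_HB_pot_zero hα H.hr hN0 (H.ker.pd k) i
  have hP : ∀ p q, ¬(p = l ∧ q = l) → ∀ M h, HB α univ 0 h M →
      HB α univ 0 (pot N (pd p (pd q Ψ)) 0 (oddExt A l h)) ((K0 p q + K0 q p) * M) := by
    intro p q hpq M h hh
    have hM := hh.nonneg isDom_univ
    have hb := bddMeas_oddExt (A := A) (l := l) (hh.bddMeas hα)
    by_cases hp : p = l
    · have hq : q ≠ l := fun hq => hpq ⟨hp, hq⟩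
      rw [H.ker.pd_comm]
      refine (HK0 q p M _ hb (hh.holderDir_oddExt hα hq)).mono ?_
      gcongr; linarith [hK0 p q]
    · refine (HK0 p q M _ hb (hh.holderDir_oddExt hα hp)).mono ?_
      gcongr; linarith [hK0 q p]
  set KP := ∑ p, ∑ q, (K0 p q + K0 q p)
  have hKP0 : ∀ p q, 0 ≤ K0 p q + K0 q p := fun p q => add_nonneg (hK0 p q) (hK0 q p)
  have hKP : ∀ p q, K0 p q + K0 q p ≤ KP := fun p q =>
    (Finset.single_le_sum (f := fun q => K0 p q + K0 q p) (fun q _ => hKP0 p q) (Finset.mem_univ q)).trans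
      (Finset.single_le_sum (f := fun p => ∑ q, (K0 p q + K0 q p))
        (fun p _ => Finset.sum_nonneg fun q _ => hKP0 p q) (Finset.mem_univ p))
  have hKPn : 0 ≤ KP := Finset.sum_nonneg fun p _ => Finset.sum_nonneg fun q _ => hKP0 p q
  set Kn := |(A l l)⁻¹| * (|∫ y, φ y| + κ + ∑ p, ∑ q, |A p q| * (K0 p q + K0 q p))
  have hKn : 0 ≤ Kn := mul_nonneg (abs_nonneg _) (add_nonneg (by positivity)
    (Finset.sum_nonneg fun p _ => Finset.sum_nonneg fun q _ => mul_nonneg (abs_nonneg _) (hKP0 p q)))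
  refine ⟨KP + Kn, by positivity, fun M h hh h0 i k => ?_⟩
  have hM := hh.nonneg isDom_univ
  have hb := bddMeas_oddExt (A := A) (l := l) (hh.bddMeas hα)
  by_cases hik : i = l ∧ k = l
  · have e : potDD A l Ψ φ N h i k = fun x => (A l l)⁻¹ * ((∫ y, φ y) * h x - avg φ N (oddExt A l h) x -
        ∑ p, ∑ q, if p = l ∧ q = l then 0 else A p q * pot N (pd p (pd q Ψ)) 0 (oddExt A l h) x) := by
      ext x; rw [potDD, if_pos hik]
    rw [e]
    have h1 := (Hκ N M _ hN hb fun x hx => oddExt_eq_zero H.hA.ne' h0 ((le_max_left _ _).trans_lt hx)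
      ((le_max_right _ _).trans_lt hx)).mono (C' := κ * M) (div_le_self (by positivity) hN)
    have h2 : HB α univ 0 (fun x => ∑ p, ∑ q, if p = l ∧ q = l then 0 else
        A p q * pot N (pd p (pd q Ψ)) 0 (oddExt A l h) x)
        (∑ p, ∑ q, |A p q| * ((K0 p q + K0 q p) * M)) := by
      refine HB.sum isDom_univ _ fun p _ => HB.sum isDom_univ _ fun q _ => ?_
      by_cases hpq : p = l ∧ q = l
      · simp only [if_pos hpq]
        exact HB.zero.mono (mul_nonneg (abs_nonneg _) (mul_nonneg (hKP0 p q) hM))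
      · simp only [if_neg hpq]
        exact (hP p q hpq M h hh).smul isDom_univ _
    refine ((((hh.smul isDom_univ (∫ y, φ y)).sub isDom_univ h1).sub isDom_univ h2).smul isDom_univ
      (A l l)⁻¹).mono ?_
    have : |(A l l)⁻¹| * (|∫ y, φ y| * M + κ * M + ∑ p, ∑ q, |A p q| * ((K0 p q + K0 q p) * M)) = Kn * M := by
      simp only [Kn, ← mul_assoc, ← Finset.sum_mul]; ring
    rw [this]
    gcongr; linarith
  · have e : potDD A l Ψ φ N h i k = pot N (pd i (pd k Ψ)) 0 (oddExt A l h) := by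
      ext x; rw [potDD, if_neg hik]
    rw [e]
    exact (hP i k hik M h hh).mono (mul_le_mul_of_nonneg_right (by linarith [hKP i k]) hM)

lemma continuous_pot (hN : 0 < N) {ρ : Pt n → ℝ} (hρ : Ker r ρ) (hh : BddMeas M h) {p : ℕ} (hp : p ≠ 0) :
    Continuous (pot N ρ p h) := by
  refine continuous_tsum (fun j => ?_) ((summable_sc_pow (N := N) hp).mul_right ((∫ y, |ρ y|) * M))
    fun j x => abs_pot_term_le hN hρ hh p j x
  exact continuous_const.mul (continuous_iff_continuousAt.2 fun x =>
    (hasFDerivAt_avg hρ (sc_pos hN j).ne' hh x).continuousAt)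

lemma PotKernel.hasFDerivWithinAt_grad (H : PotKernel A l r Ψ φ) (hα : α ∈ Ioo (0 : ℝ) 1) (hN : 1 ≤ N)
    {R : ℝ} (hh : HB α univ 0 h M) (h0 : ∀ x, R < ‖x‖ → h x = 0) (k : Fin n) (x : Pt n) :
    HasFDerivWithinAt (pot N (pd k Ψ) 1 (oddExt A l h)) (gradForm fun i => potDD A l Ψ φ N h i k x)
      (upperHS l) x := by
  have hN0 : 0 < N := by linarith
  have hb := bddMeas_oddExt (A := A) (l := l) (hh.bddMeas hα)
  obtain ⟨K, -, HK⟩ := exists_HB_potDD H hα hN R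
  have hc : ∀ i, Continuous (potDD A l Ψ φ N h i k) := fun i =>
    continuousOn_univ.1 ((HK M h hh h0 i k).continuousOn hα)
  rw [← closure_posHS]
  refine hasFDerivWithinAt_closure_of_tendsto_fderiv
    (fun y hy => (H.hasFDerivAt_normal hα hN0 hh hy k).differentiableAt.differentiableWithinAt)
    (convex_posHS l 0) (isOpen_posHS l 0)
    (fun y _ => (continuous_pot hN0 (H.ker.pd k) hb one_ne_zero).continuousWithinAt) ?_
  have hcg : Continuous fun y => gradForm fun i => potDD A l Ψ φ N h i k y := by
    unfold gradForm
    exact continuous_finsetSum _ fun i _ => (hc i).smul continuous_const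
  refine ((hcg.tendsto x).mono_left nhdsWithin_le_nhds).congr' ?_
  filter_upwards [self_mem_nhdsWithin] with y hy
  exact (H.hasFDerivAt_normal hα hN0 hh hy k).fderiv.symm

end potential

section dirichlet

variable {A : Matrix (Fin n) (Fin n) ℝ} {l i k : Fin n} {h : Pt n → ℝ} {M r s N R : ℝ} {Ψ φ : Pt n → ℝ}

lemma potDD_comm (H : PotKernel A l r Ψ φ) (i k : Fin n) : potDD A l Ψ φ N h i k = potDD A l Ψ φ N h k i := by
  ext x
  by_cases hik : i = l ∧ k = l
  · rw [hik.1, hik.2]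
  · rw [potDD, potDD, if_neg hik, if_neg fun h => hik ⟨h.2, h.1⟩, H.ker.pd_comm i k]

/-- The Dirichlet potential on the half space. -/
def dirPot (A : Matrix (Fin n) (Fin n) ℝ) (l : Fin n) (Ψ : Pt n → ℝ) (N : ℝ) (h : Pt n → ℝ) : Pt n → ℝ :=
  pot N Ψ 2 (oddExt A l h)

lemma PotKernel.pdW_dirPot (H : PotKernel A l r Ψ φ) (hN : 0 < N) (hh : BddMeas M h) (i : Fin n) {x : Pt n}
    (hx : x ∈ upperHS l) :
    pdW (upperHS l) i (dirPot A l Ψ N h) x = pot N (pd i Ψ) 1 (oddExt A l h) x :=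
  pdW_of_hasFDeriv (isDom_upperHS l) hx
    (hasFDerivAt_pot hN H.ker (bddMeas_oddExt hh) one_ne_zero x).hasFDerivWithinAt i

lemma PotKernel.pdW_pdW_dirPot (H : PotKernel A l r Ψ φ) (hα : α ∈ Ioo (0 : ℝ) 1) (hN : 1 ≤ N)
    (hh : HB α univ 0 h M) (h0 : ∀ x, R < ‖x‖ → h x = 0) (i k : Fin n) {x : Pt n} (hx : x ∈ upperHS l) :
    pdW (upperHS l) i (pdW (upperHS l) k (dirPot A l Ψ N h)) x = potDD A l Ψ φ N h i k x := by
  rw [pdW_congr (fun y hy => H.pdW_dirPot (by linarith) (hh.bddMeas hα) k hy) hx]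
  exact pdW_of_hasFDeriv (isDom_upperHS l) hx (H.hasFDerivWithinAt_grad hα hN hh h0 k x) i

lemma PotKernel.dirPot_eq_zero (H : PotKernel A l r Ψ φ) {x : Pt n} (hx : x l = 0) :
    dirPot A l Ψ N h x = 0 := by
  simp [dirPot, pot, avg_oddExt_eq_zero H.hA.ne' H.refl hx]

lemma PotKernel.sum_pdW_dirPot (H : PotKernel A l r Ψ φ) (hα : α ∈ Ioo (0 : ℝ) 1) (hN : 1 ≤ N)
    (hh : HB α univ 0 h M) (h0 : ∀ x, R < ‖x‖ → h x = 0) {x : Pt n} (hx : x ∈ upperHS l) :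
    ∑ i, ∑ k, A i k * pdW (upperHS l) i (pdW (upperHS l) k (dirPot A l Ψ N h)) x =
      (∫ y, φ y) * h x - avg φ N (oddExt A l h) x := by
  simp only [H.pdW_pdW_dirPot hα hN hh h0 _ _ hx, H.sum_potDD]

lemma PotKernel.dirPot_add (H : PotKernel A l r Ψ φ) (hN : 0 < N) {h' : Pt n → ℝ} {M' : ℝ} (hh : BddMeas M h)
    (hh' : BddMeas M' h') :
    dirPot A l Ψ N (fun x => h x + h' x) = fun x => dirPot A l Ψ N h x + dirPot A l Ψ N h' x := by
  ext x
  have hb := bddMeas_oddExt (A := A) (l := l) hh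
  have hb' := bddMeas_oddExt (A := A) (l := l) hh'
  rw [dirPot, dirPot, dirPot, pot, pot, pot, ← (summable_pot hN H.ker hb two_ne_zero x).tsum_add
    (summable_pot hN H.ker hb' two_ne_zero x), oddExt_add]
  simp only [avg_add H.ker hb hb', mul_add]

lemma hasDerivAt_line {m : ℕ} (hh : HB α univ (m + 1) h M) (i : Fin n) (y : Pt n) :
    HasDerivAt (fun t : ℝ => h (y + t • (Pi.single i 1 : Pt n))) (pd i h y) 0 := by
  have h1 : DifferentiableAt ℝ h y := (hh.diff y trivial).differentiableAt Filter.univ_mem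
  exact h1.hasFDerivAt.hasLineDerivAt (Pi.single i 1)

lemma PotKernel.pot_pd_eq (H : PotKernel A l r Ψ φ) (hα : α ∈ Ioo (0 : ℝ) 1) (hN : 0 < N) {m : ℕ}
    (hh : HB α univ (m + 1) h M) (hil : i ≠ l) :
    pot N (pd i Ψ) 1 (oddExt A l h) = dirPot A l Ψ N (pd i h) := by
  have hp : HB α univ m (pd i h) M := by simpa only [pdW_univ] using hh.pd i
  ext x
  refine tsum_congr fun j => ?_
  rw [avg_pd_of_hasDerivAt H.ker (sc_pos hN j).ne' (bddMeas_oddExt (hh.bddMeas hα)) (bddMeas_oddExt (hp.bddMeas hα))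
    fun y => hasDerivAt_oddExt hil (hasDerivAt_line hh i) y]
  ring

lemma PotKernel.exists_bound_dirPot (H : PotKernel A l r Ψ φ) (hN : 0 < N) : ∃ K, 0 ≤ K ∧
    ∀ M h, BddMeas M h → (∀ x, |dirPot A l Ψ N h x| ≤ K * M) ∧
      ∀ i x, |pot N (pd i Ψ) 1 (oddExt A l h) x| ≤ K * M := by
  set b0 := (∑' j, sc N j ^ 2) * ∫ y, |Ψ y|
  set b : Fin n → ℝ := fun i => (∑' j, sc N j ^ 1) * ∫ y, |pd i Ψ y|
  have hb0 : 0 ≤ b0 := mul_nonneg (tsum_nonneg fun j => by have := sc_pos hN j; positivity)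
    (MeasureTheory.integral_nonneg fun _ => abs_nonneg _)
  have hb : ∀ i, 0 ≤ b i := fun i => mul_nonneg (tsum_nonneg fun j => by have := sc_pos hN j; positivity)
    (MeasureTheory.integral_nonneg fun _ => abs_nonneg _)
  have hs : 0 ≤ ∑ i, b i := Finset.sum_nonneg fun i _ => hb i
  refine ⟨b0 + ∑ i, b i, by positivity, fun M h hh => ⟨fun x => ?_, fun i x => ?_⟩⟩
  · exact (abs_pot_le hN H.ker (bddMeas_oddExt hh) two_ne_zero x).trans
      (mul_le_mul_of_nonneg_right (by linarith) hh.nonneg)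
  · have := Finset.single_le_sum (f := b) (fun i _ => hb i) (Finset.mem_univ i)
    exact (abs_pot_le hN (H.ker.pd i) (bddMeas_oddExt hh) one_ne_zero x).trans
      (mul_le_mul_of_nonneg_right (by simp only [b] at this hs ⊢; linarith) hh.nonneg)

lemma PotKernel.HB_dirPot (H : PotKernel A l r Ψ φ) (hα : α ∈ Ioo (0 : ℝ) 1) (hN : 1 ≤ N) {m : ℕ} {C : ℝ}
    (hh : HB α univ 0 h M) (h0 : ∀ x, R < ‖x‖ → h x = 0) (h1 : ∀ x, |dirPot A l Ψ N h x| ≤ C)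
    (h2 : ∀ i x, |pot N (pd i Ψ) 1 (oddExt A l h) x| ≤ C)
    (h3 : ∀ i k, HB α (upperHS l) m (potDD A l Ψ φ N h i k) C) :
    HB α (upperHS l) (m + 2) (dirPot A l Ψ N h) C :=
  .of_hasFDeriv (isDom_upperHS l) (fun x _ => h1 x)
    (fun x _ => (hasFDerivAt_pot (by linarith) H.ker (bddMeas_oddExt (hh.bddMeas hα)) one_ne_zero x).hasFDerivWithinAt)
    fun k => .of_hasFDeriv (isDom_upperHS l) (fun x _ => h2 k x)
      (fun x _ => H.hasFDerivWithinAt_grad hα hN hh h0 k x) fun i => h3 i k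

lemma pd_eq_zero_of_lt (h0 : ∀ x, R < ‖x‖ → h x = 0) (i : Fin n) {x : Pt n} (hx : R < ‖x‖) : pd i h x = 0 := by
  refine pd_eq_zero_of_eventuallyEq ?_ i
  filter_upwards [(isOpen_lt continuous_const continuous_norm).mem_nhds hx] with y hy using h0 y hy

lemma PotKernel.exists_HB_dirPot (H : PotKernel A l r Ψ φ) (hn : 0 < n) (hα : α ∈ Ioo (0 : ℝ) 1) (hN : 1 ≤ N) (R : ℝ)
    (m : ℕ) : ∃ K, 0 ≤ K ∧ ∀ M h, HB α univ m h M → (∀ x, R < ‖x‖ → h x = 0) →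
      (∀ i k, HB α (upperHS l) m (potDD A l Ψ φ N h i k) (K * M)) ∧
      HB α (upperHS l) (m + 2) (dirPot A l Ψ N h) (K * M) := by
  obtain ⟨Kb, hKb, HKb⟩ := H.exists_bound_dirPot (N := N) (by linarith)
  have hz : ∀ {m M h}, HB α univ m h M → HB α univ 0 h (((n : ℝ) + 2) ^ m * M) := fun {m M h} hh =>
    hh.zero_of_any isDom_univ hα
  suffices ∃ K, 0 ≤ K ∧ ∀ M h, HB α univ m h M → (∀ x, R < ‖x‖ → h x = 0) →
      ∀ i k, HB α (upperHS l) m (potDD A l Ψ φ N h i k) (K * M) by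
    obtain ⟨K, hK, HK⟩ := this
    refine ⟨K + Kb, by positivity, fun M h hh h0 => ?_⟩
    have hM := hh.nonneg isDom_univ
    have h3 : ∀ i k, HB α (upperHS l) m (potDD A l Ψ φ N h i k) ((K + Kb) * M) := fun i k =>
      (HK M h hh h0 i k).mono (mul_le_mul_of_nonneg_right (by linarith) hM)
    have hb := HKb M h (hh.bddMeas hα)
    have hle : Kb * M ≤ (K + Kb) * M := mul_le_mul_of_nonneg_right (by linarith) hM
    exact ⟨h3, H.HB_dirPot hα hN (hz hh) h0 (fun x => (hb.1 x).trans hle) (fun i x => (hb.2 i x).trans hle) h3⟩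
  induction m with
  | zero =>
    obtain ⟨K, hK, HK⟩ := exists_HB_potDD H hα hN R
    exact ⟨K, hK, fun M h hh h0 i k => (HK M h hh h0 i k).subset (isDom_upperHS l) (subset_univ _)⟩
  | succ m ih =>
    obtain ⟨K, hK, HK⟩ := ih
    obtain ⟨κ, hκ, Hκ⟩ := exists_HB_avg hα hn H.src
      (max R (‖conormalRefl A l‖ * R)) (m + 1)
    have hU : ∀ M h, HB α univ m h M → (∀ x, R < ‖x‖ → h x = 0) →
        HB α (upperHS l) (m + 2) (dirPot A l Ψ N h) ((K + Kb) * M) := fun M h hh h0 => by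
      have hM := hh.nonneg isDom_univ
      have hb := HKb M h (hh.bddMeas hα)
      have hle : Kb * M ≤ (K + Kb) * M := mul_le_mul_of_nonneg_right (by linarith) hM
      exact H.HB_dirPot hα hN (hz hh) h0 (fun x => (hb.1 x).trans hle) (fun i x => (hb.2 i x).trans hle)
        fun i k => (HK M h hh h0 i k).mono (mul_le_mul_of_nonneg_right (by linarith) hM)
    have htan : ∀ M h, HB α univ (m + 1) h M → (∀ x, R < ‖x‖ → h x = 0) → ∀ i k, k ≠ l →
        HB α (upperHS l) (m + 1) (potDD A l Ψ φ N h i k) ((K + Kb) * M) := fun M h hh h0 i k hk => by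
      have hp : HB α univ m (pd k h) M := by simpa only [pdW_univ] using hh.pd k
      have h1 := (hU M _ hp fun x hx => pd_eq_zero_of_lt h0 k hx).pd i
      refine h1.congr fun x hx => ?_
      rw [← H.pdW_pdW_dirPot hα hN (hz hh) h0 i k hx]
      refine pdW_congr (fun y hy => ?_) hx i
      rw [H.pdW_dirPot (by linarith) (hh.bddMeas hα) k hy, H.pot_pd_eq hα (by linarith) hh hk]
    have hoff : ∀ M h, HB α univ (m + 1) h M → (∀ x, R < ‖x‖ → h x = 0) → ∀ i k, ¬(i = l ∧ k = l) →
        HB α (upperHS l) (m + 1) (potDD A l Ψ φ N h i k) ((K + Kb) * M) := fun M h hh h0 i k hik => by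
      by_cases hk : k = l
      · rw [potDD_comm H]
        exact htan M h hh h0 k i fun hi => hik ⟨hi, hk⟩
      · exact htan M h hh h0 i k hk
    set Kn := |(A l l)⁻¹| * (|∫ y, φ y| + κ + ∑ p, ∑ q, |A p q| * (K + Kb))
    have hKn : 0 ≤ Kn := by
      have : 0 ≤ ∑ p, ∑ q, |A p q| * (K + Kb) :=
        Finset.sum_nonneg fun p _ => Finset.sum_nonneg fun q _ => by positivity
      positivity
    refine ⟨K + Kb + Kn, by positivity, fun M h hh h0 i k => ?_⟩
    have hM := hh.nonneg isDom_univ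
    by_cases hik : i = l ∧ k = l
    · have e : potDD A l Ψ φ N h i k = fun x => (A l l)⁻¹ * ((∫ y, φ y) * h x - avg φ N (oddExt A l h) x -
          ∑ p, ∑ q, if p = l ∧ q = l then 0 else A p q * potDD A l Ψ φ N h p q x) := by
        ext x
        rw [potDD, if_pos hik]
        congr 2
        refine Finset.sum_congr rfl fun p _ => Finset.sum_congr rfl fun q _ => ?_
        split_ifs with hpq
        · rfl
        · rw [potDD, if_neg hpq]
      rw [e]
      have h1 := (Hκ N M _ hN (bddMeas_oddExt (hh.bddMeas hα)) fun x hx => oddExt_eq_zero H.hA.ne' h0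
        ((le_max_left _ _).trans_lt hx)
        ((le_max_right _ _).trans_lt hx)).mono (C' := κ * M) (div_le_self (by positivity) hN)
      have h2 : HB α (upperHS l) (m + 1) (fun x => ∑ p, ∑ q, if p = l ∧ q = l then 0 else
          A p q * potDD A l Ψ φ N h p q x)
          (∑ p, ∑ q, |A p q| * ((K + Kb) * M)) := by
        refine HB.sum (isDom_upperHS l) _ fun p _ => HB.sum (isDom_upperHS l) _ fun q _ => ?_
        by_cases hpq : p = l ∧ q = l
        · simp only [if_pos hpq]
          exact HB.zero.mono (by positivity)
        · simp only [if_neg hpq]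
          exact (hoff M h hh h0 p q hpq).smul (isDom_upperHS l) _
      have hh' := hh.subset (isDom_upperHS l) (subset_univ _)
      have h1' := h1.subset (isDom_upperHS l) (subset_univ _)
      refine ((((hh'.smul (isDom_upperHS l) (∫ y, φ y)).sub (isDom_upperHS l) h1').sub (isDom_upperHS l) h2).smul
        (isDom_upperHS l) (A l l)⁻¹).mono ?_
      have : |(A l l)⁻¹| * (|∫ y, φ y| * M + κ * M + ∑ p, ∑ q, |A p q| * ((K + Kb) * M)) = Kn * M := by
        simp only [Kn, ← mul_assoc, ← Finset.sum_mul]; ring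
      rw [this]
      exact mul_le_mul_of_nonneg_right (by linarith) hM
    · exact (hoff M h hh h0 i k hik).mono (mul_le_mul_of_nonneg_right (by linarith) hM)

end dirichlet

lemma HB.pdW_eq_pd {m : ℕ} {f : Pt n → ℝ} {C : ℝ} (hf : HB α univ (m + 1) f C) (hS : IsDom S) {x : Pt n} (hx : x ∈ S)
    (i : Fin n) : pdW S i f x = _root_.pd i f x := by
  have h1 := (hasFDeriv_pdW (hf.diff x trivial)).mono (subset_univ S)
  rw [pdW_of_hasFDeriv hS hx h1, pdW_univ]

lemma HB.pd_univ {m : ℕ} {f : Pt n → ℝ} {C : ℝ} (hf : HB α univ (m + 1) f C) (i : Fin n) :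
    HB α univ m (_root_.pd i f) C := by
  simpa only [pdW_univ] using hf.pd i

lemma HB.pdW_pdW_eq_of_eqOn {m : ℕ} {f g : Pt n → ℝ} {C : ℝ} (hf : HB α univ (m + 2) f C) (hS : IsDom S)
    (hfg : EqOn g f S) {x : Pt n} (hx : x ∈ S) (i j : Fin n) :
    pdW S i (pdW S j g) x = _root_.pd i (_root_.pd j f) x := by
  rw [pdW_congr (fun y hy => (pdW_congr hfg hy j).trans (hf.pdW_eq_pd hS hy j)) hx, (hf.pd_univ j).pdW_eq_pd hS hx]

lemma pd_const_mul {m : ℕ} {f : Pt n → ℝ} {C : ℝ} (hf : HB α univ (m + 1) f C) (c : ℝ) (i : Fin n) :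
    pd i (fun x => c * f x) = fun x => c * pd i f x := by
  ext x
  rw [← pdW_univ, ← pdW_univ, pdW_smul isDom_univ trivial (hf.diff x trivial)]

lemma pd_fun_add {m : ℕ} {f g : Pt n → ℝ} {C C' : ℝ} (hf : HB α univ (m + 1) f C) (hg : HB α univ (m + 1) g C')
    (i : Fin n) : pd i (fun x => f x + g x) = fun x => pd i f x + pd i g x := by
  ext x
  rw [← pdW_univ, ← pdW_univ, ← pdW_univ, pdW_add isDom_univ trivial (hf.diff x trivial) (hg.diff x trivial)]

lemma exists_cutoff (hα : α ∈ Ioo (0 : ℝ) 1) (m : ℕ) : ∃ (χ : Pt n → ℝ) (C : ℝ), HB α univ m χ C ∧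
    (∀ x, ‖x‖ ≤ 1 → χ x = 1) ∧ ∀ x, 2 ≤ ‖x‖ → χ x = 0 := by
  let b : ContDiffBump (0 : Pt n) := ⟨1, 2, one_pos, one_lt_two⟩
  obtain ⟨C, hC⟩ := HB.of_contDiff_hasCompactSupport hα m b.contDiff b.hasCompactSupport
  refine ⟨b, C, hC, fun x hx => b.one_of_mem_closedBall (by simpa using hx), fun x hx => ?_⟩
  exact b.zero_of_le_dist (by simpa [dist_zero_right] using hx)

/-- First order perturbation of a constant coefficient operator. -/
def pertOp (q : Fin n → Fin n → Pt n → ℝ) (b : Fin n → Pt n → ℝ) (c v : Pt n → ℝ) (x : Pt n) : ℝ :=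
  ∑ i, ∑ j, q i j x * pd i (pd j v) x + ∑ i, b i x * pd i v x + c x * v x

lemma HB.pertOp {m : ℕ} (hα : α ∈ Ioo (0 : ℝ) 1) {q : Fin n → Fin n → Pt n → ℝ} {b : Fin n → Pt n → ℝ} {c v : Pt n → ℝ}
    {δ M : ℝ} (hq : ∀ i j, HB α univ m (q i j) δ) (hb : ∀ i, HB α univ m (b i) δ) (hc : HB α univ m c δ)
    (hv : HB α univ (m + 2) v M) :
    HB α univ m (_root_.pertOp q b c v) (((n : ℝ) * (n : ℝ) + n * (n + 2) + (n + 2) ^ 2) * (mulC n m * (δ * M))) := by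
  have h1 := HB.sum isDom_univ Finset.univ fun i _ => HB.sum isDom_univ Finset.univ fun j _ =>
    (hq i j).mul isDom_univ hα ((hv.pd_univ j).pd_univ i)
  have h2 := HB.sum isDom_univ Finset.univ fun i _ =>
    (hb i).mul isDom_univ hα ((hv.pd_univ i).down isDom_univ hα)
  have h3 := hc.mul isDom_univ hα ((hv.down isDom_univ hα).down isDom_univ hα)
  refine ((h1.add isDom_univ h2).add isDom_univ h3).mono (le_of_eq ?_)
  simp only [Finset.sum_const, Finset.card_univ, Fintype.card_fin, nsmul_eq_mul]
  ring

lemma pertOp_add {m : ℕ} {q : Fin n → Fin n → Pt n → ℝ} {b : Fin n → Pt n → ℝ} {c v v' : Pt n → ℝ}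
    {M M' : ℝ} (hv : HB α univ (m + 2) v M) (hv' : HB α univ (m + 2) v' M') :
    pertOp q b c (fun x => v x + v' x) = fun x => pertOp q b c v x + pertOp q b c v' x := by
  ext x
  have h1 : ∀ i j, pd i (pd j fun x => v x + v' x) = fun x => pd i (pd j v) x + pd i (pd j v') x := fun i j => by
    rw [pd_fun_add hv hv' j, pd_fun_add (hv.pd_univ j) (hv'.pd_univ j) i]
  simp only [pertOp, h1]
  simp only [pd_fun_add hv hv', mul_add, Finset.sum_add_distrib]
  ring

/-- Boundary value problem for small perturbations of a constant coefficient operator. -/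
lemma exists_unit_solution (hα : α ∈ Ioo (0 : ℝ) 1) {A : Matrix (Fin n) (Fin n) ℝ} (hAs : A.IsSymm) (hA : A.PosDef)
    (l : Fin n) (m : ℕ) : ∃ δ > 0, ∃ C₁, 0 ≤ C₁ ∧ ∀ (q : Fin n → Fin n → Pt n → ℝ) (b : Fin n → Pt n → ℝ)
      (c : Pt n → ℝ), (∀ i j, HB α univ m (q i j) δ ∧ ∀ x, 2 < ‖x‖ → q i j x = 0) →
      (∀ i, HB α univ m (b i) δ ∧ ∀ x, 2 < ‖x‖ → b i x = 0) → HB α univ m c δ → (∀ x, 2 < ‖x‖ → c x = 0) →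
      ∀ (M : ℝ) (f : Pt n → ℝ), HB α univ m f M → (∀ x, 2 < ‖x‖ → f x = 0) →
      ∃ v, HB α univ (m + 2) v (C₁ * M) ∧ (∀ x, x l = 0 → v x = 0) ∧ ∀ x, 0 ≤ x l → ‖x‖ ≤ 1 →
        ∑ i, ∑ j, A i j * pd i (pd j v) x + pertOp q b c v x = f x := by
  obtain ⟨r, Ψ, φ, hr, hΨ, hφ, hφ0, hrefl, hpde⟩ := exists_kernel hAs hA l
  have H : PotKernel A l r Ψ φ := ⟨hA.diag_pos, hr, hΨ, hφ, hrefl, hpde⟩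
  have hn : 0 < n := Fin.pos l
  obtain ⟨χ, Cχ, hχ, hχ1, hχ0⟩ := exists_cutoff (n := n) hα m
  obtain ⟨κ, hκ, Hκ⟩ := exists_HB_avg hα hn hφ (max 2 (‖conormalRefl A l‖ * 2)) m
  obtain ⟨E, KE, hKE, hES, hEadd, hEHB⟩ := exists_extension (n := n) hα l (m + 2)
  set I := ∫ y, φ y
  have hCχ := hχ.nonneg isDom_univ
  have hmulC := mulC_nonneg n m
  set G := |I⁻¹| * (mulC n m * (Cχ * κ))
  have hG : 0 ≤ G := by positivity
  set N := 1 + 4 * G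
  have hN : 1 ≤ N := by simp only [N]; linarith
  have hN0 : 0 < N := by linarith
  obtain ⟨K, hK, HK⟩ := H.exists_HB_dirPot hn hα hN 2 m
  set T : (Pt n → ℝ) → Pt n → ℝ := fun h x => I⁻¹ * E (dirPot A l Ψ N h) x
  set KT := |I⁻¹| * (KE * K)
  have hKT : 0 ≤ KT := by positivity
  have hT : ∀ h M, HB α univ m h M → (∀ x, 2 < ‖x‖ → h x = 0) → HB α univ (m + 2) (T h) (KT * M) :=
    fun h M hh h0 => ((hEHB _ _ (HK M h hh h0).2).smul isDom_univ I⁻¹).mono (le_of_eq (by simp only [KT]; ring))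
  set G' := (((n : ℝ) * (n : ℝ) + n * (n + 2) + (n + 2) ^ 2) * (mulC n m * KT))
  have hG' : 0 ≤ G' := by positivity
  set δ := (4 * (1 + G'))⁻¹
  have hδ : 0 < δ := by positivity
  refine ⟨δ, hδ, KT * 2, by positivity, fun q b c hq hb hc hc0 M f hf hf0 => ?_⟩
  set Kop : (Pt n → ℝ) → Pt n → ℝ := fun h x =>
    I⁻¹ * (χ x * avg φ N (oddExt A l h) x) - pertOp q b c (T h) x
  have hKop : ∀ h C, HB α univ m h C → (∀ x ∉ {x : Pt n | ‖x‖ ≤ 2}, h x = 0) →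
      HB α univ m (Kop h) (C * (1 / 2)) ∧ ∀ x ∉ {x : Pt n | ‖x‖ ≤ 2}, Kop h x = 0 := fun h C hh h0 => by
    have hC := hh.nonneg isDom_univ
    have h0' : ∀ x, 2 < ‖x‖ → h x = 0 := fun x hx => h0 x (by simpa using hx)
    refine ⟨?_, fun x hx => ?_⟩
    · have h1 := (hχ.mul isDom_univ hα (Hκ N C _ hN (bddMeas_oddExt (A := A) (l := l) (hh.bddMeas hα)) fun x hx =>
        oddExt_eq_zero H.hA.ne' h0' ((le_max_left _ _).trans_lt hx) ((le_max_right _ _).trans_lt hx))).smul isDom_univ I⁻¹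
      have h2 := HB.pertOp hα (fun i j => (hq i j).1) (fun i => (hb i).1) hc (hT h C hh h0')
      refine (h1.sub isDom_univ h2).mono ?_
      have e1 : |I⁻¹| * (mulC n m * (Cχ * (κ * C / N))) = G / N * C := by simp only [G]; ring
      have e2 : ((n : ℝ) * (n : ℝ) + n * (n + 2) + (n + 2) ^ 2) * (mulC n m * (δ * (KT * C))) = G' * δ * C := by
        simp only [G']; ring
      have h3 : G / N ≤ 1 / 4 := by rw [div_le_div_iff₀ hN0 (by norm_num)]; simp only [N]; linarith
      have h4 : G' * δ ≤ 1 / 4 := by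
        simp only [δ]; rw [← div_eq_mul_inv, div_le_div_iff₀ (by positivity) (by norm_num)]; linarith
      rw [e1, e2]
      nlinarith
    · have hx' : 2 < ‖x‖ := by simpa using hx
      simp [Kop, pertOp, (hq _ _).2 x hx', (hb _).2 x hx', hc0 x hx', hχ0 x hx'.le]
  have hb0 : ∀ {h : Pt n → ℝ} {C : ℝ}, HB α univ m h C → BddMeas C h := fun hh => hh.bddMeas hα
  have hadd : ∀ h₁ h₂ C₁ C₂, HB α univ m h₁ C₁ → HB α univ m h₂ C₂ → (∀ x ∉ {x : Pt n | ‖x‖ ≤ 2}, h₁ x = 0) →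
      (∀ x ∉ {x : Pt n | ‖x‖ ≤ 2}, h₂ x = 0) → Kop (fun x => h₁ x + h₂ x) = fun x => Kop h₁ x + Kop h₂ x :=
    fun h₁ h₂ C₁ C₂ hh₁ hh₂ hz₁ hz₂ => by
      have hTadd : T (fun x => h₁ x + h₂ x) = fun x => T h₁ x + T h₂ x := by
        ext x
        simp only [T, H.dirPot_add hN0 (hb0 hh₁) (hb0 hh₂), hEadd]
        ring
      ext x
      simp only [Kop, hTadd, oddExt_add,
        avg_add hφ (bddMeas_oddExt (A := A) (l := l) (hb0 hh₁)) (bddMeas_oddExt (A := A) (l := l) (hb0 hh₂)),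
        pertOp_add (hT h₁ C₁ hh₁ fun x hx => hz₁ x (by simpa using hx))
          (hT h₂ C₂ hh₂ fun x hx => hz₂ x (by simpa using hx))]
      ring
  obtain ⟨h, hh, h0, hfix⟩ := HB.exists_fixedPoint hKop hadd hf fun x hx => hf0 x (by simpa using hx)
  have h0' : ∀ x, 2 < ‖x‖ → h x = 0 := fun x hx => h0 x (by simpa using hx)
  have hTh := hT h _ hh h0'
  refine ⟨T h, hTh.mono (le_of_eq (by ring)), fun x hx => ?_, fun x hx hx1 => ?_⟩
  · simp only [T, hES _ x hx.ge, H.dirPot_eq_zero hx, mul_zero]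
  · have hE := hEHB _ _ (HK _ h hh h0').2
    have h1 : ∀ i j, pd i (pd j (T h)) x =
        I⁻¹ * pdW (upperHS l) i (pdW (upperHS l) j (dirPot A l Ψ N h)) x := fun i j => by
      rw [hE.pdW_pdW_eq_of_eqOn (isDom_upperHS l) (fun y hy => (hES _ y hy).symm) (show x ∈ upperHS l from hx),
        show T h = fun x => I⁻¹ * E (dirPot A l Ψ N h) x from rfl, pd_const_mul hE, pd_const_mul (hE.pd_univ j)]
    have h2 := H.sum_pdW_dirPot hα hN (hh.zero_of_any isDom_univ hα) h0' (show x ∈ upperHS l from hx)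
    have h3 : ∑ i, ∑ j, A i j * pd i (pd j (T h)) x = I⁻¹ * (I * h x - avg φ N (oddExt A l h) x) := by
      rw [← h2, Finset.mul_sum]
      refine Finset.sum_congr rfl fun i _ => ?_
      rw [Finset.mul_sum]
      exact Finset.sum_congr rfl fun j _ => by rw [h1]; ring
    have h4 : I⁻¹ * (I * h x) = h x := inv_mul_cancel_left₀ hφ0.ne' _
    have h5 := hfix x
    simp only [Kop, hχ1 x hx1, one_mul] at h5
    rw [h3]
    linear_combination h4 + h5

lemma HB.comp_smul_univ {m : ℕ} (hα : α ∈ Ioo (0 : ℝ) 1) {f : Pt n → ℝ} {C : ℝ} (hf : HB α univ m f C) (c : ℝ) :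
    HB α univ m (fun x => f (c • x)) ((1 + |c|) ^ (m + 1) * C) := by
  have hC := hf.nonneg isDom_univ
  have hb : ∀ {m : ℕ} {f : Pt n → ℝ}, HB α univ m f C → ∀ x ∈ (univ : Set (Pt n)), |f (c • x)| ≤ (1 + |c|) ^ (m + 1) * C :=
    fun hf x _ => (hf.bound _ trivial).trans
      (le_mul_of_one_le_left hC (one_le_pow₀ (by linarith [abs_nonneg c])))
  induction m generalizing f with
  | zero =>
    refine ⟨hb hf, fun x _ y _ => ?_⟩
    have h1 := hf.2 (c • x) trivial (c • y) trivial
    have h2 : |c| ^ α ≤ 1 + |c| := by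
      calc |c| ^ α ≤ (1 + |c|) ^ α := by have := hα.1.le; gcongr; linarith
        _ ≤ (1 + |c|) ^ (1 : ℝ) := Real.rpow_le_rpow_of_exponent_le (by linarith [abs_nonneg c]) hα.2.le
        _ = 1 + |c| := Real.rpow_one _
    rw [← smul_sub, norm_smul, Real.mul_rpow (norm_nonneg _) (norm_nonneg _), Real.norm_eq_abs] at h1
    refine h1.trans ?_
    rw [zero_add, pow_one, ← mul_assoc]
    refine mul_le_mul_of_nonneg_right ?_ (by positivity)
    rw [mul_comm]
    exact mul_le_mul_of_nonneg_right h2 hC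
  | succ m ih =>
    refine .of_hasFDeriv isDom_univ (f' := fun i x => c * _root_.pd i f (c • x)) (hb hf) (fun x _ => ?_) fun i =>
      ((ih (hf.pd_univ i)).smul isDom_univ c).mono ?_
    · have h1 := (hasFDeriv_pdW (hf.diff (c • x) trivial)).hasFDerivAt Filter.univ_mem
      have h2 := h1.comp x ((ContinuousLinearMap.id ℝ (Pt n)).hasFDerivAt.const_smul c)
      refine (h2.congr_fderiv ?_).hasFDerivWithinAt
      ext v
      simp [gradForm_apply, pdW_univ, Finset.mul_sum, mul_assoc]
    · rw [pow_succ (1 + |c|) (m + 1), ← mul_assoc, mul_comm |c|]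
      have := pow_nonneg (by linarith [abs_nonneg c] : (0 : ℝ) ≤ 1 + |c|) (m + 1)
      nlinarith [mul_nonneg this hC]

lemma HB.coord (hα : α ∈ Ioo (0 : ℝ) 1) {R : ℝ} (hR : 0 < R) (m : ℕ) (j : Fin n) :
    HB α (Metric.ball 0 R) m (fun x : Pt n => x j) (2 * R + 1) := by
  have hb : ∀ x ∈ Metric.ball (0 : Pt n) R, |x j| ≤ R := fun x hx => by
    have := norm_le_pi_norm x j
    rw [Real.norm_eq_abs] at this
    exact this.trans (mem_ball_zero_iff.1 hx).le
  cases m with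
  | zero =>
    refine ⟨fun x hx => (hb x hx).trans (by linarith), fun x hx y hy => ?_⟩
    refine holder_of_lipschitz (f := fun x : Pt n => x j) hα hR.le zero_le_one (hb x hx) (hb y hy) ?_
    have := norm_le_pi_norm (x - y) j
    rwa [Real.norm_eq_abs, Pi.sub_apply, ← one_mul ‖x - y‖] at this
  | succ m =>
    refine .of_hasFDeriv (isDom_ball hR) (f' := fun i _ => if i = j then 1 else 0)
      (fun x hx => (hb x hx).trans (by linarith)) (fun x _ => ?_) fun i =>
        (HB.const _).mono (by split_ifs <;> simp <;> linarith)
    have h1 := (ContinuousLinearMap.proj (R := ℝ) (φ := fun _ : Fin n => ℝ) j).hasFDerivAt (x := x)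
    refine (h1.congr_fderiv ?_).hasFDerivWithinAt
    ext v
    simp [gradForm_apply]

lemma LocH.coord (hα : α ∈ Ioo (0 : ℝ) 1) (m : ℕ) (j : Fin n) : LocH α m fun x : Pt n => x j :=
  .of_HB one_pos (HB.coord hα one_pos m j)

lemma LocH.eventually_family {ι : Type*} [Fintype ι] {m : ℕ} {f : ι → Pt n → ℝ} (hf : ∀ i, LocH α m (f i)) :
    ∀ᶠ r in nhdsWithin (0 : ℝ) (Ioi 0), ∃ C, ∀ i, HB α (Metric.ball 0 r) m (f i) C := by
  filter_upwards [Filter.eventually_all.2 hf, self_mem_nhdsWithin] with r h hr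
  choose C hC using h
  exact ⟨∑ i, C i, fun i => (hC i).mono
    (Finset.single_le_sum (fun i _ => (hC i).nonneg (isDom_ball hr)) (Finset.mem_univ i))⟩

lemma HB.cutoff_mul {m : ℕ} (hα : α ∈ Ioo (0 : ℝ) 1) {χ w : Pt n → ℝ} {Cχ C : ℝ} (hχ : HB α univ m χ Cχ)
    (hχ0 : ∀ x, 2 ≤ ‖x‖ → χ x = 0) (hw : HB α (Metric.ball 0 (2 + 1)) m w C) :
    HB α univ m (fun x => χ x * w x) (mulC n m * (Cχ * C)) ∧ ∀ x, 2 < ‖x‖ → χ x * w x = 0 := by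
  have h0 : ∀ x, 2 < ‖x‖ → χ x * w x = 0 := fun x hx => by rw [hχ0 x hx.le, zero_mul]
  have hB := isDom_ball (n := n) (show (0 : ℝ) < 2 + 1 by norm_num)
  exact ⟨((hχ.subset hB (subset_univ _)).mul hB hα hw).zeroExt hα zero_le_two h0, h0⟩

lemma pd_affine_add_comp_smul {m : ℕ} {v : Pt n → ℝ} {C : ℝ} (hv : HB α univ (m + 1) v C) (s t c : ℝ) (j i : Fin n) :
    pd i (fun x => s + t * x j + v (c • x)) = fun x => (if i = j then t else 0) + c * pd i v (c • x) := by
  ext x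
  have h1 := (hasFDeriv_pdW (hv.diff (c • x) trivial)).hasFDerivAt Filter.univ_mem
  have h2 := h1.comp x ((ContinuousLinearMap.id ℝ (Pt n)).hasFDerivAt.const_smul c)
  have h3 := (ContinuousLinearMap.proj (R := ℝ) (φ := fun _ : Fin n => ℝ) j).hasFDerivAt (x := x)
  have h4 := ((h3.const_mul t).const_add s).add h2
  have h5 : HasFDerivAt (fun x : Pt n => s + t * x j + v (c • x)) _ x := h4
  rw [pd, h5.fderiv]
  simp [gradForm_apply, pdW_univ, Pi.single_apply, mul_comm, eq_comm]

/-- Local solvability of the Dirichlet problem with affine boundary values. -/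
lemma exists_local_solution (hα : α ∈ Ioo (0 : ℝ) 1) (l j : Fin n) (s t : ℝ) {m : ℕ} {a : Fin n → Fin n → Pt n → ℝ}
    {b : Fin n → Pt n → ℝ} {c : Pt n → ℝ} (ha : ∀ i k, LocH α m (a i k)) (hb : ∀ i, LocH α m (b i)) (hc : LocH α m c)
    (hs : (Matrix.of fun i k => a i k 0).IsSymm) (hp : (Matrix.of fun i k => a i k 0).PosDef) :
    ∃ u, LocH α (m + 2) u ∧ (∀ x, x l = 0 → u x = s + t * x j) ∧ |pd l u 0 - if l = j then t else 0| ≤ 1 / 2 ∧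
      ∃ r > 0, ∀ x, 0 ≤ x l → ‖x‖ < r → pertOp a b c u x = 0 := by
  set A : Matrix (Fin n) (Fin n) ℝ := Matrix.of fun i k => a i k 0
  obtain ⟨δ, hδ, C₁, hC₁, hsol⟩ := exists_unit_solution hα hs hp l m
  obtain ⟨χ, Cχ, hχ, hχ1, hχ0⟩ := exists_cutoff (n := n) hα m
  have hp' : LocH α m fun x => t * b j x + c x * (s + t * x j) :=
    ((hb j).smul t).add (hc.mul hα ((LocH.const s).add ((LocH.coord hα m j).smul t)))
  obtain ⟨r₀, ⟨⟨Ca, hCa⟩, ⟨Cb, hCb⟩, ⟨Cc, hCc⟩, ⟨Cp, hCp⟩⟩, hr₀⟩ :=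
    (((LocH.eventually_family (f := fun p : Fin n × Fin n => a p.1 p.2) fun p => ha p.1 p.2).and
      ((LocH.eventually_family hb).and (hc.and hp'))).and self_mem_nhdsWithin).exists
  have hr₀' : 0 < r₀ := hr₀
  have hB₀ := isDom_ball (n := n) hr₀'
  have hCa0 : 0 ≤ Ca := (hCa (l, l)).nonneg hB₀
  have hCb0 : 0 ≤ Cb := (hCb l).nonneg hB₀
  have hCc0 := hCc.nonneg hB₀
  have hCp0 := hCp.nonneg hB₀
  have hCχ := hχ.nonneg isDom_univ
  have hmulC := mulC_nonneg n m
  set Ka := (2 + 1) * ((n : ℝ) + 2) ^ m * Ca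
  set D := mulC n m * (Cχ * (Ka + Cb + Cc))
  have hD : 0 ≤ D := by positivity
  set M₀ := mulC n m * (Cχ * Cp)
  obtain ⟨ε, ⟨hεδ, hεh⟩, ⟨hε0, hεr⟩, hε1⟩ : ∃ ε : ℝ, (D * ε ^ α ≤ δ ∧ ε * (C₁ * M₀) ≤ 1 / 2) ∧
      ε ∈ Ioc 0 (r₀ / (2 + 1)) ∧ ε ∈ Ioc (0 : ℝ) 1 := by
    have h1 : Filter.Tendsto (fun ε : ℝ => D * ε ^ α) (nhdsWithin 0 (Ioi 0)) (nhds 0) := by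
      have := ((Real.continuousAt_rpow_const 0 α (Or.inr hα.1.le)).tendsto.const_mul D).mono_left
        (nhdsWithin_le_nhds (s := Ioi 0))
      rwa [Real.zero_rpow hα.1.ne', mul_zero] at this
    have h2 : Filter.Tendsto (fun ε : ℝ => ε * (C₁ * M₀)) (nhdsWithin 0 (Ioi 0)) (nhds 0) := by
      have := (Filter.tendsto_id (α := ℝ) (x := nhds 0)).mul_const (C₁ * M₀) |>.mono_left
        (nhdsWithin_le_nhds (s := Ioi 0))
      rwa [zero_mul] at this
    exact (((h1.eventually_le_const hδ).and (h2.eventually_le_const (by norm_num))).and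
      ((Filter.Eventually.and (Ioc_mem_nhdsGT (by positivity)) (Ioc_mem_nhdsGT one_pos)))).exists
  have hε1 := hε1.2
  have hεr' : ε * (2 + 1) ≤ r₀ := (le_div_iff₀ (by norm_num)).1 hεr
  have hεα : ε ≤ ε ^ α := by
    simpa using Real.rpow_le_rpow_of_exponent_ge hε0 hε1 hα.2.le
  have hεα0 : 0 ≤ ε ^ α := by positivity
  have hscale : ∀ {w : Pt n → ℝ} {C : ℝ}, HB α (Metric.ball 0 r₀) m w C →
      HB α (Metric.ball 0 (2 + 1)) m (fun x => w (ε • x)) C := fun hw =>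
    hw.comp_smul hα (by norm_num) hε0 hε1 hεr'
  have hB3 := isDom_ball (n := n) (show (0 : ℝ) < 2 + 1 by norm_num)
  have hle : ∀ {K e : ℝ}, 0 ≤ K → 0 ≤ e → K ≤ Ka + Cb + Cc → e ≤ ε ^ α → mulC n m * (Cχ * (e * K)) ≤ δ :=
    fun {K e} hK he h1 h2 => by
      refine le_trans ?_ hεδ
      calc mulC n m * (Cχ * (e * K)) ≤ mulC n m * (Cχ * (ε ^ α * (Ka + Cb + Cc))) := by gcongr
        _ = D * ε ^ α := by ring
  have hKa : 0 ≤ Ka := by positivity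
  obtain ⟨v, hv, hv0, hveq⟩ := hsol (fun i k x => χ x * (a i k (ε • x) - a i k 0)) (fun i x => χ x * (ε * b i (ε • x)))
    (fun x => χ x * (ε ^ 2 * c (ε • x)))
    (fun i k => by
      have := HB.cutoff_mul hα hχ hχ0 ((hCa (i, k)).comp_smul_sub hα (by norm_num) hε0 hε1 hεr')
      exact ⟨this.1.mono (hle hKa hεα0 (by linarith) le_rfl), this.2⟩)
    (fun i => by
      have := HB.cutoff_mul hα hχ hχ0 ((hscale (hCb i)).smul hB3 ε)
      rw [abs_of_pos hε0] at this
      exact ⟨this.1.mono (hle hCb0 hε0.le (by linarith) hεα), this.2⟩)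
    (by
      have := HB.cutoff_mul hα hχ hχ0 ((hscale hCc).smul hB3 (ε ^ 2))
      rw [abs_of_pos (by positivity)] at this
      exact this.1.mono (hle hCc0 (by positivity) (by linarith) (by nlinarith)))
    (fun x hx => by rw [hχ0 x hx.le, zero_mul])
    (ε ^ 2 * M₀) (fun x => χ x * (-ε ^ 2 * (t * b j (ε • x) + c (ε • x) * (s + t * (ε • x) j))))
    (by
      have := HB.cutoff_mul hα hχ hχ0 ((hscale hCp).smul hB3 (-ε ^ 2))
      rw [abs_neg, abs_of_pos (by positivity)] at this
      exact this.1.mono (le_of_eq (by simp only [M₀]; ring)))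
    (fun x hx => by rw [hχ0 x hx.le, zero_mul])
  have hd1 : ∀ i, pd i (fun x => s + t * x j + v (ε⁻¹ • x)) =
      fun x => (if i = j then t else 0) + ε⁻¹ * pd i v (ε⁻¹ • x) := fun i => pd_affine_add_comp_smul hv s t _ j i
  refine ⟨fun x => s + t * x j + v (ε⁻¹ • x), ?_, fun x hx => ?_, ?_, ε, hε0, fun x hx hxr => ?_⟩
  · exact ((LocH.const s).add ((LocH.coord hα _ j).smul t)).add
      (.of_HB one_pos ((hv.comp_smul_univ hα ε⁻¹).subset (isDom_ball one_pos) (subset_univ _)))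
  · simp only [hv0 (ε⁻¹ • x) (by simp [hx]), add_zero]
  · rw [hd1 l]
    simp only [smul_zero, add_sub_cancel_left]
    have h1 := (hv.pd_univ l).bound 0 trivial
    rw [abs_mul, abs_of_pos (by positivity)]
    calc ε⁻¹ * |pd l v 0| ≤ ε⁻¹ * (C₁ * (ε ^ 2 * M₀)) := by gcongr
      _ = ε * (C₁ * M₀) := by field_simp
      _ ≤ 1 / 2 := hεh
  · have hd2 : ∀ i k, pd i (pd k fun x => s + t * x j + v (ε⁻¹ • x)) x =
        ε⁻¹ ^ 2 * pd i (pd k v) (ε⁻¹ • x) := fun i k => by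
      rw [hd1 k]
      have := pd_affine_add_comp_smul ((hv.pd_univ k).smul isDom_univ ε⁻¹) (if k = j then t else 0) 0 ε⁻¹ j i
      simp only [zero_mul, add_zero, ite_self, zero_add] at this
      rw [this, pd_const_mul (hv.pd_univ k)]
      ring
    have hX : ‖ε⁻¹ • x‖ ≤ 1 := by
      rw [norm_smul, norm_inv, Real.norm_of_nonneg hε0.le, inv_mul_le_iff₀ hε0]; linarith
    have hXl : 0 ≤ (ε⁻¹ • x) l := by simp only [Pi.smul_apply, smul_eq_mul]; positivity
    have heq := hveq (ε⁻¹ • x) hXl hX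
    simp only [pertOp, hχ1 _ hX, one_mul, smul_inv_smul₀ hε0.ne'] at heq
    simp only [pertOp, hd2]
    simp only [hd1]
    have e1 : ∑ i, ∑ k, A i k * pd i (pd k v) (ε⁻¹ • x) + ∑ i, ∑ k, (a i k x - a i k 0) * pd i (pd k v) (ε⁻¹ • x) =
        ∑ i, ∑ k, a i k x * pd i (pd k v) (ε⁻¹ • x) := by
      rw [← Finset.sum_add_distrib]
      refine Finset.sum_congr rfl fun i _ => ?_
      rw [← Finset.sum_add_distrib]
      exact Finset.sum_congr rfl fun k _ => by simp only [A, Matrix.of_apply]; ring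
    have e2 : ∑ i, ∑ k, a i k x * (ε⁻¹ ^ 2 * pd i (pd k v) (ε⁻¹ • x)) =
        ε⁻¹ ^ 2 * ∑ i, ∑ k, a i k x * pd i (pd k v) (ε⁻¹ • x) := by
      simp only [Finset.mul_sum]
      exact Finset.sum_congr rfl fun i _ => Finset.sum_congr rfl fun k _ => by ring
    have e3 : ∑ i, b i x * ((if i = j then t else 0) + ε⁻¹ * pd i v (ε⁻¹ • x)) =
        t * b j x + ε⁻¹ ^ 2 * ∑ i, ε * b i x * pd i v (ε⁻¹ • x) := by
      simp only [mul_add, Finset.sum_add_distrib, Finset.mul_sum]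
      congr 1
      · simp [mul_comm]
      · exact Finset.sum_congr rfl fun i _ => by field_simp
    rw [e2, e3, ← e1]
    have e4 : ε⁻¹ ^ 2 * ε ^ 2 = 1 := by field_simp
    linear_combination ε⁻¹ ^ 2 * heq - (t * b j x + c x * (s + t * x j) + c x * v (ε⁻¹ • x)) * e4

lemma pd_fun_mul {f g : Pt n → ℝ} {x : Pt n} (hf : DifferentiableAt ℝ f x) (hg : DifferentiableAt ℝ g x) (i : Fin n) :
    pd i (fun y => f y * g y) x = f x * pd i g x + g x * pd i f x := by
  simp [pd, fderiv_fun_mul hf hg]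

lemma pd_fun_sum {ι : Type*} {s : Finset ι} {f : ι → Pt n → ℝ} {x : Pt n} (hf : ∀ j, DifferentiableAt ℝ (f j) x)
    (i : Fin n) : pd i (fun y => ∑ j ∈ s, f j y) x = ∑ j ∈ s, pd i (f j) x := by
  simp [pd, fderiv_fun_sum fun j _ => hf j]

lemma pd_congr {f g : Pt n → ℝ} {x : Pt n} (h : f =ᶠ[nhds x] g) (i : Fin n) : pd i f x = pd i g x := by
  rw [pd, pd, h.fderiv_eq]

lemma pd_linearComb {f g : Pt n → ℝ} {x : Pt n} (hf : DifferentiableAt ℝ f x) (hg : DifferentiableAt ℝ g x)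
    (s t : ℝ) (i : Fin n) : pd i (fun y => s * f y + t * g y) x = s * pd i f x + t * pd i g x := by
  simp [pd, fderiv_fun_add (hf.const_mul s) (hg.const_mul t), fderiv_const_mul hf, fderiv_const_mul hg]

/-- `u` is differentiable near `x`, and its partial derivatives are differentiable at `x`. -/
def TwiceDiff {n : ℕ} (u : Pt n → ℝ) (x : Pt n) : Prop :=
  (∀ᶠ y in nhds x, DifferentiableAt ℝ u y) ∧ ∀ i, DifferentiableAt ℝ (pd i u) x

lemma LocH.eventually_twiceDiff {m : ℕ} {u : Pt n → ℝ} (hu : LocH α (m + 2) u) : ∀ᶠ x in nhds 0, TwiceDiff u x :=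
  hu.eventually_differentiableAt.eventually_nhds.and
    (Filter.eventually_all.2 fun i => (hu.pd i).eventually_differentiableAt)

variable {a : Fin n → Fin n → Pt n → ℝ} {b : Fin n → Pt n → ℝ} {c : Pt n → ℝ} {u v f : Pt n → ℝ} {x : Pt n}

lemma pd_pd_linearComb (hu : TwiceDiff u x) (hv : TwiceDiff v x) (s t : ℝ) (i j : Fin n) :
    pd i (pd j fun y => s * u y + t * v y) x = s * pd i (pd j u) x + t * pd i (pd j v) x := by
  rw [← pd_linearComb (hu.2 j) (hv.2 j)]
  refine pd_congr ?_ i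
  filter_upwards [hu.1, hv.1] with y h1 h2 using pd_linearComb h1 h2 s t j

lemma pertOp_linearComb (hu : TwiceDiff u x) (hv : TwiceDiff v x) (s t : ℝ) :
    pertOp a b c (fun y => s * u y + t * v y) x = s * pertOp a b c u x + t * pertOp a b c v x := by
  simp only [pertOp, pd_pd_linearComb hu hv, pd_linearComb hu.1.self_of_nhds hv.1.self_of_nhds, mul_add,
    Finset.sum_add_distrib, Finset.mul_sum, mul_left_comm s, mul_left_comm t]
  ring

lemma pd_pd_mul (hu : TwiceDiff u x) (hv : TwiceDiff v x) (i j : Fin n) :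
    pd i (pd j fun y => u y * v y) x = u x * pd i (pd j v) x + pd i u x * pd j v x + pd j u x * pd i v x +
      v x * pd i (pd j u) x := by
  have h : (pd j fun y => u y * v y) =ᶠ[nhds x] fun y => 1 * (u y * pd j v y) + 1 * (v y * pd j u y) := by
    filter_upwards [hu.1, hv.1] with y h1 h2
    rw [pd_fun_mul h1 h2, one_mul, one_mul]
  have h1 := hu.1.self_of_nhds
  have h2 := hv.1.self_of_nhds
  rw [pd_congr h, pd_linearComb (h1.fun_mul (hv.2 j)) (h2.fun_mul (hu.2 j)), pd_fun_mul h1 (hv.2 j), pd_fun_mul h2 (hu.2 j)]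
  ring

lemma pertOp_mul (ha : ∀ i j, a i j x = a j i x) (hf : TwiceDiff f x) (hu : TwiceDiff u x) (hx : f x ≠ 0) :
    pertOp a b c (fun y => f y * u y) x =
      f x * pertOp a (fun i y => b i y + ∑ j, 2 * (f y)⁻¹ * a i j y * pd j f y) (fun _ => 0) u x +
        u x * pertOp a b c f x := by
  simp only [pertOp, pd_pd_mul hf hu, pd_fun_mul hf.1.self_of_nhds hu.1.self_of_nhds, mul_add, add_mul,
    Finset.sum_add_distrib, Finset.mul_sum, Finset.sum_mul]
  have h1 : ∑ i, ∑ j, a i j x * (pd i f x * pd j u x) = ∑ i, ∑ j, a i j x * (pd j f x * pd i u x) := by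
    rw [Finset.sum_comm]
    exact Finset.sum_congr rfl fun i _ => Finset.sum_congr rfl fun j _ => by rw [ha]
  have h2 : ∑ i, ∑ j, f x * (2 * (f x)⁻¹ * a i j x * pd j f x * pd i u x) =
      2 * ∑ i, ∑ j, a i j x * (pd j f x * pd i u x) := by
    simp only [Finset.mul_sum]
    exact Finset.sum_congr rfl fun i _ => Finset.sum_congr rfl fun j _ => by field_simp
  rw [h1, h2]
  simp only [mul_left_comm (f x), mul_left_comm (u x)]
  ring

namespace LocH

variable {m : ℕ} {g : Met n}

lemma det (hα : α ∈ Ioo (0 : ℝ) 1) (hg : ∀ i j, LocH α m fun x => g x i j) : LocH α m fun x => (g x).det := by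
  simp only [Matrix.det_apply']
  exact .sum _ fun σ => .smul _ (.prod hα _ fun i => hg (σ i) i)

lemma matrixInv (hα : α ∈ Ioo (0 : ℝ) 1) (hg : ∀ i j, LocH α m fun x => g x i j) (h0 : 0 < (g 0).det) (i j : Fin n) :
    LocH α m fun x => (g x)⁻¹ i j := by
  simp only [Matrix.inv_def, Ring.inverse_eq_inv', Matrix.smul_apply, smul_eq_mul, Matrix.adjugate_apply]
  refine ((LocH.det hα hg).inv hα h0).mul hα (LocH.det hα fun i' j' => ?_)
  by_cases h : i' = j
  · simpa [Matrix.updateRow_apply, h] using LocH.const _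
  · simpa [Matrix.updateRow_apply, h] using hg i' j'

lemma christoffel (hα : α ∈ Ioo (0 : ℝ) 1) (hg : ∀ i j, LocH α (m + 1) fun x => g x i j) (h0 : 0 < (g 0).det)
    (c a b : Fin n) : LocH α m (christoffel g c a b) :=
  .smul _ (.sum _ fun d => .mul hα ((matrixInv hα hg h0 c d).down hα)
    ((((hg b d).pd a).add ((hg a d).pd b)).sub ((hg a b).pd d)))

lemma ricci (hα : α ∈ Ioo (0 : ℝ) 1) (hg : ∀ i j, LocH α (m + 2) fun x => g x i j) (h0 : 0 < (g 0).det)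
    (a b : Fin n) : LocH α m (ricci g a b) := by
  have h := christoffel hα hg h0
  exact (((LocH.sum _ fun c => (h c a b).pd c).sub (.sum _ fun c => (h c c b).pd a)).add
    (.sum _ fun c => .sum _ fun d => ((h c a b).down hα).mul hα ((h d d c).down hα))).sub
    (.sum _ fun c => .sum _ fun d => ((h d c b).down hα).mul hα ((h c a d).down hα))

lemma scalarCurv (hα : α ∈ Ioo (0 : ℝ) 1) (hg : ∀ i j, LocH α (m + 2) fun x => g x i j) (h0 : 0 < (g 0).det) :
    LocH α m (scalarCurv g) :=
  .sum _ fun a => .sum _ fun b => (((matrixInv hα hg h0 a b).down hα).down hα).mul hα (ricci hα hg h0 a b)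

end LocH

/-- First order coefficients of the Laplace–Beltrami operator. -/
def lapDrift {n : ℕ} (g : Met n) (b : Fin n) (x : Pt n) : ℝ :=
  (√(g x).det)⁻¹ * ∑ a, pd a (fun y => √(g y).det * (g y)⁻¹ a b) x

lemma LocH.lapDrift (hα : α ∈ Ioo (0 : ℝ) 1) {m : ℕ} {g : Met n} (hg : ∀ i j, LocH α (m + 1) fun x => g x i j)
    (h0 : 0 < (g 0).det) (b : Fin n) : LocH α m (lapDrift g b) := by
  have h := (LocH.det hα hg).sqrt hα h0
  exact ((h.inv hα (Real.sqrt_pos.2 h0)).down hα).mul hα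
    (.sum _ fun a => (h.mul hα (LocH.matrixInv hα hg h0 a b)).pd a)

/-- The conformal Laplacian in non-divergence form. -/
lemma eventually_confLap_eq (hα : α ∈ Ioo (0 : ℝ) 1) {m : ℕ} {g : Met n} (hg : ∀ i j, LocH α (m + 1) fun x => g x i j)
    (h0 : 0 < (g 0).det) : ∀ᶠ x in nhds 0, ∀ u, TwiceDiff u x → confLap g u x =
      -pertOp (fun i j x => (g x)⁻¹ i j) (lapDrift g)
        (fun x => -((((n : ℝ) - 2) / (4 * ((n : ℝ) - 1))) * scalarCurv g x)) u x := by
  have h := (LocH.det hα hg).sqrt hα h0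
  filter_upwards [Filter.eventually_all.2 fun a => Filter.eventually_all.2 fun b =>
    (h.mul hα (LocH.matrixInv hα hg h0 a b)).eventually_differentiableAt,
    (h.continuousAt hα).eventually_ne (Real.sqrt_pos.2 h0).ne'] with x h1 h2 u hu
  have h3 : ∀ a, pd a (fun y => √(g y).det * ∑ b, (g y)⁻¹ a b * pd b u y) x =
      ∑ b, (√(g x).det * ((g x)⁻¹ a b * pd a (pd b u) x) +
        pd b u x * pd a (fun y => √(g y).det * (g y)⁻¹ a b) x) := fun a => by
    simp only [Finset.mul_sum, ← mul_assoc]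
    rw [pd_fun_sum fun b => (h1 a b).fun_mul (hu.2 b)]
    exact Finset.sum_congr rfl fun b _ => pd_fun_mul (h1 a b) (hu.2 b) a
  simp only [confLap, laplaceBeltrami, h3, pertOp, lapDrift, Finset.sum_add_distrib, ← Finset.mul_sum]
  rw [Finset.sum_comm (f := fun a b => pd b u x * _)]
  simp only [← Finset.mul_sum]
  have h4 : ∑ b, (√(g x).det)⁻¹ * (∑ a, pd a (fun y => √(g y).det * (g y)⁻¹ a b) x) * pd b u x =
      (√(g x).det)⁻¹ * ∑ b, pd b u x * ∑ a, pd a (fun y => √(g y).det * (g y)⁻¹ a b) x := by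
    rw [Finset.mul_sum]
    exact Finset.sum_congr rfl fun b _ => by ring
  rw [h4]
  field_simp
  ring

lemma pd_of_eq_coord {l i j : Fin n} (hil : i ≠ l) (hu : DifferentiableAt ℝ u 0) (h : ∀ x, x l = 0 → u x = x j) :
    pd i u 0 = if i = j then 1 else 0 := by
  have h1 : HasDerivAt (fun t : ℝ => t • (Pi.single i 1 : Pt n)) (Pi.single i 1) 0 := by
    simpa using (hasDerivAt_id (0 : ℝ)).smul_const (Pi.single i 1 : Pt n)
  have h2 := HasFDerivAt.comp_hasDerivAt (f := fun t : ℝ => t • (Pi.single i 1 : Pt n)) 0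
    (by simpa using hu.hasFDerivAt) h1
  have h3 : (u ∘ fun t : ℝ => t • (Pi.single i 1 : Pt n)) = fun t => t * (if i = j then 1 else 0) := by
    ext t
    rw [Function.comp_apply, h _ (by simp [hil.symm])]
    simp [Pi.single_apply, eq_comm]
  rw [h3] at h2
  simpa [pd] using h2.unique ((hasDerivAt_id (0 : ℝ)).mul_const (if i = j then (1 : ℝ) else 0))

lemma eventually_forall_ball {E : Type*} [SeminormedAddCommGroup E] {p : E → Prop} (h : ∀ᶠ x in nhds 0, p x) :
    ∀ᶠ r in nhdsWithin (0 : ℝ) (Ioi 0), ∀ x ∈ Metric.ball (0 : E) r, p x := by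
  obtain ⟨s, hs, hsp⟩ := Metric.eventually_nhds_iff_ball.1 h
  filter_upwards [Ioo_mem_nhdsGT hs] with r hr x hx using hsp x (Metric.ball_subset_ball hr.2.le hx)

lemma eventually_of_lt_norm {l : Fin n} {p : Pt n → Prop} (h : ∃ r > 0, ∀ x, 0 ≤ x l → ‖x‖ < r → p x) :
    ∀ᶠ x in nhds (0 : Pt n), 0 ≤ x l → p x := by
  obtain ⟨r, hr, h⟩ := h
  filter_upwards [Metric.ball_mem_nhds _ hr] with x hx hl using h x hl (by simpa using hx)

/-- A solution of the Dirichlet problem whose boundary values are a coordinate, for each coordinate,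
normalized to have the identity as its Jacobian matrix at the origin. -/
lemma exists_normalized_coordinates (hα : α ∈ Ioo (0 : ℝ) 1) (l : Fin n) {m : ℕ} {a : Fin n → Fin n → Pt n → ℝ}
    {b : Fin n → Pt n → ℝ} (ha : ∀ i k, LocH α m (a i k)) (hb : ∀ i, LocH α m (b i))
    (hs : (Matrix.of fun i k => a i k 0).IsSymm) (hp : (Matrix.of fun i k => a i k 0).PosDef) :
    ∃ Z : Fin n → Pt n → ℝ, (∀ i, LocH α (m + 2) (Z i)) ∧ (∀ x, x l = 0 → ∀ i, Z i x = x i) ∧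
      (∀ i j, pd j (Z i) 0 = if j = i then 1 else 0) ∧
      ∀ i, ∀ᶠ x in nhds 0, 0 ≤ x l → pertOp a b (fun _ => 0) (Z i) x = 0 := by
  choose Y hY hYb hYl hYe using fun j => exists_local_solution hα l j 0 1 ha hb (LocH.const 0) hs hp
  simp only [zero_add, one_mul] at hYb
  have hd : ∀ i, DifferentiableAt ℝ (Y i) 0 := fun i => (hY i).eventually_differentiableAt.self_of_nhds
  have hl : pd l (Y l) 0 ≠ 0 := fun h => by
    have := hYl l
    norm_num [h] at this
  set s : Fin n → ℝ := fun i => if i = l then 0 else 1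
  set t : Fin n → ℝ := fun i => if i = l then (pd l (Y l) 0)⁻¹ else -(pd l (Y i) 0 / pd l (Y l) 0)
  refine ⟨fun i x => s i * Y i x + t i * Y l x, fun i => ((hY i).smul _).add ((hY l).smul _), fun x hx i => ?_,
    fun i j => ?_, fun i => ?_⟩
  · simp only [hYb i x hx, hYb l x hx, hx]
    by_cases h : i = l
    · rw [h, hx]; simp
    · simp [s, h]
  · rw [pd_linearComb (hd i) (hd l)]
    by_cases hj : j = l
    · subst hj
      by_cases h : i = j
      · subst h; simp [s, t, hl]
      · simp [s, t, h, hl, Ne.symm h]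
    · rw [pd_of_eq_coord hj (hd i) (hYb i), pd_of_eq_coord hj (hd l) (hYb l)]
      by_cases h : i = l
      · subst h; simp [hj]
      · simp [s, h, hj]
  · filter_upwards [(hY i).eventually_twiceDiff, (hY l).eventually_twiceDiff, eventually_of_lt_norm (hYe i),
      eventually_of_lt_norm (hYe l)] with x h1 h2 h3 h4 hx
    rw [pertOp_linearComb h1 h2, h3 hx, h4 hx]
    simp

end Schauder

/-- Theorem 2.3, part (3): existence of conformal harmonic boundary coordinates
with prescribed boundary trace. -/
theorem conformal_harmonic_coordinates_exist_boundary
    (n k : ℕ) (hn : 3 ≤ n) (hk : 2 ≤ k) (α : ℝ) (hα : α ∈ Set.Ioo (0 : ℝ) 1)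
    (Ω : Set (Pt n)) (hΩ : IsOpen Ω) (h0 : (0 : Pt n) ∈ Ω)
    (g : Met n) (hgm : IsMetricOn g Ω) (hgr : MetCHolderOn k α Ω g)
    (lastIdx : Fin n) (hlast : (lastIdx : ℕ) = n - 1)
    (D : ℝ → Set (Pt n))
    (hD : ∀ ε, D ε = Metric.closedBall (0 : Pt n) ε ∩ {x : Pt n | 0 ≤ x lastIdx})
    (Γ : ℝ → Set (Pt n))
    (hΓ : ∀ ε, Γ ε = D ε ∩ {x : Pt n | x lastIdx = 0}) :
    ∃ ε > (0 : ℝ), D ε ⊆ Ω ∧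
      ∃ (F : Fin n → Pt n → ℝ) (f : Pt n → ℝ) (W : Set (Pt n)),
        IsOpen W ∧ D ε ⊆ W ∧
        (∀ i, CHolderOn k α W (F i)) ∧ CHolderOn k α W f ∧
        (∀ x ∈ D ε, 0 < f x) ∧
        (∀ i, ∀ x ∈ D ε, confLap g (F i) x = 0) ∧ (∀ x ∈ D ε, confLap g f x = 0) ∧
        ∀ Z : Pt n → Pt n, (∀ x i, Z x i = F i x / f x) →
          jac Z 0 = 1 ∧
          (∃ (Zt : Pt n → Pt n) (W' : Set (Pt n)), IsOpen W' ∧ (0 : Pt n) ∈ W' ∧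
            (∀ i, CHolderOn (k + 1) α W' fun x => Zt x i) ∧
            ∀ x ∈ (D ε \ Γ ε) ∩ W', Zt x = Z x) ∧
          (∀ x ∈ Γ ε, Z x lastIdx = 0) ∧
          (∀ x ∈ Γ ε, ∀ j, j ≠ lastIdx → Z x j = x j) := by
  obtain ⟨m, rfl⟩ := Nat.exists_eq_add_of_le' hk
  have hg : ∀ i j, LocH α (m + 2) fun x => g x i j := fun i j => (hgr i j).locH hα hΩ h0
  have hdet : 0 < (g 0).det := (hgm 0 h0).2.det_pos
  have hG := LocH.matrixInv hα hg hdet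
  have hsymm : ∀ x ∈ Ω, (g x)⁻¹.IsSymm := fun x hx => by
    rw [Matrix.IsSymm, Matrix.transpose_nonsing_inv, (hgm x hx).1]
  have hpos : (g 0)⁻¹.PosDef := (hgm 0 h0).2.inv
  set c : Pt n → ℝ := fun x => -((((n : ℝ) - 2) / (4 * ((n : ℝ) - 1))) * scalarCurv g x)
  have hc : LocH α m c := ((LocH.scalarCurv hα hg hdet).smul _).neg
  obtain ⟨f, hf, hf1, -, hfe⟩ := exists_local_solution hα lastIdx lastIdx 1 0
    (fun i j => (hG i j).downTo hα (by omega)) (fun i => (LocH.lapDrift hα hg hdet i).down hα) hc (hsymm 0 h0) hpos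
  simp only [zero_mul, add_zero] at hf1
  have hf0 : 0 < f 0 := by rw [hf1 0 rfl]; exact one_pos
  obtain ⟨Y, hY, hYb, hYd, hYe⟩ := exists_normalized_coordinates hα lastIdx (fun i j => (hG i j).down hα)
    (fun i => (LocH.lapDrift hα hg hdet i).add (.sum Finset.univ fun j =>
      ((((hf.inv hα hf0).down hα).smul 2).mul hα ((hG i j).down hα)).mul hα (hf.pd j))) (hsymm 0 h0) hpos
  have hfpos : ∀ᶠ x in nhds 0, 0 < f x := (hf.continuousAt hα).eventually_const_lt hf0
  have hF : ∀ i, LocH α (m + 2) fun x => f x * Y i x := fun i => hf.mul hα ((hY i).down hα)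
  have hfL : ∀ᶠ x in nhds 0, 0 ≤ x lastIdx → confLap g f x = 0 := by
    filter_upwards [eventually_confLap_eq hα hg hdet, hf.eventually_twiceDiff, eventually_of_lt_norm hfe]
      with x h1 h2 h3 hx
    rw [h1 f h2, h3 hx, neg_zero]
  have hFL : ∀ i, ∀ᶠ x in nhds 0, 0 ≤ x lastIdx → confLap g (fun x => f x * Y i x) x = 0 := fun i => by
    filter_upwards [eventually_confLap_eq hα hg hdet, hf.eventually_twiceDiff, (hY i).down hα |>.eventually_twiceDiff,
      (hF i).eventually_twiceDiff, eventually_of_lt_norm hfe, hYe i, hfpos, hΩ.mem_nhds h0] with x h1 h2 h3 h4 h5 h6 h7 h8 hx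
    rw [h1 _ h4, pertOp_mul (fun i j => (hsymm x h8).apply j i) h2 h3 h7.ne', h5 hx, h6 hx]
    simp
  have hΩ0 : ∀ᶠ x in nhds 0, x ∈ Ω := hΩ.mem_nhds h0
  obtain ⟨r, ⟨hE, ⟨Cf, hCf⟩, ⟨CF, hCF⟩, ⟨CY, hCY⟩⟩, hr⟩ :=
    (((eventually_forall_ball (hΩ0.and (hfpos.and (hfL.and (Filter.eventually_all.2 hFL))))).and
      (hf.and ((LocH.eventually_family hF).and (LocH.eventually_family hY)))).and self_mem_nhdsWithin).exists
  have hr' : 0 < r := hr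
  have hB := isDom_ball (n := n) hr'
  have hDr : D (r / 2) ⊆ Metric.ball 0 r := by
    rw [hD]
    exact inter_subset_left.trans (Metric.closedBall_subset_ball (half_lt_self hr'))
  have hDl : ∀ x ∈ D (r / 2), 0 ≤ x lastIdx := fun x hx => by rw [hD] at hx; exact hx.2
  have hΓr : ∀ x ∈ Γ (r / 2), x ∈ D (r / 2) ∧ x lastIdx = 0 := fun x hx => by rwa [hΓ] at hx
  refine ⟨r / 2, half_pos hr', fun x hx => (hE x (hDr hx)).1, fun i x => f x * Y i x, f, Metric.ball 0 r,
    Metric.isOpen_ball, hDr, fun i => (hCF i).cHolderOn hα hB, hCf.cHolderOn hα hB, fun x hx => (hE x (hDr hx)).2.1,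
    fun i x hx => (hE x (hDr hx)).2.2.2 i (hDl x hx), fun x hx => (hE x (hDr hx)).2.2.1 (hDl x hx), fun Z hZ => ?_⟩
  have hZY : ∀ x ∈ Metric.ball 0 r, ∀ i, Z x i = Y i x := fun x hx i => by
    rw [hZ, mul_div_cancel_left₀ _ (hE x hx).2.1.ne']
  have hΓY : ∀ x ∈ Γ (r / 2), ∀ i, Z x i = x i := fun x hx i => by
    rw [hZY x (hDr (hΓr x hx).1), hYb x (hΓr x hx).2]
  refine ⟨?_, ⟨fun x i => Y i x, Metric.ball 0 r, Metric.isOpen_ball, Metric.mem_ball_self hr',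
    fun i => (hCY i).cHolderOn hα hB, fun x hx => funext fun i => (hZY x hx.2 i).symm⟩,
    fun x hx => (hΓY x hx _).trans (hΓr x hx).2, fun x hx j _ => hΓY x hx j⟩
  ext i j
  rw [jac, Matrix.of_apply, pd_congr (g := Y i), hYd, Matrix.one_apply]
  · simp only [eq_comm]
  · filter_upwards [Metric.ball_mem_nhds _ hr'] with x hx using hZY x hx i
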